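/- Let f : ℝ → ℝ be a continuous odd function satisfying: (f₁) there is C > 0 with |f(s)| ≤ C·exp(4π s²) for all s ∈ ℝ; (f₂) lim_{s→0} f(s)/s = 0; (H₁) there are s₀ > 0 and M > 0 such that 0 < F(s) ≤ M|f(s)| for all |s| ≥ s₀, where F(s) = ∫₀^s f(t) dt; (H₂) 0 < F(s) ≤ (1/2) f(s) s for all s ≠ 0; (H₃) lim_{s→+∞} s f(s) exp(−4π s²) = +∞. Then for every natural number m ≥ 1 there exists a function u : ℝ² → ℝ, continuous on the closure of the angular sector A_m = { x = (x₁,x₂) ∈ B : cos(π/2^m)·|x₁| < sin(π/2^m)·x₂ }, continuously differentiable on A_m, vanishing on ∂A_m, strictly positive in A_m, and satisfying ∫_{A_m} ⟨∇u(x), ∇φ(x)⟩ dx = ∫_{A_m} f(u(x)) φ(x) dx for every smooth function φ : ℝ² → ℝ with compact support contained in A_m. -/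

import Mathlib

open MeasureTheory Real Filter Metric Set
open scoped Topology RealInnerProductSpace

/-- `primF f s = ∫₀^s f(t) dt`. -/
noncomputable def primF (f : ℝ → ℝ) (s : ℝ) : ℝ := ∫ t in (0:ℝ)..s, f t

/-- The angular sector `A_m = {x ∈ B : cos(π/2^m)·|x₁| < sin(π/2^m)·x₂}` of the
open unit ball `B ⊂ ℝ²`. -/
def sector (m : ℕ) : Set (EuclideanSpace ℝ (Fin 2)) :=
  {x | x ∈ ball (0 : EuclideanSpace ℝ (Fin 2)) 1 ∧
    Real.cos (π / 2 ^ m) * |x 0| < Real.sin (π / 2 ^ m) * x 1}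

section GreenKernel

variable {X : Type*} [MeasurableSpace X]

/-- Bounded measurable real functions. -/
def BddMeasurable (g : X → ℝ) : Prop := Measurable g ∧ ∃ C, ∀ x, |g x| ≤ C

namespace BddMeasurable

variable {g h : X → ℝ}

theorem exists_nonneg_bound (hg : BddMeasurable g) : ∃ C, 0 ≤ C ∧ ∀ x, |g x| ≤ C := by
  obtain ⟨C, hC⟩ := hg.2
  exact ⟨max C 0, le_max_right _ _, fun x => (hC x).trans (le_max_left _ _)⟩

theorem add (hg : BddMeasurable g) (hh : BddMeasurable h) :
    BddMeasurable (fun x => g x + h x) := by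
  obtain ⟨C, hC⟩ := hg.2
  obtain ⟨D, hD⟩ := hh.2
  exact ⟨hg.1.add hh.1, C + D, fun x => (abs_add_le _ _).trans (add_le_add (hC x) (hD x))⟩

theorem const_mul (hg : BddMeasurable g) (c : ℝ) : BddMeasurable (fun x => c * g x) := by
  obtain ⟨C, hC⟩ := hg.2
  refine ⟨hg.1.const_mul c, |c| * C, fun x => ?_⟩
  rw [abs_mul]
  exact mul_le_mul_of_nonneg_left (hC x) (abs_nonneg _)

theorem mul (hg : BddMeasurable g) (hh : BddMeasurable h) :
    BddMeasurable (fun x => g x * h x) := by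
  obtain ⟨C, hC0, hC⟩ := hg.exists_nonneg_bound
  obtain ⟨D, hD⟩ := hh.2
  refine ⟨hg.1.mul hh.1, C * D, fun x => ?_⟩
  rw [abs_mul]
  exact mul_le_mul (hC x) (hD x) (abs_nonneg _) hC0

theorem abs (hg : BddMeasurable g) : BddMeasurable (fun x => |g x|) := by
  obtain ⟨C, hC⟩ := hg.2
  exact ⟨hg.1.abs, C, fun x => by rw [abs_abs]; exact hC x⟩

theorem sub (hg : BddMeasurable g) (hh : BddMeasurable h) :
    BddMeasurable (fun x => g x - h x) := by
  have := hg.add (hh.const_mul (-1))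
  simpa [sub_eq_add_neg] using this

theorem pow (hg : BddMeasurable g) (n : ℕ) : BddMeasurable (fun x => g x ^ n) := by
  obtain ⟨C, hC⟩ := hg.2
  refine ⟨hg.1.pow_const n, C ^ n, fun x => ?_⟩
  rw [abs_pow]
  exact pow_le_pow_left₀ (abs_nonneg _) (hC x) n

theorem integrable (hg : BddMeasurable g) (μ : Measure X) [IsFiniteMeasure μ] :
    Integrable g μ := by
  obtain ⟨C, hC⟩ := hg.2
  exact Integrable.of_bound hg.1.aestronglyMeasurable C (ae_of_all _ hC)

theorem comp_continuous (hg : BddMeasurable g) {φ : ℝ → ℝ} (hφ : Continuous φ) :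
    BddMeasurable (fun x => φ (g x)) := by
  obtain ⟨C, hC⟩ := hg.2
  obtain ⟨D, hD⟩ := (isCompact_Icc (a := -C) (b := C)).exists_bound_of_continuousOn
    hφ.continuousOn
  exact ⟨hφ.measurable.comp hg.1, D, fun x => hD _ (abs_le.mp (hC x))⟩

end BddMeasurable

theorem Continuous.bddMeasurable [TopologicalSpace X] [BorelSpace X] [CompactSpace X]
    {g : X → ℝ} (hg : Continuous g) : BddMeasurable g := by
  refine ⟨hg.measurable, ?_⟩
  obtain ⟨C, hC⟩ := isCompact_univ.exists_bound_of_continuousOn hg.continuousOn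
  exact ⟨C, fun x => hC x (mem_univ x)⟩

/-- The integral operator with kernel `G`. -/
noncomputable def kernelOp (μ : Measure X) (G : X → X → ℝ) (g : X → ℝ) (x : X) : ℝ :=
  ∫ y, G x y * g y ∂μ

/-- The bilinear form `(g, h) ↦ ∫ g · K h` of the integral operator `K` with kernel `G`. -/
noncomputable def kernelForm (μ : Measure X) (G : X → X → ℝ) (g h : X → ℝ) : ℝ :=
  ∫ x, g x * kernelOp μ G h x ∂μ

/-- A symmetric nonnegative kernel with a logarithmic singularity. -/
structure IsLogKernel [TopologicalSpace X] (μ : Measure X) (G : X → X → ℝ) : Prop where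
  measurable : Measurable (Function.uncurry G)
  symm : ∀ x y, G x y = G y x
  nonneg : ∀ x y, 0 ≤ G x y
  exp_bound : ∀ a, a < 4 * π → ∃ C, ∀ x,
    Integrable (fun y => Real.exp (a * G x y)) μ ∧ ∫ y, Real.exp (a * G x y) ∂μ ≤ C
  ae_continuousAt : ∀ x, ∀ᵐ y ∂μ, ContinuousAt (fun x' => G x' y) x

/-- A symmetric, nonnegative, positive semidefinite kernel with a logarithmic singularity. -/
structure IsGreenKernel [TopologicalSpace X] (μ : Measure X) (G : X → X → ℝ) : Prop
    extends IsLogKernel μ G where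
  posSemidef : ∀ g, BddMeasurable g → 0 ≤ kernelForm μ G g g

namespace IsLogKernel

variable [MetricSpace X] [CompactSpace X] [BorelSpace X] {μ : Measure X} [IsFiniteMeasure μ]
  {G : X → X → ℝ}

theorem measurable_left (hG : IsLogKernel μ G) (x : X) : Measurable (G x) :=
  hG.measurable.comp measurable_prodMk_left

theorem integrable_pow (hG : IsLogKernel μ G) {a : ℝ} (ha0 : 0 < a) (ha : a < 4 * π)
    (j : ℕ) (x : X) : Integrable (fun y => G x y ^ j) μ := by
  obtain ⟨C, hC⟩ := hG.exp_bound a ha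
  refine Integrable.mono' ((hC x).1.const_mul (j.factorial / a ^ j))
    ((hG.measurable_left x).pow_const j).aestronglyMeasurable (ae_of_all _ fun y => ?_)
  have h1 := Real.pow_div_factorial_le_exp (a * G x y) (mul_nonneg ha0.le (hG.nonneg x y)) j
  rw [mul_pow, div_le_iff₀ (by positivity)] at h1
  rw [Real.norm_eq_abs, abs_of_nonneg (pow_nonneg (hG.nonneg x y) j), div_mul_eq_mul_div,
    le_div_iff₀ (by positivity)]
  linarith

theorem exists_integral_pow_le (hG : IsLogKernel μ G) {a : ℝ} (ha0 : 0 < a) (ha : a < 4 * π) :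
    ∃ C, 1 ≤ C ∧ ∀ (j : ℕ) (x : X), ∫ y, G x y ^ j ∂μ ≤ C * (j.factorial / a ^ j) := by
  obtain ⟨C, hC⟩ := hG.exp_bound a ha
  refine ⟨max C 1, le_max_right _ _, fun j x => ?_⟩
  have h2 : ∫ y, G x y ^ j ∂μ ≤ ∫ y, (j.factorial / a ^ j) * Real.exp (a * G x y) ∂μ := by
    refine integral_mono (hG.integrable_pow ha0 ha j x) ((hC x).1.const_mul _) fun y => ?_
    have h1 := Real.pow_div_factorial_le_exp (a * G x y) (mul_nonneg ha0.le (hG.nonneg x y)) j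
    rw [mul_pow, div_le_iff₀ (by positivity)] at h1
    simp only
    rw [div_mul_eq_mul_div, le_div_iff₀ (by positivity)]
    linarith
  rw [integral_const_mul] at h2
  refine h2.trans ?_
  rw [mul_comm]
  exact mul_le_mul_of_nonneg_right ((hC x).2.trans (le_max_left _ _)) (by positivity)

theorem integrable_left (hG : IsLogKernel μ G) (x : X) : Integrable (G x) μ := by
  simpa using hG.integrable_pow Real.pi_pos (by linarith [Real.pi_pos]) 1 x

theorem integrable_mul (hG : IsLogKernel μ G) {g : X → ℝ} (hg : BddMeasurable g) (x : X) :
    Integrable (fun y => G x y * g y) μ := by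
  obtain ⟨C, hC⟩ := hg.2
  exact (hG.integrable_left x).mul_bdd hg.1.aestronglyMeasurable (ae_of_all _ hC)

theorem integral_abs_sub_tendsto (hG : IsLogKernel μ G) (x : X) :
    Tendsto (fun x' => ∫ y, |G x' y - G x y| ∂μ) (𝓝 x) (𝓝 0) := by
  have hpi := Real.pi_pos
  obtain ⟨C, hC1, hC⟩ := hG.exists_integral_pow_le hpi (by linarith)
  have hi1 := fun z => hG.integrable_left z
  have hi2 : ∀ z, Integrable (fun y => G z y ^ 2) μ := fun z =>
    hG.integrable_pow hpi (by linarith) 2 z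
  have hD : ∀ z, ∫ y, G z y ^ 2 ∂μ ≤ C := fun z => by
    refine (hC 2 z).trans (mul_le_of_le_one_right (by linarith) ?_)
    rw [div_le_one (by positivity)]
    norm_num [Nat.factorial]
    nlinarith [Real.pi_gt_three]
  rw [Metric.tendsto_nhds]
  intro ε hε
  obtain ⟨M, hM0, hM⟩ : ∃ M : ℝ, 0 < M ∧ 2 * C / M < ε / 2 := by
    refine ⟨4 * C / ε + 1, by positivity, ?_⟩
    rw [div_lt_iff₀ (by positivity)]
    field_simp
    nlinarith
  have hmin : Tendsto (fun x' => ∫ y, |min (G x' y) M - min (G x y) M| ∂μ) (𝓝 x) (𝓝 0) := by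
    have : Tendsto (fun x' => ∫ y, |min (G x' y) M - min (G x y) M| ∂μ) (𝓝 x)
        (𝓝 (∫ _, (0 : ℝ) ∂μ)) := by
      refine tendsto_integral_filter_of_dominated_convergence (fun _ => M) ?_ ?_
        (integrable_const M) ?_
      · refine Eventually.of_forall fun z => ?_
        exact (((hG.measurable_left z).min measurable_const).sub
          ((hG.measurable_left x).min measurable_const)).abs.aestronglyMeasurable
      · refine Eventually.of_forall fun z => ae_of_all _ fun y => ?_
        rw [Real.norm_eq_abs, abs_abs, abs_le]
        have h1 := hG.nonneg z y
        have h2 := hG.nonneg x y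
        have h3 : 0 ≤ min (G z y) M := le_min h1 hM0.le
        have h4 : 0 ≤ min (G x y) M := le_min h2 hM0.le
        constructor <;> linarith [min_le_right (G z y) M, min_le_right (G x y) M]
      · filter_upwards [hG.ae_continuousAt x] with y hy
        have h5 : ContinuousAt (fun x' => |min (G x' y) M - min (G x y) M|) x :=
          ((hy.min continuousAt_const).sub continuousAt_const).abs
        simpa [ContinuousAt] using h5
    simpa using this
  rw [Metric.tendsto_nhds] at hmin
  filter_upwards [hmin (ε / 2) (by linarith)] with z hz
  rw [Real.dist_eq, sub_zero] at hz ⊢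
  rw [abs_of_nonneg (integral_nonneg fun y => abs_nonneg _)] at hz ⊢
  have hpt : ∀ t : ℝ, 0 ≤ t → |t - min t M| ≤ t ^ 2 / M := by
    intro t ht
    rcases le_total t M with h | h
    · rw [min_eq_left h, sub_self, abs_zero]
      positivity
    · rw [min_eq_right h, abs_of_nonneg (by linarith), le_div_iff₀ hM0]
      nlinarith
  have hint : Integrable (fun y => |min (G z y) M - min (G x y) M|) μ :=
    ((hi1 z).inf (integrable_const M)).sub ((hi1 x).inf (integrable_const M)) |>.abs
  calc ∫ y, |G z y - G x y| ∂μ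
      ≤ ∫ y, (|min (G z y) M - min (G x y) M| + (G z y ^ 2 / M + G x y ^ 2 / M)) ∂μ := by
        refine integral_mono ((hi1 z).sub (hi1 x)).abs
          (hint.add (((hi2 z).div_const M).add ((hi2 x).div_const M))) fun y => ?_
        have e1 := hpt _ (hG.nonneg z y)
        have e2 := hpt _ (hG.nonneg x y)
        have e3 : G z y - G x y = (min (G z y) M - min (G x y) M) +
          ((G z y - min (G z y) M) - (G x y - min (G x y) M)) := by ring
        simp only
        calc |G z y - G x y| = _ := by rw [e3]
          _ ≤ |min (G z y) M - min (G x y) M| +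
              |(G z y - min (G z y) M) - (G x y - min (G x y) M)| := abs_add_le _ _
          _ ≤ _ := by
            have := abs_sub (G z y - min (G z y) M) (G x y - min (G x y) M)
            linarith
    _ = (∫ y, |min (G z y) M - min (G x y) M| ∂μ) +
          ((∫ y, G z y ^ 2 ∂μ) / M + (∫ y, G x y ^ 2 ∂μ) / M) := by
        have hq : Integrable (fun y => G z y ^ 2 / M + G x y ^ 2 / M) μ :=
          ((hi2 z).div_const M).add ((hi2 x).div_const M)
        rw [integral_add hint hq, integral_add ((hi2 z).div_const M) ((hi2 x).div_const M), integral_div, integral_div]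
    _ < ε := by
        have : (∫ y, G z y ^ 2 ∂μ) / M + (∫ y, G x y ^ 2 ∂μ) / M ≤ 2 * C / M := by
          rw [← add_div]
          gcongr
          linarith [hD z, hD x]
        linarith

theorem abs_kernelOp_sub_le (hG : IsLogKernel μ G) {g : X → ℝ} (hg : Measurable g) {C : ℝ}
    (hC : ∀ x, |g x| ≤ C) (x x' : X) :
    |kernelOp μ G g x' - kernelOp μ G g x| ≤ (∫ y, |G x' y - G x y| ∂μ) * C := by
  have hb : BddMeasurable g := ⟨hg, C, hC⟩
  unfold kernelOp
  rw [← integral_sub (hG.integrable_mul hb x') (hG.integrable_mul hb x), ← integral_mul_const]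
  refine (abs_integral_le_integral_abs).trans (integral_mono ?_ ?_ fun y => ?_)
  · exact ((hG.integrable_mul hb x').sub (hG.integrable_mul hb x)).abs
  · exact (((hG.integrable_left x').sub (hG.integrable_left x)).abs).mul_const C
  · simp only
    rw [← sub_mul, abs_mul]
    exact mul_le_mul_of_nonneg_left (hC y) (abs_nonneg _)

theorem continuous_kernelOp (hG : IsLogKernel μ G) {g : X → ℝ} (hg : BddMeasurable g) :
    Continuous (kernelOp μ G g) := by
  obtain ⟨C, hC⟩ := hg.2
  rw [continuous_iff_continuousAt]
  intro x
  have h1 := (hG.integral_abs_sub_tendsto x).mul_const C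
  rw [zero_mul] at h1
  rw [ContinuousAt, tendsto_iff_dist_tendsto_zero]
  refine squeeze_zero (fun _ => dist_nonneg) (fun x' => ?_) h1
  rw [Real.dist_eq]
  exact hG.abs_kernelOp_sub_le hg.1 hC x x'

theorem bddMeasurable_kernelOp (hG : IsLogKernel μ G) {g : X → ℝ} (hg : BddMeasurable g) :
    BddMeasurable (kernelOp μ G g) :=
  (hG.continuous_kernelOp hg).bddMeasurable

theorem kernelOp_nonneg (hG : IsLogKernel μ G) {g : X → ℝ} (hg : ∀ x, 0 ≤ g x) (x : X) :
    0 ≤ kernelOp μ G g x :=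
  integral_nonneg fun y => mul_nonneg (hG.nonneg x y) (hg y)

theorem kernelOp_add (hG : IsLogKernel μ G) {g h : X → ℝ} (hg : BddMeasurable g)
    (hh : BddMeasurable h) (x : X) :
    kernelOp μ G (fun y => g y + h y) x = kernelOp μ G g x + kernelOp μ G h x := by
  unfold kernelOp
  rw [← integral_add (hG.integrable_mul hg x) (hG.integrable_mul hh x)]
  simp only [mul_add]

theorem kernelOp_const_mul (g : X → ℝ) (c : ℝ) (x : X) :
    kernelOp μ G (fun y => c * g y) x = c * kernelOp μ G g x := by
  unfold kernelOp
  rw [← integral_const_mul]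
  congr 1 with y
  ring

theorem kernelOp_sub (hG : IsLogKernel μ G) {g h : X → ℝ} (hg : BddMeasurable g)
    (hh : BddMeasurable h) (x : X) :
    kernelOp μ G (fun y => g y - h y) x = kernelOp μ G g x - kernelOp μ G h x := by
  unfold kernelOp
  rw [← integral_sub (hG.integrable_mul hg x) (hG.integrable_mul hh x)]
  simp only [mul_sub]

theorem integrable_prod_pow_mul (hG : IsLogKernel μ G) {g h : X → ℝ} (hg : BddMeasurable g)
    (hh : BddMeasurable h) (j : ℕ) :
    Integrable (fun p : X × X => g p.1 * (G p.1 p.2 ^ j * h p.2)) (μ.prod μ) := by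
  have hpi := Real.pi_pos
  obtain ⟨C, hC⟩ := hg.2
  obtain ⟨D, hD⟩ := hh.2
  obtain ⟨A, -, hA⟩ := hG.exists_integral_pow_le hpi (by linarith)
  have hm : Measurable (fun p : X × X => G p.1 p.2 ^ j) := hG.measurable.pow_const j
  have hI : Integrable (fun p : X × X => G p.1 p.2 ^ j) (μ.prod μ) := by
    rw [integrable_prod_iff hm.aestronglyMeasurable]
    refine ⟨ae_of_all _ fun x => hG.integrable_pow hpi (by linarith) j x, ?_⟩
    refine Integrable.of_bound
      (hm.stronglyMeasurable.norm.integral_prod_right).aestronglyMeasurable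
      (A * (j.factorial / π ^ j)) (ae_of_all _ fun x => ?_)
    rw [Real.norm_eq_abs, abs_of_nonneg (integral_nonneg fun y => norm_nonneg _)]
    refine le_trans (le_of_eq ?_) (hA j x)
    congr 1 with y
    exact Real.norm_of_nonneg (pow_nonneg (hG.nonneg _ _) j)
  have h1 : Integrable (fun p : X × X => G p.1 p.2 ^ j * h p.2) (μ.prod μ) :=
    hI.mul_bdd (hh.1.comp measurable_snd).aestronglyMeasurable (ae_of_all _ fun p => hD p.2)
  exact h1.bdd_mul (hg.1.comp measurable_fst).aestronglyMeasurable (ae_of_all _ fun p => hC p.1)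

theorem integrable_prod_mul (hG : IsLogKernel μ G) {g h : X → ℝ} (hg : BddMeasurable g)
    (hh : BddMeasurable h) :
    Integrable (fun p : X × X => g p.1 * (G p.1 p.2 * h p.2)) (μ.prod μ) := by
  simpa using hG.integrable_prod_pow_mul hg hh 1

theorem kernelForm_eq_integral_prod (hG : IsLogKernel μ G) {g h : X → ℝ}
    (hg : BddMeasurable g) (hh : BddMeasurable h) :
    kernelForm μ G g h = ∫ p : X × X, g p.1 * (G p.1 p.2 * h p.2) ∂(μ.prod μ) := by
  rw [integral_prod _ (hG.integrable_prod_mul hg hh)]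
  unfold kernelForm kernelOp
  congr 1 with x
  exact (integral_const_mul _ _).symm

theorem kernelForm_comm (hG : IsLogKernel μ G) {g h : X → ℝ} (hg : BddMeasurable g)
    (hh : BddMeasurable h) : kernelForm μ G g h = kernelForm μ G h g := by
  rw [hG.kernelForm_eq_integral_prod hg hh, hG.kernelForm_eq_integral_prod hh hg,
    ← integral_prod_swap]
  congr 1 with p
  simp only [Prod.fst_swap, Prod.snd_swap]
  rw [hG.symm p.2 p.1]
  ring

theorem kernelForm_add_left (hG : IsLogKernel μ G) {g h k : X → ℝ} (hg : BddMeasurable g)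
    (hh : BddMeasurable h) (hk : BddMeasurable k) :
    kernelForm μ G (fun x => g x + h x) k = kernelForm μ G g k + kernelForm μ G h k := by
  have hK := hG.bddMeasurable_kernelOp hk
  unfold kernelForm
  rw [← integral_add ((hg.mul hK).integrable μ) ((hh.mul hK).integrable μ)]
  simp only [add_mul]

theorem kernelForm_const_mul_left (g k : X → ℝ) (c : ℝ) :
    kernelForm μ G (fun x => c * g x) k = c * kernelForm μ G g k := by
  unfold kernelForm
  rw [← integral_const_mul]
  congr 1 with y
  ring

theorem kernelForm_add_mul_self (hG : IsLogKernel μ G) {g h : X → ℝ} (hg : BddMeasurable g)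
    (hh : BddMeasurable h) (t : ℝ) :
    kernelForm μ G (fun x => g x + t * h x) (fun x => g x + t * h x) =
      kernelForm μ G g g + 2 * t * kernelForm μ G h g + t ^ 2 * kernelForm μ G h h := by
  have ht := hh.const_mul t
  have hs := hg.add ht
  rw [hG.kernelForm_add_left hg ht hs, hG.kernelForm_comm hg hs, hG.kernelForm_comm ht hs,
    hG.kernelForm_add_left hg ht hg, hG.kernelForm_add_left hg ht ht,
    kernelForm_const_mul_left, hG.kernelForm_comm hg ht, kernelForm_const_mul_left,
    kernelForm_const_mul_left, hG.kernelForm_comm hh ht, kernelForm_const_mul_left]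
  ring

end IsLogKernel

variable [MetricSpace X] [CompactSpace X] [BorelSpace X] {μ : Measure X} [IsFiniteMeasure μ]
  {G : X → X → ℝ}

theorem IsGreenKernel.kernelForm_sq_le (hG : IsGreenKernel μ G) {g h : X → ℝ} (hg : BddMeasurable g)
    (hh : BddMeasurable h) :
    kernelForm μ G g h ^ 2 ≤ kernelForm μ G g g * kernelForm μ G h h := by
  have h1 : ∀ t : ℝ, 0 ≤ kernelForm μ G g g * (t * t) + (2 * kernelForm μ G g h) * t +
      kernelForm μ G h h := by
    intro t
    have h2 := hG.posSemidef _ (hh.add (hg.const_mul t))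
    rw [hG.kernelForm_add_mul_self hh hg t] at h2
    linarith
  have h3 := discrim_le_zero h1
  unfold discrim at h3
  linarith


end GreenKernel

section GreenKernelEstimates

variable {X : Type*} [MeasurableSpace X]

theorem BddMeasurable.integral_mul_sq_le {μ : Measure X} [IsFiniteMeasure μ] {g h : X → ℝ}
    (hg : BddMeasurable g) (hh : BddMeasurable h) :
    (∫ x, g x * h x ∂μ) ^ 2 ≤ (∫ x, g x ^ 2 ∂μ) * ∫ x, h x ^ 2 ∂μ := by
  have h1 : ∀ t : ℝ, 0 ≤ (∫ x, g x ^ 2 ∂μ) * (t * t) + (2 * ∫ x, g x * h x ∂μ) * t +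
      ∫ x, h x ^ 2 ∂μ := by
    intro t
    have h2 : 0 ≤ ∫ x, (t * g x + h x) ^ 2 ∂μ := integral_nonneg fun x => sq_nonneg _
    have i1 := ((hg.pow 2).const_mul (t * t)).integrable μ
    have i2 := ((hg.mul hh).const_mul (2 * t)).integrable μ
    have i3 := (hh.pow 2).integrable μ
    have h3 : ∫ x, (t * g x + h x) ^ 2 ∂μ =
        ∫ x, ((t * t * g x ^ 2 + 2 * t * (g x * h x)) + h x ^ 2) ∂μ := by
      congr 1 with x
      ring
    have i12 : Integrable (fun x => t * t * g x ^ 2 + 2 * t * (g x * h x)) μ := i1.add i2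
    rw [h3, integral_add i12 i3, integral_add i1 i2, integral_const_mul, integral_const_mul] at h2
    linarith
  have h3 := discrim_le_zero h1
  unfold discrim at h3
  linarith

theorem young_pow_succ {q r : ℝ} (hq : 0 ≤ q) (hr : 0 ≤ r) (i : ℕ) :
    (i + 1) * q ^ i * r ≤ r ^ (i + 1) + i * q ^ (i + 1) := by
  induction i with
  | zero => simp
  | succ i ih =>
    have h1 : 0 ≤ (r ^ (i + 1) - q ^ (i + 1)) * (r - q) := by
      rcases le_total q r with h | h
      · exact mul_nonneg (sub_nonneg.2 (pow_le_pow_left₀ hq h _)) (sub_nonneg.2 h)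
      · exact mul_nonneg_of_nonpos_of_nonpos (sub_nonpos.2 (pow_le_pow_left₀ hr h _))
          (sub_nonpos.2 h)
    have h2 := mul_le_mul_of_nonneg_left ih hq
    push_cast
    ring_nf at h1 h2 ⊢
    linarith

theorem mul_pow_mul_pow_le {r : ℝ} (hr : 0 ≤ r) (v w : ℝ) (i : ℕ) :
    2 * (i + 1) * (v ^ (2 * i + 1) * (r * w ^ (2 * i + 1))) ≤
      v ^ (2 * (i + 1)) * r ^ (i + 1) + r ^ (i + 1) * w ^ (2 * (i + 1)) +
        2 * i * (v ^ (2 * (i + 1)) * w ^ (2 * (i + 1))) := by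
  have hq : 0 ≤ |v * w| := abs_nonneg _
  have h1 := young_pow_succ hq hr i
  have h2 : (v * w) ^ (2 * i + 1) ≤ |v * w| ^ (2 * i + 1) := by
    rw [← abs_pow]; exact le_abs_self _
  have h3 : 2 * |v * w| ^ (i + 1) ≤ v ^ (2 * (i + 1)) + w ^ (2 * (i + 1)) := by
    have := two_mul_le_add_sq (|v| ^ (i + 1)) (|w| ^ (i + 1))
    rw [abs_mul, mul_pow]
    have e1 : v ^ (2 * (i + 1)) = (|v| ^ (i + 1)) ^ 2 := by
      rw [← pow_mul, mul_comm (i + 1) 2, pow_mul, pow_mul, sq_abs]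
    have e2 : w ^ (2 * (i + 1)) = (|w| ^ (i + 1)) ^ 2 := by
      rw [← pow_mul, mul_comm (i + 1) 2, pow_mul, pow_mul, sq_abs]
    rw [e1, e2]
    linarith
  have h4 : v ^ (2 * (i + 1)) * w ^ (2 * (i + 1)) = |v * w| ^ (2 * (i + 1)) := by
    rw [← mul_pow, pow_mul, pow_mul, sq_abs]
  have h5 := mul_le_mul_of_nonneg_left h1 (pow_nonneg hq (i + 1))
  have h6 := mul_le_mul_of_nonneg_left h3 (pow_nonneg hr (i + 1))
  have h7 := mul_le_mul_of_nonneg_left h2 (mul_nonneg (by positivity : (0:ℝ) ≤ 2 * (i + 1)) hr)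
  rw [h4]
  have e3 : 2 * ((i : ℝ) + 1) * (v ^ (2 * i + 1) * (r * w ^ (2 * i + 1))) =
      2 * (i + 1) * r * (v * w) ^ (2 * i + 1) := by rw [mul_pow]; ring
  rw [e3]
  refine h7.trans ?_
  have e4 : |v * w| ^ (2 * (i + 1)) = |v * w| ^ (i + 1) * |v * w| ^ (i + 1) := by ring
  have e5 : |v * w| ^ (2 * i + 1) = |v * w| ^ (i + 1) * |v * w| ^ i := by ring
  rw [e4, e5]
  linarith

namespace IsGreenKernel

variable [MetricSpace X] [CompactSpace X] [BorelSpace X] {μ : Measure X} [IsFiniteMeasure μ]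
  {G : X → X → ℝ}

theorem kernelForm_pow_le (hG : IsGreenKernel μ G) {w : X → ℝ} (hw : BddMeasurable w) (i : ℕ)
    {A : ℝ} (hA : ∀ x, ∫ y, G x y ^ (i + 1) ∂μ ≤ A) (hwA : ∫ x, w x ^ (2 * (i + 1)) ∂μ = A) :
    kernelForm μ G (fun x => w x ^ (2 * i + 1)) (fun x => w x ^ (2 * i + 1)) ≤ A ^ 2 := by
  have hψ := hw.pow (2 * i + 1)
  have hE := hw.pow (2 * (i + 1))
  have h1 : BddMeasurable (fun _ : X => (1 : ℝ)) := ⟨measurable_const, 1, fun _ => by simp⟩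
  have hEnn : ∀ x, 0 ≤ w x ^ (2 * (i + 1)) := fun x => by
    rw [pow_mul]; exact pow_nonneg (sq_nonneg _) _
  have hA0 : 0 ≤ A := hwA ▸ integral_nonneg hEnn
  have I1 := hG.integrable_prod_pow_mul hE h1 (i + 1)
  have I2 := hG.integrable_prod_pow_mul h1 hE (i + 1)
  have I3 : Integrable (fun p : X × X => w p.1 ^ (2 * (i + 1)) * w p.2 ^ (2 * (i + 1)))
      (μ.prod μ) := (hE.integrable μ).mul_prod (hE.integrable μ)
  have V1 : ∫ p : X × X, w p.1 ^ (2 * (i + 1)) * (G p.1 p.2 ^ (i + 1) * 1) ∂(μ.prod μ)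
      ≤ A * A := by
    rw [integral_prod _ I1]
    have : ∀ x, ∫ y, w x ^ (2 * (i + 1)) * (G x y ^ (i + 1) * 1) ∂μ ≤
        w x ^ (2 * (i + 1)) * A := fun x => by
      simp only [mul_one]
      rw [integral_const_mul]
      exact mul_le_mul_of_nonneg_left (hA x) (hEnn x)
    refine (integral_mono I1.integral_prod_left ((hE.integrable μ).mul_const A) this).trans ?_
    rw [integral_mul_const, hwA]
  have V2 : ∫ p : X × X, 1 * (G p.1 p.2 ^ (i + 1) * w p.2 ^ (2 * (i + 1))) ∂(μ.prod μ)
      ≤ A * A := by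
    refine le_trans (le_of_eq ?_) V1
    rw [← integral_prod_swap]
    congr 1 with p
    simp only [Prod.fst_swap, Prod.snd_swap]
    rw [hG.symm p.2 p.1]
    ring
  have V3 : ∫ p : X × X, w p.1 ^ (2 * (i + 1)) * w p.2 ^ (2 * (i + 1)) ∂(μ.prod μ) = A * A := by
    rw [integral_prod_mul (fun x => w x ^ (2 * (i + 1))) (fun x => w x ^ (2 * (i + 1))), hwA]
  have hmain : 2 * ((i : ℝ) + 1) * kernelForm μ G (fun x => w x ^ (2 * i + 1))
      (fun x => w x ^ (2 * i + 1)) ≤ A * A + A * A + 2 * i * (A * A) := by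
    rw [hG.kernelForm_eq_integral_prod hψ hψ, ← integral_const_mul]
    calc _ ≤ ∫ p : X × X, ((w p.1 ^ (2 * (i + 1)) * (G p.1 p.2 ^ (i + 1) * 1) +
            1 * (G p.1 p.2 ^ (i + 1) * w p.2 ^ (2 * (i + 1)))) +
            2 * i * (w p.1 ^ (2 * (i + 1)) * w p.2 ^ (2 * (i + 1)))) ∂(μ.prod μ) := by
          refine integral_mono ((hG.integrable_prod_mul hψ hψ).const_mul _)
            ((I1.add I2).add (I3.const_mul _)) fun p => ?_
          have := mul_pow_mul_pow_le (hG.nonneg p.1 p.2) (w p.1) (w p.2) i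
          simpa using this
      _ ≤ _ := by
          have I12 : Integrable (fun p : X × X => w p.1 ^ (2 * (i + 1)) *
            (G p.1 p.2 ^ (i + 1) * 1) + 1 * (G p.1 p.2 ^ (i + 1) * w p.2 ^ (2 * (i + 1))))
            (μ.prod μ) := I1.add I2
          rw [integral_add I12 (I3.const_mul _), integral_add I1 I2, integral_const_mul (2 * (i:ℝ)), V3]
          linarith
  have hpos : (0 : ℝ) < 2 * (i + 1) := by positivity
  refine le_of_mul_le_mul_left (hmain.trans (le_of_eq ?_)) hpos
  ring

theorem integral_kernelOp_pow_le_of_bound (hG : IsGreenKernel μ G) {g : X → ℝ}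
    (hg : BddMeasurable g) (i : ℕ) {A : ℝ} (hA0 : 0 < A)
    (hA : ∀ x, ∫ y, G x y ^ (i + 1) ∂μ ≤ A) :
    ∫ x, kernelOp μ G g x ^ (2 * (i + 1)) ∂μ ≤ A * kernelForm μ G g g ^ (i + 1) := by
  set v := kernelOp μ G g with hv
  have hvb : BddMeasurable v := hG.bddMeasurable_kernelOp hg
  set I := ∫ x, v x ^ (2 * (i + 1)) ∂μ with hI
  have hQ := hG.posSemidef g hg
  rcases le_or_gt I 0 with h0 | h0
  · exact h0.trans (by positivity)
  set c : ℝ := (A / I) ^ (1 / ((2 * (i + 1) : ℕ) : ℝ)) with hc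
  have hcpow : c ^ (2 * (i + 1)) = A / I := by
    rw [hc, ← Real.rpow_natCast, ← Real.rpow_mul (by positivity)]
    rw [one_div, inv_mul_cancel₀ (by positivity), Real.rpow_one]
  have hw : BddMeasurable (fun x => c * v x) := hvb.const_mul c
  have hwA : ∫ x, (c * v x) ^ (2 * (i + 1)) ∂μ = A := by
    simp only [mul_pow]
    rw [integral_const_mul, hcpow, ← hI]
    field_simp
  have h1 := hG.kernelForm_pow_le hw i hA hwA
  have h2 := hG.kernelForm_sq_le (hw.pow (2 * i + 1)) hg
  have h3 : c * kernelForm μ G (fun x => (c * v x) ^ (2 * i + 1)) g = A := by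
    rw [← hwA]
    unfold kernelForm
    rw [← integral_const_mul]
    congr 1 with x
    rw [← hv]
    ring
  have h4 : A ^ 2 ≤ c ^ 2 * (A ^ 2 * kernelForm μ G g g) := by
    calc A ^ 2 = c ^ 2 * kernelForm μ G (fun x => (c * v x) ^ (2 * i + 1)) g ^ 2 := by
          rw [← mul_pow, h3]
      _ ≤ c ^ 2 * (A ^ 2 * kernelForm μ G g g) := by
          refine mul_le_mul_of_nonneg_left (h2.trans ?_) (sq_nonneg c)
          exact mul_le_mul_of_nonneg_right h1 hQ
  have h5 : 1 ≤ c ^ 2 * kernelForm μ G g g := by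
    have : A ^ 2 * 1 ≤ A ^ 2 * (c ^ 2 * kernelForm μ G g g) := by linarith
    exact le_of_mul_le_mul_left this (by positivity)
  have h6 := one_le_pow₀ (n := i + 1) h5
  rw [mul_pow, ← pow_mul, hcpow, div_mul_eq_mul_div, le_div_iff₀ h0, one_mul] at h6
  exact h6

theorem exists_integral_kernelOp_pow_le (hG : IsGreenKernel μ G) {a : ℝ} (ha0 : 0 < a)
    (ha : a < 4 * π) :
    ∃ C, 1 ≤ C ∧ ∀ (j : ℕ), 1 ≤ j → ∀ g, BddMeasurable g →
      ∫ x, kernelOp μ G g x ^ (2 * j) ∂μ ≤ C * (j.factorial / a ^ j) * kernelForm μ G g g ^ j := by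
  obtain ⟨C, hC1, hC⟩ := hG.exists_integral_pow_le ha0 ha
  refine ⟨C, hC1, fun j hj g hg => ?_⟩
  obtain ⟨i, rfl⟩ : ∃ i, j = i + 1 := ⟨j - 1, by omega⟩
  exact hG.integral_kernelOp_pow_le_of_bound hg i (by positivity) (hC (i + 1))

/-- A constant `C` with `‖K g‖_{2j}^{2j} ≤ C ⟨g, K g⟩^j`. -/
theorem exists_integral_kernelOp_pow_le' (hG : IsGreenKernel μ G) (j : ℕ) (hj : 1 ≤ j) :
    ∃ C, 1 ≤ C ∧ ∀ g, BddMeasurable g →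
      ∫ x, kernelOp μ G g x ^ (2 * j) ∂μ ≤ C * kernelForm μ G g g ^ j := by
  have hpi := Real.pi_pos
  obtain ⟨C, hC1, hC⟩ := hG.exists_integral_kernelOp_pow_le hpi (by linarith)
  refine ⟨max 1 (C * (j.factorial / π ^ j)), le_max_left _ _, fun g hg => ?_⟩
  refine (hC j hj g hg).trans (mul_le_mul_of_nonneg_right (le_max_right _ _) ?_)
  exact pow_nonneg (hG.posSemidef g hg) _

/-- The subcritical Trudinger–Moser inequality. -/
theorem exists_integral_exp_le (hG : IsGreenKernel μ G) {b q : ℝ} (hb : 0 ≤ b) (hq : 0 ≤ q)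
    (hbq : b * q < 4 * π) :
    ∃ C, ∀ g, BddMeasurable g → kernelForm μ G g g ≤ q →
      ∫ x, Real.exp (b * kernelOp μ G g x ^ 2) ∂μ ≤ C := by
  have hpi := Real.pi_pos
  obtain ⟨a, ha1, ha2⟩ := exists_between hbq
  have ha0 : 0 < a := (mul_nonneg hb hq).trans_lt ha1
  obtain ⟨C, hC1, hC⟩ := hG.exists_integral_kernelOp_pow_le ha0 ha2
  set D := max C (μ.real univ) with hD
  have hD0 : 0 ≤ D := le_trans (by linarith) (le_max_left _ _)
  set θ := b * q / a with hθ
  have hθ0 : 0 ≤ θ := by positivity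
  have hθ1 : θ < 1 := (div_lt_one ha0).2 ha1
  have hsum : Summable fun j : ℕ => D * θ ^ j :=
    (summable_geometric_of_lt_one hθ0 hθ1).mul_left D
  refine ⟨∑' j : ℕ, D * θ ^ j, fun g hg hgq => ?_⟩
  set v := kernelOp μ G g with hv
  have hvb : BddMeasurable v := hG.bddMeasurable_kernelOp hg
  set F : ℕ → X → ℝ := fun j x => (b * v x ^ 2) ^ j / j.factorial with hF
  have hFi : ∀ j, Integrable (F j) μ := fun j =>
    ((((hvb.pow 2).const_mul b).pow j).integrable μ).div_const _
  have hF0 : ∀ j x, 0 ≤ F j x := fun j x => by positivity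
  have hQ := hG.posSemidef g hg
  have hFle : ∀ j, ∫ x, F j x ∂μ ≤ D * θ ^ j := by
    intro j
    rcases Nat.eq_zero_or_pos j with rfl | hj
    · simp [hF, hD]
    · have e1 : ∫ x, F j x ∂μ = b ^ j / j.factorial * ∫ x, v x ^ (2 * j) ∂μ := by
        rw [← integral_const_mul]
        congr 1 with x
        simp only [hF]
        rw [mul_pow, pow_mul]
        ring
      rw [e1]
      calc b ^ j / j.factorial * ∫ x, v x ^ (2 * j) ∂μ
          ≤ b ^ j / j.factorial * (C * (j.factorial / a ^ j) * kernelForm μ G g g ^ j) :=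
            mul_le_mul_of_nonneg_left (hC j hj g hg) (by positivity)
        _ ≤ b ^ j / j.factorial * (D * (j.factorial / a ^ j) * q ^ j) := by
            gcongr
            exact le_max_left _ _
        _ = D * θ ^ j := by
            rw [hθ, div_pow, mul_pow]
            field_simp
  have hnorm : ∀ j, ∫ x, ‖F j x‖ ∂μ = ∫ x, F j x ∂μ := fun j => by
    congr 1 with x
    exact Real.norm_of_nonneg (hF0 j x)
  have hFs : Summable fun j => ∫ x, F j x ∂μ :=
    Summable.of_nonneg_of_le (fun j => integral_nonneg (hF0 j)) hFle hsum
  have hH := hasSum_integral_of_summable_integral_norm hFi (by simpa only [hnorm] using hFs)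
  have hexp : ∀ x, ∑' j, F j x = Real.exp (b * v x ^ 2) := fun x => by
    rw [Real.exp_eq_exp_ℝ, NormedSpace.exp_eq_tsum_div]
  simp only [hexp] at hH
  rw [← hH.tsum_eq]
  exact hFs.tsum_le_tsum hFle hsum

theorem exists_integral_pow_four_mul_exp_le (hG : IsGreenKernel μ G) :
    ∃ C, 0 ≤ C ∧ ∀ g, BddMeasurable g → kernelForm μ G g g ≤ 1 / 4 →
      ∫ x, kernelOp μ G g x ^ 4 * Real.exp (4 * π * kernelOp μ G g x ^ 2) ∂μ ≤
        C * kernelForm μ G g g ^ 2 := by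
  have hpi := Real.pi_pos
  obtain ⟨C, hC⟩ := hG.exists_integral_exp_le (b := 8 * π) (q := 1 / 4) (by positivity)
    (by norm_num) (by linarith)
  obtain ⟨D, hD1, hD⟩ := hG.exists_integral_kernelOp_pow_le' 4 (by norm_num)
  refine ⟨Real.sqrt (D * max C 0), Real.sqrt_nonneg _, fun g hg hq => ?_⟩
  have hvb : BddMeasurable (kernelOp μ G g) := hG.bddMeasurable_kernelOp hg
  have hexpb : BddMeasurable fun x => Real.exp (4 * π * kernelOp μ G g x ^ 2) :=
    hvb.comp_continuous (φ := fun s => Real.exp (4 * π * s ^ 2)) (by fun_prop)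
  have h1 := (hvb.pow 4).integral_mul_sq_le (μ := μ) hexpb
  have e1 : ∫ x, (kernelOp μ G g x ^ 4) ^ 2 ∂μ = ∫ x, kernelOp μ G g x ^ (2 * 4) ∂μ := by
    congr 1 with x
    ring
  have e2 : ∫ x, (Real.exp (4 * π * kernelOp μ G g x ^ 2)) ^ 2 ∂μ =
      ∫ x, Real.exp (8 * π * kernelOp μ G g x ^ 2) ∂μ := by
    congr 1 with x
    rw [← Real.exp_nat_mul]
    congr 1
    push_cast
    ring
  rw [e1, e2] at h1
  have hQ := hG.posSemidef g hg
  have h2 : (∫ x, kernelOp μ G g x ^ (2 * 4) ∂μ) *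
      ∫ x, Real.exp (8 * π * kernelOp μ G g x ^ 2) ∂μ ≤
      (D * kernelForm μ G g g ^ 4) * max C 0 := by
    refine mul_le_mul (hD g hg) ((hC g hg hq).trans (le_max_left _ _))
      (integral_nonneg fun _ => (Real.exp_pos _).le) (by positivity)
  refine (le_abs_self _).trans (abs_le_of_sq_le_sq ?_ (by positivity))
  refine (h1.trans h2).trans (le_of_eq ?_)
  rw [mul_pow, Real.sq_sqrt (by positivity)]
  ring

end IsGreenKernel
end GreenKernelEstimates

theorem hasDerivAt_primF {h : ℝ → ℝ} (hh : Continuous h) (s : ℝ) : HasDerivAt (primF h) (h s) s :=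
  intervalIntegral.integral_hasDerivAt_right (hh.intervalIntegrable _ _)
    (hh.stronglyMeasurableAtFilter _ _) hh.continuousAt

theorem continuous_primF {h : ℝ → ℝ} (hh : Continuous h) : Continuous (primF h) :=
  continuous_iff_continuousAt.2 fun s => (hasDerivAt_primF hh s).continuousAt

@[simp] theorem primF_zero (h : ℝ → ℝ) : primF h 0 = 0 := intervalIntegral.integral_same

theorem primF_eq_zero_of_nonpos {h : ℝ → ℝ} (h0 : ∀ s ≤ 0, h s = 0) {s : ℝ} (hs : s ≤ 0) :
    primF h s = 0 := by
  unfold primF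
  rw [intervalIntegral.integral_congr (g := fun _ => (0 : ℝ)), intervalIntegral.integral_zero]
  intro t ht
  rw [uIcc_of_ge hs] at ht
  exact h0 t ht.2

theorem primF_mono_of_nonneg {h : ℝ → ℝ} (hh : Continuous h) (h0 : ∀ s, 0 ≤ h s) :
    Monotone (primF h) :=
  monotone_of_deriv_nonneg (fun s => (hasDerivAt_primF hh s).differentiableAt)
    fun s => by rw [(hasDerivAt_primF hh s).deriv]; exact h0 s

theorem primF_nonneg {h : ℝ → ℝ} (hh : Continuous h) (h0 : ∀ s, 0 ≤ h s)
    (hz : ∀ s ≤ 0, h s = 0) (s : ℝ) : 0 ≤ primF h s := by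
  rcases le_total s 0 with hs | hs
  · exact (primF_eq_zero_of_nonpos hz hs).ge
  · simpa using primF_mono_of_nonneg hh h0 hs

theorem primF_le_primF {g h : ℝ → ℝ} (hg : Continuous g) (hh : Continuous h) (hle : ∀ s, g s ≤ h s)
    {s : ℝ} (hs : 0 ≤ s) : primF g s ≤ primF h s :=
  intervalIntegral.integral_mono_on hs (hg.intervalIntegrable _ _) (hh.intervalIntegrable _ _)
    fun t _ => hle t

/-- The average of `h` over `[s - δ, s]`. -/
noncomputable def backwardAverage (δ : ℝ) (h : ℝ → ℝ) (s : ℝ) : ℝ :=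
  δ⁻¹ * ∫ t in (s - δ)..s, h t

section backwardAverage

variable {δ : ℝ} {h : ℝ → ℝ}

theorem backwardAverage_eq (hh : Continuous h) (s : ℝ) :
    backwardAverage δ h s = δ⁻¹ * (primF h s - primF h (s - δ)) := by
  unfold backwardAverage primF
  rw [intervalIntegral.integral_interval_sub_left (hh.intervalIntegrable _ _)
    (hh.intervalIntegrable _ _)]

theorem hasDerivAt_backwardAverage (hh : Continuous h) (s : ℝ) :
    HasDerivAt (backwardAverage δ h) (δ⁻¹ * (h s - h (s - δ))) s := by
  have e : backwardAverage δ h = fun s => δ⁻¹ * (primF h s - primF h (s - δ)) :=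
    funext (backwardAverage_eq hh)
  rw [e]
  have h1 := hasDerivAt_primF hh s
  have h2 : HasDerivAt (fun s => primF h (s - δ)) (h (s - δ)) s :=
    (hasDerivAt_primF hh (s - δ)).comp_sub_const s δ
  exact (h1.sub h2).const_mul _

theorem continuous_backwardAverage (hh : Continuous h) : Continuous (backwardAverage δ h) :=
  continuous_iff_continuousAt.2 fun s => (hasDerivAt_backwardAverage hh s).continuousAt

theorem backwardAverage_mono_on (hδ : 0 < δ) {g : ℝ → ℝ} (hg : Continuous g) (hh : Continuous h)
    {s : ℝ} (hle : ∀ t, s - δ ≤ t → t ≤ s → g t ≤ h t) :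
    backwardAverage δ g s ≤ backwardAverage δ h s :=
  mul_le_mul_of_nonneg_left (intervalIntegral.integral_mono_on (by linarith)
    (hg.intervalIntegrable _ _) (hh.intervalIntegrable _ _) fun t ht => hle t ht.1 ht.2)
    (by positivity)

theorem backwardAverage_const (hδ : 0 < δ) (c s : ℝ) : backwardAverage δ (fun _ => c) s = c := by
  unfold backwardAverage
  rw [intervalIntegral.integral_const, smul_eq_mul]
  field_simp
  ring

theorem backwardAverage_le (hδ : 0 < δ) (hh : Continuous h) {s c : ℝ}
    (hle : ∀ t, s - δ ≤ t → t ≤ s → h t ≤ c) : backwardAverage δ h s ≤ c :=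
  (backwardAverage_mono_on hδ hh continuous_const hle).trans_eq (backwardAverage_const hδ c s)

theorem le_backwardAverage (hδ : 0 < δ) (hh : Continuous h) {s c : ℝ}
    (hle : ∀ t, s - δ ≤ t → t ≤ s → c ≤ h t) : c ≤ backwardAverage δ h s :=
  (backwardAverage_const hδ c s).symm.trans_le (backwardAverage_mono_on hδ continuous_const hh hle)

theorem backwardAverage_nonneg (hδ : 0 < δ) (hh : Continuous h) (h0 : ∀ s, 0 ≤ h s) (s : ℝ) :
    0 ≤ backwardAverage δ h s :=
  le_backwardAverage hδ hh fun t _ _ => h0 t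

theorem backwardAverage_eq_zero (hδ : 0 < δ) (hh : Continuous h) (hz : ∀ s ≤ 0, h s = 0) {s : ℝ}
    (hs : s ≤ 0) : backwardAverage δ h s = 0 :=
  le_antisymm (backwardAverage_le hδ hh fun t _ ht => (hz t (ht.trans hs)).le)
    (le_backwardAverage hδ hh fun t _ ht => (hz t (ht.trans hs)).ge)

theorem primF_backwardAverage (hδ : 0 < δ) (hh : Continuous h) (hz : ∀ s ≤ 0, h s = 0) (s : ℝ) :
    primF (backwardAverage δ h) s = backwardAverage δ (primF h) s := by
  have h1 : ∀ s, HasDerivAt (fun s => primF (backwardAverage δ h) s -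
      backwardAverage δ (primF h) s) 0 s := by
    intro s
    have := (hasDerivAt_primF (continuous_backwardAverage (δ := δ) hh) s).sub
      (hasDerivAt_backwardAverage (δ := δ) (continuous_primF hh) s)
    rwa [backwardAverage_eq hh, sub_self] at this
  have h2 := is_const_of_deriv_eq_zero (fun s => (h1 s).differentiableAt)
    (fun s => (h1 s).deriv) s 0
  simp only [primF_zero] at h2
  rw [backwardAverage_eq_zero hδ (continuous_primF hh)
    (fun s hs => primF_eq_zero_of_nonpos hz hs) le_rfl] at h2
  linarith

end backwardAverage

/-- If `|φ'| ≤ L` on the segment between `a` and `b`, then the first order Taylor remainder of the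
primitive of `φ` is quadratic. -/
theorem abs_primF_sub_le {φ φ' : ℝ → ℝ} (hφ : ∀ s, HasDerivAt φ (φ' s) s) {a b L : ℝ}
    (hL : ∀ s ∈ uIcc a b, |φ' s| ≤ L) :
    |primF φ b - primF φ a - φ a * (b - a)| ≤ L * (b - a) ^ 2 := by
  have hc : Continuous φ := continuous_iff_continuousAt.2 fun s => (hφ s).continuousAt
  have h1 : ∀ s ∈ uIcc a b, |φ s - φ a| ≤ L * |s - a| := fun s hs => by
    have := (convex_uIcc a b).norm_image_sub_le_of_norm_hasDerivWithin_le
      (fun t _ => (hφ t).hasDerivWithinAt) hL left_mem_uIcc hs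
    simpa [Real.norm_eq_abs] using this
  have hL0 : 0 ≤ L := (abs_nonneg _).trans (hL a left_mem_uIcc)
  have h2 : ∀ s ∈ uIcc a b, |φ s - φ a| ≤ L * |b - a| := fun s hs =>
    (h1 s hs).trans (mul_le_mul_of_nonneg_left (abs_sub_left_of_mem_uIcc hs) hL0)
  have h3 : ∀ s ∈ uIcc a b, HasDerivWithinAt (fun s => primF φ s - φ a * s) (φ s - φ a)
      (uIcc a b) s := fun s _ => by
    have := ((hasDerivAt_primF hc s).sub ((hasDerivAt_id s).const_mul (φ a))).hasDerivWithinAt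
      (s := uIcc a b)
    rw [mul_one] at this
    exact this
  have h4 := (convex_uIcc a b).norm_image_sub_le_of_norm_hasDerivWithin_le h3 h2
    left_mem_uIcc right_mem_uIcc
  rw [Real.norm_eq_abs, Real.norm_eq_abs, mul_assoc, ← pow_two, sq_abs] at h4
  refine le_trans (le_of_eq ?_) h4
  congr 1
  ring

/-- Nonnegative nonlinearities with critical exponential growth, vanishing on the negative axis. -/
structure IsCriticalNonlinearity (f : ℝ → ℝ) : Prop where
  continuous : Continuous f
  nonneg : ∀ s, 0 ≤ f s
  eq_zero : ∀ s ≤ 0, f s = 0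
  exp_bound : ∃ C, 0 < C ∧ ∀ s, f s ≤ C * Real.exp (4 * π * s ^ 2)
  small : ∀ ε > 0, ∃ δ > 0, ∀ s, 0 ≤ s → s ≤ δ → f s ≤ ε * s
  primF_le : ∃ s₀ > 0, ∃ M > 0, ∀ s, s₀ ≤ s → primF f s ≤ M * f s
  tendsto : Tendsto (fun s : ℝ => s * f s * Real.exp (-(4 * π * s ^ 2))) atTop atTop

/-- A nonnegative nonlinearity of polynomial growth whose primitive has a second order Taylor
expansion with polynomially growing constants. -/
structure IsPolynomialNonlinearity (φ : ℝ → ℝ) (L : ℝ) (P : ℕ) : Prop where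
  continuous : Continuous φ
  one_le : 1 ≤ P
  const_nonneg : 0 ≤ L
  sq_le : ∀ s, φ s ^ 2 ≤ L * (1 + s ^ (2 * P))
  remainder_le : ∀ a b, |primF φ b - primF φ a - φ a * (b - a)| ≤
    L * (1 + a ^ (2 * P) + b ^ (2 * P)) * (b - a) ^ 2

/-- Nonlinearities of polynomial growth that approximate `f` with uniform estimates. -/
structure IsRegularization (f : ℝ → ℝ) (κ : ℝ) (φ : ℕ → ℝ → ℝ) : Prop where
  continuous : ∀ k, Continuous (φ k)
  nonneg : ∀ k s, 0 ≤ φ k s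
  eq_zero : ∀ k, ∀ s ≤ 0, φ k s = 0
  exp_bound : ∃ C, 0 < C ∧ ∀ k s, φ k s ≤ C * Real.exp (4 * π * s ^ 2)
  small : ∀ ε > 0, ∃ δ > 0, ∀ k s, 0 ≤ s → s ≤ δ → φ k s ≤ ε * s
  primF_le : ∃ S > 0, ∀ k s, S ≤ s → primF (φ k) s ≤ κ * (s * φ k s)
  polynomial : ∀ k, ∃ L P, IsPolynomialNonlinearity (φ k) L P
  tendsto : ∀ (s : ℕ → ℝ) (k : ℕ → ℕ) (t : ℝ), Tendsto k atTop atTop → Tendsto s atTop (𝓝 t) →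
    Tendsto (fun n => φ (k n) (s n)) atTop (𝓝 (f t))
  primF_ge : ∀ M, ∀ ε > 0, ∀ᶠ k in atTop, ∀ s, s ≤ M → primF f s - ε ≤ primF (φ k) s

/-- Truncation of `f` by a power growth. -/
noncomputable def powerCap (f : ℝ → ℝ) (p k : ℕ) (s : ℝ) : ℝ :=
  min (f s) ((k + 1) * (max s 0 + max s 0 ^ p))

namespace IsCriticalNonlinearity

variable {f : ℝ → ℝ}

theorem continuous_powerCap (hf : IsCriticalNonlinearity f) (p k : ℕ) :
    Continuous (powerCap f p k) := by
  have := hf.continuous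
  unfold powerCap
  fun_prop

theorem powerCap_nonneg (hf : IsCriticalNonlinearity f) (p k : ℕ) (s : ℝ) :
    0 ≤ powerCap f p k s :=
  le_min (hf.nonneg s) (by positivity)

theorem powerCap_le (p k : ℕ) (s : ℝ) : powerCap f p k s ≤ f s := min_le_left _ _

theorem powerCap_le_pow {p k : ℕ} {s : ℝ} (hs : 0 ≤ s) :
    powerCap f p k s ≤ (k + 1) * (s + s ^ p) := by
  unfold powerCap
  rw [max_eq_left hs]
  exact min_le_right _ _

theorem powerCap_eq_zero (hf : IsCriticalNonlinearity f) (p k : ℕ) (s : ℝ) (hs : s ≤ 0) :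
    powerCap f p k s = 0 :=
  le_antisymm ((powerCap_le p k s).trans_eq (hf.eq_zero s hs)) (hf.powerCap_nonneg p k s)

theorem powerCap_eq (hf : IsCriticalNonlinearity f) (p : ℕ) (M : ℝ) :
    ∀ᶠ k : ℕ in atTop, ∀ s ≤ M, powerCap f p k s = f s := by
  obtain ⟨δ, hδ, hs⟩ := hf.small 1 one_pos
  obtain ⟨A, hA⟩ := (isCompact_Icc (a := 0) (b := M)).exists_bound_of_continuousOn
    hf.continuous.continuousOn
  filter_upwards [eventually_ge_atTop ⌈A / δ⌉₊] with k hk s hsM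
  refine min_eq_left ?_
  rcases le_or_gt s 0 with h0 | h0
  · rw [hf.eq_zero s h0]
    positivity
  rw [max_eq_left h0.le]
  have hk' : A / δ ≤ k := (Nat.le_ceil _).trans (by exact_mod_cast hk)
  rw [div_le_iff₀ hδ] at hk'
  have hp : 0 ≤ ((k : ℝ) + 1) * s ^ p := by positivity
  rcases le_total s δ with h1 | h1
  · have := hs s h0.le h1
    nlinarith [mul_nonneg (Nat.cast_nonneg (α := ℝ) k) h0.le]
  · have h2 := hA s ⟨h0.le, hsM⟩
    rw [Real.norm_eq_abs] at h2
    have h3 := le_abs_self (f s)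
    nlinarith [mul_le_mul_of_nonneg_left h1 (by positivity : (0 : ℝ) ≤ k)]

theorem primF_powerCap_le (hf : IsCriticalNonlinearity f) {κ : ℝ} (hκ : 0 < κ) {p : ℕ}
    (hp : 2 / κ ≤ p + 1) (hp2 : 2 ≤ p) :
    ∃ S > 0, ∀ k s, S ≤ s → primF (powerCap f p k) s ≤ κ * (s * powerCap f p k s) := by
  obtain ⟨s₀, hs₀, M, hM, h⟩ := hf.primF_le
  refine ⟨max s₀ (max (M / κ) (max 1 (1 / κ))), by positivity, fun k s hs => ?_⟩
  simp only [max_le_iff] at hs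
  obtain ⟨h1, h2, h3, h4⟩ := hs
  have hs0 : 0 ≤ s := by linarith
  rcases le_total (f s) ((k + 1) * (max s 0 + max s 0 ^ p)) with hc | hc
  · have e : powerCap f p k s = f s := min_eq_left hc
    rw [e]
    refine (primF_le_primF (hf.continuous_powerCap p k) hf.continuous (powerCap_le p k) hs0).trans
      ((h s h1).trans ?_)
    rw [div_le_iff₀ hκ] at h2
    nlinarith [hf.nonneg s]
  · have e : powerCap f p k s = (k + 1) * (s + s ^ p) := by
      have : powerCap f p k s = (k + 1) * (max s 0 + max s 0 ^ p) := min_eq_right hc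
      rwa [max_eq_left hs0] at this
    rw [e]
    have h5 : primF (powerCap f p k) s ≤ ((k : ℝ) + 1) * (s ^ 2 / 2 + s ^ (p + 1) / (p + 1)) := by
      have h6 : primF (powerCap f p k) s ≤ ∫ t in (0:ℝ)..s, ((k : ℝ) + 1) * (t + t ^ p) :=
        intervalIntegral.integral_mono_on hs0
          ((hf.continuous_powerCap p k).intervalIntegrable _ _)
          ((by fun_prop : Continuous fun t : ℝ => ((k : ℝ) + 1) * (t + t ^ p)).intervalIntegrable
            _ _) fun t ht => powerCap_le_pow ht.1
      refine h6.trans (le_of_eq ?_)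
      rw [intervalIntegral.integral_const_mul, intervalIntegral.integral_add
        (f := fun t : ℝ => t) (continuous_id.intervalIntegrable _ _) ((continuous_pow p).intervalIntegrable _ _),
        integral_id, integral_pow]
      simp
    refine h5.trans ?_
    have h7 : s ^ (p + 1) / (p + 1) ≤ κ / 2 * s ^ (p + 1) := by
      rw [div_le_iff₀ hκ] at hp
      rw [div_le_iff₀ (by positivity)]
      have := pow_nonneg hs0 (p + 1)
      nlinarith
    have h8 : s ^ 2 / 2 ≤ κ / 2 * s ^ (p + 1) := by
      rw [div_le_iff₀ hκ] at h4
      have h9 : s ^ 2 * s ≤ s ^ (p + 1) := by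
        rw [← pow_succ]
        exact pow_le_pow_right₀ h3 (by omega)
      nlinarith [sq_nonneg s]
    have hk : (0 : ℝ) ≤ k + 1 := by positivity
    have h10 := mul_le_mul_of_nonneg_left (add_le_add h8 h7) hk
    have h11 : s ^ (p + 1) = s ^ p * s := pow_succ s p
    have h12 : κ * (s * (((k : ℝ) + 1) * (s + s ^ p))) =
        (k + 1) * (κ / 2 * s ^ (p + 1) + κ / 2 * s ^ (p + 1)) + (k + 1) * (κ * s ^ 2) := by
      rw [h11]
      ring
    rw [h12]
    linarith [mul_nonneg hk (mul_nonneg hκ.le (sq_nonneg s))]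

end IsCriticalNonlinearity

theorem add_pow_le_two_mul_one_add {s : ℝ} (hs : 0 ≤ s) {p : ℕ} (hp : 1 ≤ p) :
    s + s ^ p ≤ 2 * (1 + s ^ (2 * p)) := by
  have h1 : s ≤ 1 + s ^ (2 * p) := by
    rcases le_total s 1 with h | h
    · have := pow_nonneg hs (2 * p); linarith
    · have := le_self_pow₀ h (n := 2 * p) (by omega); linarith
  have h2 : s ^ p ≤ 1 + s ^ (2 * p) := by
    rw [mul_comm, pow_mul]
    nlinarith [sq_nonneg (s ^ p - 1), pow_nonneg hs p]
  linarith

theorem isPolynomialNonlinearity_backwardAverage {h : ℝ → ℝ} (hh : Continuous h)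
    (h0 : ∀ s, 0 ≤ h s) (hz : ∀ s ≤ 0, h s = 0) {δ : ℝ} (hδ : 0 < δ) {c : ℝ} (hc : 0 ≤ c) {p : ℕ}
    (hp : 1 ≤ p) (hle : ∀ s, 0 ≤ s → h s ≤ c * (s + s ^ p)) :
    ∃ L, IsPolynomialNonlinearity (backwardAverage δ h) L (2 * p) := by
  have hmono : ∀ s t, t ≤ s → 0 ≤ s → h t ≤ c * (s + s ^ p) := fun s t hts hs => by
    rcases le_total t 0 with ht | ht
    · rw [hz t ht]; positivity
    · refine (hle t ht).trans ?_
      gcongr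
  have hb : ∀ s A, 0 ≤ A → s ≤ A → backwardAverage δ h s ≤ c * (A + A ^ p) := fun s A hA hs =>
    backwardAverage_le hδ hh fun t _ ht => hmono A t (ht.trans hs) hA
  refine ⟨max (8 * c ^ 2) (4 * c * δ⁻¹), continuous_backwardAverage hh, by omega, by positivity,
    fun s => ?_, fun a b => ?_⟩
  · have h1 : backwardAverage δ h s ≤ c * (2 * (1 + |s| ^ (2 * p))) :=
      (hb s |s| (abs_nonneg _) (le_abs_self s)).trans
        (mul_le_mul_of_nonneg_left (add_pow_le_two_mul_one_add (abs_nonneg s) hp) hc)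
    have h2 := pow_le_pow_left₀ (backwardAverage_nonneg hδ hh h0 s) h1 2
    have h3 : s ^ (2 * (2 * p)) = (|s| ^ (2 * p)) ^ 2 := by
      rw [← pow_mul, mul_comm 2 (2 * p), pow_mul, pow_mul, pow_mul, pow_mul, sq_abs]
    have h4 : (1 + |s| ^ (2 * p)) ^ 2 ≤ 2 * (1 + (|s| ^ (2 * p)) ^ 2) := by
      nlinarith [sq_nonneg (|s| ^ (2 * p) - 1)]
    rw [h3]
    calc backwardAverage δ h s ^ 2 ≤ 4 * c ^ 2 * (1 + |s| ^ (2 * p)) ^ 2 := by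
          refine h2.trans (le_of_eq ?_); ring
      _ ≤ 4 * c ^ 2 * (2 * (1 + (|s| ^ (2 * p)) ^ 2)) := by gcongr
      _ = 8 * c ^ 2 * (1 + (|s| ^ (2 * p)) ^ 2) := by ring
      _ ≤ _ := by gcongr; exact le_max_left _ _
  · have key : ∀ s ∈ uIcc a b, |δ⁻¹ * (h s - h (s - δ))| ≤
        max (8 * c ^ 2) (4 * c * δ⁻¹) * (1 + a ^ (2 * (2 * p)) + b ^ (2 * (2 * p))) := by
      intro s hs
      set A := max |a| |b| with hA
      have hA0 : 0 ≤ A := (abs_nonneg a).trans (le_max_left _ _)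
      have hsA : s ≤ A := by
        rcases le_total a b with hab | hab
        · rw [uIcc_of_le hab] at hs
          exact hs.2.trans ((le_abs_self b).trans (le_max_right _ _))
        · rw [uIcc_of_ge hab] at hs
          exact hs.2.trans ((le_abs_self a).trans (le_max_left _ _))
      have e1 := hmono A s hsA hA0
      have e2 := hmono A (s - δ) (by linarith) hA0
      have e3 := h0 s
      have e4 := h0 (s - δ)
      have e5 : |h s - h (s - δ)| ≤ c * (A + A ^ p) := by rw [abs_le]; constructor <;> linarith
      have e6 : A ^ p ≤ 1 + A ^ (2 * p) := by
        rw [mul_comm 2 p, pow_mul]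
        nlinarith [sq_nonneg (A ^ p - 1), pow_nonneg hA0 p]
      have e7 : A + A ^ p ≤ 4 * (1 + A ^ (2 * (2 * p))) := by
        have f1 := add_pow_le_two_mul_one_add hA0 hp
        have f2 : A ^ (2 * p) ≤ 1 + A ^ (2 * (2 * p)) := by
          rw [mul_comm 2 (2 * p), pow_mul A (2 * p) 2]
          nlinarith [sq_nonneg (A ^ (2 * p) - 1), pow_nonneg hA0 (2 * p)]
        have f3 : A + A ^ p ≤ 2 * (1 + A ^ (2 * (2 * p))) + 2 := by
          rcases le_total A 1 with h | h
          · have g1 := pow_le_one₀ (n := p) hA0 h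
            have g2 := pow_nonneg hA0 (2 * (2 * p))
            linarith
          · have g1 := pow_le_pow_right₀ h (show p ≤ 2 * (2 * p) by omega)
            have g2 := pow_le_pow_right₀ h (show 1 ≤ 2 * (2 * p) by omega)
            rw [pow_one] at g2
            linarith
        have g2 := pow_nonneg hA0 (2 * (2 * p))
        linarith
      have e8 : A ^ (2 * (2 * p)) ≤ a ^ (2 * (2 * p)) + b ^ (2 * (2 * p)) := by
        have ha : 0 ≤ a ^ (2 * (2 * p)) := by rw [pow_mul]; positivity
        have hb : 0 ≤ b ^ (2 * (2 * p)) := by rw [pow_mul]; positivity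
        rcases max_choice |a| |b| with h | h <;> rw [hA, h, pow_mul, sq_abs, ← pow_mul]
          <;> linarith
      rw [abs_mul, abs_of_pos (inv_pos.2 hδ)]
      calc δ⁻¹ * |h s - h (s - δ)| ≤ δ⁻¹ * (c * (4 * (1 + (a ^ (2 * (2 * p)) +
            b ^ (2 * (2 * p)))))) := by
            have : A + A ^ p ≤ 4 * (1 + (a ^ (2 * (2 * p)) + b ^ (2 * (2 * p)))) := by linarith
            gcongr
            exact e5.trans (mul_le_mul_of_nonneg_left this hc)
        _ = 4 * c * δ⁻¹ * (1 + a ^ (2 * (2 * p)) + b ^ (2 * (2 * p))) := by ring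
        _ ≤ _ := by
            have ha : 0 ≤ a ^ (2 * (2 * p)) := by rw [pow_mul]; positivity
            have hb : 0 ≤ b ^ (2 * (2 * p)) := by rw [pow_mul]; positivity
            gcongr
            exact le_max_right _ _
    exact abs_primF_sub_le (hasDerivAt_backwardAverage hh) key

theorem IsCriticalNonlinearity.exists_isRegularization {f : ℝ → ℝ} (hf : IsCriticalNonlinearity f)
    {κ : ℝ} (hκ : 0 < κ) : ∃ φ, IsRegularization f κ φ := by
  obtain ⟨p, hp⟩ := exists_nat_ge (max 2 (2 / κ))
  rw [max_le_iff] at hp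
  have hp2 : 2 ≤ p := by exact_mod_cast hp.1
  set δ : ℕ → ℝ := fun k => 1 / ((k : ℝ) + 1) with hδ
  have hδ0 : ∀ k, 0 < δ k := fun k => by positivity
  have hδ1 : ∀ k, δ k ≤ 1 := fun k => by
    simp only [hδ]
    rw [div_le_one (by positivity)]
    have : (0 : ℝ) ≤ k := by positivity
    linarith
  have hδt : Tendsto δ atTop (𝓝 0) := tendsto_one_div_add_atTop_nhds_zero_nat
  have hc := hf.continuous_powerCap p
  have hz := hf.powerCap_eq_zero p
  have hprim := fun k s => primF_backwardAverage (hδ0 k) (hc k) (hz k) s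
  refine ⟨fun k => backwardAverage (δ k) (powerCap f p k), ⟨fun k =>
    continuous_backwardAverage (hc k), fun k => backwardAverage_nonneg (hδ0 k) (hc k)
    (hf.powerCap_nonneg p k), fun k s hs => backwardAverage_eq_zero (hδ0 k) (hc k) (hz k) hs,
    ?_, ?_, ?_, ?_, ?_, ?_⟩⟩
  · obtain ⟨C, hC, h⟩ := hf.exp_bound
    refine ⟨C, hC, fun k s => backwardAverage_le (hδ0 k) (hc k) fun t _ ht => ?_⟩
    rcases le_total t 0 with h0 | h0
    · rw [hz k t h0]; positivity
    · refine (powerCap_le p k t).trans ((h t).trans ?_)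
      gcongr
  · intro ε hε
    obtain ⟨η, hη, h⟩ := hf.small ε hε
    refine ⟨η, hη, fun k s hs0 hs => backwardAverage_le (hδ0 k) (hc k) fun t _ ht => ?_⟩
    rcases le_total t 0 with h0 | h0
    · rw [hz k t h0]; positivity
    · refine (powerCap_le p k t).trans ((h t h0 (ht.trans hs)).trans ?_)
      gcongr
  · obtain ⟨S, hS, h⟩ := hf.primF_powerCap_le hκ (hp.2.trans (by linarith)) hp2
    refine ⟨S + 1, by linarith, fun k s hs => ?_⟩
    rw [hprim]
    have h1 : backwardAverage (δ k) (primF (powerCap f p k)) s ≤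
        backwardAverage (δ k) (fun t => κ * s * powerCap f p k t) s := by
      refine backwardAverage_mono_on (hδ0 k) (continuous_primF (hc k)) (by fun_prop)
        fun t ht1 ht2 => (h k t (by linarith [hδ1 k])).trans ?_
      rw [mul_assoc]
      gcongr
      exact hf.powerCap_nonneg p k t
    refine h1.trans (le_of_eq ?_)
    unfold backwardAverage
    rw [intervalIntegral.integral_const_mul]
    ring
  · intro k
    obtain ⟨L, hL⟩ := isPolynomialNonlinearity_backwardAverage (hc k) (hf.powerCap_nonneg p k)
      (hz k) (hδ0 k) (c := k + 1) (by positivity) (p := p) (by omega) fun s hs => powerCap_le_pow hs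
    exact ⟨L, _, hL⟩
  · intro s k t hk hs
    rw [Metric.tendsto_nhds]
    intro ε hε
    obtain ⟨η, hη, h⟩ := Metric.continuousAt_iff.1 (hf.continuous.continuousAt (x := t)) (ε / 2)
      (half_pos hε)
    filter_upwards [hk.eventually (hf.powerCap_eq p (t + η)),
      (Metric.tendsto_nhds.1 hs) (η / 2) (half_pos hη),
      (hδt.comp hk).eventually_lt_const (half_pos hη)] with n h1 h2 h3
    simp only [Function.comp_apply] at h3
    rw [Real.dist_eq, abs_lt] at h2
    have h4 : ∀ x, s n - δ (k n) ≤ x → x ≤ s n → |powerCap f p (k n) x - f t| < ε / 2 := by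
      intro x hx1 hx2
      rw [h1 x (by linarith), ← Real.dist_eq]
      apply h
      rw [Real.dist_eq, abs_lt]
      constructor <;> linarith
    have h5 := backwardAverage_le (hδ0 (k n)) (hc (k n)) (s := s n) (c := f t + ε / 2)
      fun x hx1 hx2 => by linarith [(abs_lt.1 (h4 x hx1 hx2)).2]
    have h6 := le_backwardAverage (hδ0 (k n)) (hc (k n)) (s := s n) (c := f t - ε / 2)
      fun x hx1 hx2 => by linarith [(abs_lt.1 (h4 x hx1 hx2)).1]
    rw [Real.dist_eq, abs_lt]
    constructor <;> linarith
  · intro M ε hε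
    obtain ⟨A, hA⟩ := (isCompact_Icc (a := 0) (b := M)).exists_bound_of_continuousOn
      hf.continuous.continuousOn
    have hA' : ∀ s ≤ M, f s ≤ max A 0 := fun s hs => by
      rcases le_total s 0 with h0 | h0
      · rw [hf.eq_zero s h0]; exact le_max_right _ _
      · exact (le_abs_self _).trans ((hA s ⟨h0, hs⟩).trans (le_max_left _ _))
    have hδA : Tendsto (fun k => δ k * max A 0) atTop (𝓝 0) := by
      simpa using hδt.mul_const (max A 0)
    filter_upwards [hf.powerCap_eq p M, hδA.eventually_lt_const hε] with k h1 h2 s hs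
    rw [hprim]
    refine le_backwardAverage (hδ0 k) (continuous_primF (hc k)) fun t ht1 ht2 => ?_
    have e : primF (powerCap f p k) t = primF f t := by
      rcases le_total t 0 with h0 | h0
      · rw [primF_eq_zero_of_nonpos (hz k) h0, primF_eq_zero_of_nonpos hf.eq_zero h0]
      · unfold primF
        refine intervalIntegral.integral_congr fun x hx => h1 x ?_
        rw [uIcc_of_le h0] at hx
        exact hx.2.trans (ht2.trans hs)
    rw [e]
    have h3 : primF f s - primF f t = ∫ x in t..s, f x := by
      unfold primF
      rw [intervalIntegral.integral_interval_sub_left (hf.continuous.intervalIntegrable _ _)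
        (hf.continuous.intervalIntegrable _ _)]
    have h4 : ∫ x in t..s, f x ≤ ∫ x in t..s, max A 0 :=
      intervalIntegral.integral_mono_on ht2 (hf.continuous.intervalIntegrable _ _)
        (continuous_const.intervalIntegrable _ _) fun x hx => hA' x (hx.2.trans hs)
    rw [intervalIntegral.integral_const, smul_eq_mul] at h4
    have h5 : (s - t) * max A 0 ≤ δ k * max A 0 :=
      mul_le_mul_of_nonneg_right (by linarith) (le_max_right _ _)
    linarith

section Descent

variable {X : Type*} [MeasurableSpace X]

/-- The energy functional `½⟨g, K g⟩ - ∫ Φ(K g)` where `Φ` is the primitive of `φ`. -/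
noncomputable def kernelEnergy (μ : Measure X) (G : X → X → ℝ) (φ : ℝ → ℝ) (g : X → ℝ) : ℝ :=
  1 / 2 * kernelForm μ G g g - ∫ x, primF φ (kernelOp μ G g x) ∂μ

/-- The residual of the equation `g = φ(K g)`. -/
noncomputable def kernelResidual (μ : Measure X) (G : X → X → ℝ) (φ : ℝ → ℝ) (g : X → ℝ)
    (x : X) : ℝ :=
  g x - φ (kernelOp μ G g x)

namespace IsGreenKernel

variable [MetricSpace X] [CompactSpace X] [BorelSpace X] {μ : Measure X} [IsFiniteMeasure μ]
  {G : X → X → ℝ}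

theorem exists_kernelForm_le (hG : IsGreenKernel μ G) :
    ∃ C, 0 ≤ C ∧ ∀ h, BddMeasurable h → kernelForm μ G h h ≤ C * ∫ x, h x ^ 2 ∂μ := by
  obtain ⟨C, hC1, hC⟩ := hG.exists_integral_kernelOp_pow_le' 1 le_rfl
  refine ⟨C, by linarith, fun h hh => ?_⟩
  have h1 := hC h hh
  have h2 := hh.integral_mul_sq_le (μ := μ) (hG.bddMeasurable_kernelOp hh)
  have h3 : kernelForm μ G h h ^ 2 ≤ (∫ x, h x ^ 2 ∂μ) * (C * kernelForm μ G h h) := by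
    refine h2.trans (mul_le_mul_of_nonneg_left ?_ (integral_nonneg fun x => sq_nonneg _))
    simpa using h1
  rcases (hG.posSemidef h hh).eq_or_lt with h0 | h0
  · rw [← h0]
    exact mul_nonneg (by linarith) (integral_nonneg fun x => sq_nonneg _)
  · refine le_of_mul_le_mul_right ?_ h0
    linarith

theorem sqrt_kernelForm_add_le (hG : IsGreenKernel μ G) {g h : X → ℝ} (hg : BddMeasurable g)
    (hh : BddMeasurable h) (t : ℝ) :
    √(kernelForm μ G (fun x => g x + t * h x) (fun x => g x + t * h x)) ≤
      √(kernelForm μ G g g) + |t| * √(kernelForm μ G h h) := by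
  have h1 := hG.posSemidef g hg
  have h2 := hG.posSemidef h hh
  rw [hG.kernelForm_add_mul_self hg hh t]
  refine Real.sqrt_le_iff.2 ⟨by positivity, ?_⟩
  have h3 : |kernelForm μ G h g| ≤ √(kernelForm μ G g g) * √(kernelForm μ G h h) := by
    rw [← Real.sqrt_mul h1]
    refine Real.abs_le_sqrt ?_
    rw [mul_comm]
    exact hG.kernelForm_sq_le hh hg
  have h4 : t * kernelForm μ G h g ≤
      |t| * (√(kernelForm μ G g g) * √(kernelForm μ G h h)) :=
    (le_abs_self _).trans (by rw [abs_mul]; gcongr)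
  rw [add_sq, mul_pow, Real.sq_sqrt h1, Real.sq_sqrt h2, sq_abs]
  linarith

theorem bddMeasurable_kernelResidual (hG : IsGreenKernel μ G) {φ : ℝ → ℝ} (hφ : Continuous φ)
    {g : X → ℝ} (hg : BddMeasurable g) : BddMeasurable (kernelResidual μ G φ g) :=
  hg.sub ((hG.bddMeasurable_kernelOp hg).comp_continuous hφ)

theorem exists_kernelEnergy_step_le (hG : IsGreenKernel μ G) {φ : ℝ → ℝ} {L : ℝ} {P : ℕ}
    (hφ : IsPolynomialNonlinearity φ L P) :
    ∃ A, 0 ≤ A ∧ ∀ g, BddMeasurable g → ∀ s, 0 ≤ s → s ≤ 1 →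
      kernelEnergy μ G φ (fun x => g x + -s * kernelResidual μ G φ g x) ≤
        kernelEnergy μ G φ g - s * kernelForm μ G (kernelResidual μ G φ g) (kernelResidual μ G φ g)
        + s ^ 2 * (A * (1 + kernelForm μ G g g +
          kernelForm μ G (kernelResidual μ G φ g) (kernelResidual μ G φ g)) ^ P *
          kernelForm μ G (kernelResidual μ G φ g) (kernelResidual μ G φ g)) := by
  have hP := hφ.one_le
  obtain ⟨C, hC1, hC⟩ := hG.exists_integral_kernelOp_pow_le' (2 * P) (by omega)
  obtain ⟨D, hD1, hD⟩ := hG.exists_integral_kernelOp_pow_le' 2 (by omega)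
  set m := μ.real univ with hm
  have hm0 : 0 ≤ m := measureReal_nonneg
  set E := 3 * (m + C + C * 2 ^ (2 * P)) with hE
  have hE0 : 0 ≤ E := by positivity
  have hL := hφ.const_nonneg
  refine ⟨1 / 2 + L * √(E * D), by positivity, fun g hg s hs0 hs1 => ?_⟩
  set r := kernelResidual μ G φ g with hr
  have hrb : BddMeasurable r := hG.bddMeasurable_kernelResidual hφ.continuous hg
  set g' := fun x => g x + -s * r x with hg'
  have hgb : BddMeasurable g' := hg.add (hrb.const_mul (-s))
  set u := kernelOp μ G g with hu
  set w := kernelOp μ G r with hw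
  set v := kernelOp μ G g' with hv
  have hub : BddMeasurable u := hG.bddMeasurable_kernelOp hg
  have hwb : BddMeasurable w := hG.bddMeasurable_kernelOp hrb
  have hvb : BddMeasurable v := hG.bddMeasurable_kernelOp hgb
  have hvx : ∀ x, v x = u x + -s * w x := fun x => by
    rw [hv, hg', hG.kernelOp_add hg (hrb.const_mul (-s)), IsLogKernel.kernelOp_const_mul]
  have hQg := hG.posSemidef g hg
  have hQr := hG.posSemidef r hrb
  have hQ' : kernelForm μ G g' g' ≤ 2 * (1 + kernelForm μ G g g + kernelForm μ G r r) := by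
    have h1 := hG.kernelForm_add_mul_self hg hrb (-s)
    have h2 := hG.posSemidef _ (hg.add (hrb.const_mul s))
    rw [hG.kernelForm_add_mul_self hg hrb s] at h2
    have h3 : s ^ 2 ≤ 1 := pow_le_one₀ hs0 hs1
    have h4 := mul_le_mul_of_nonneg_right h3 hQr
    rw [h1]
    have : (-s) ^ 2 = s ^ 2 := by ring
    rw [this]
    linarith
  set R := 1 + kernelForm μ G g g + kernelForm μ G r r with hR
  have hR1 : 1 ≤ R := by linarith
  -- the weighted remainder
  have hWb : BddMeasurable fun x => 1 + u x ^ (2 * P) + v x ^ (2 * P) := by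
    have h1 : BddMeasurable (fun _ : X => (1 : ℝ)) := ⟨measurable_const, 1, fun _ => by simp⟩
    exact (h1.add (hub.pow _)).add (hvb.pow _)
  have hIw : ∫ x, (1 + u x ^ (2 * P) + v x ^ (2 * P)) * w x ^ 2 ∂μ ≤
      √(E * D) * R ^ P * kernelForm μ G r r := by
    have h1 := hWb.integral_mul_sq_le (μ := μ) (hwb.pow 2)
    have h2 : ∫ x, (w x ^ 2) ^ 2 ∂μ ≤ D * kernelForm μ G r r ^ 2 := by
      refine le_trans (le_of_eq ?_) (hD r hrb)
      congr 1 with x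
      rw [← pow_mul]
    have h3 : ∫ x, (1 + u x ^ (2 * P) + v x ^ (2 * P)) ^ 2 ∂μ ≤ E * R ^ (2 * P) := by
      have i1 := (hub.pow (2 * (2 * P))).integrable μ
      have i2 := (hvb.pow (2 * (2 * P))).integrable μ
      have i12 : Integrable (fun x => 1 + u x ^ (2 * (2 * P))) μ := (integrable_const 1).add i1
      have h4 : ∫ x, (1 + u x ^ (2 * P) + v x ^ (2 * P)) ^ 2 ∂μ ≤
          ∫ x, 3 * (1 + u x ^ (2 * (2 * P)) + v x ^ (2 * (2 * P))) ∂μ := by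
        refine integral_mono ((hWb.pow 2).integrable μ) ((i12.add i2).const_mul 3) fun x => ?_
        simp only
        have e1 : u x ^ (2 * (2 * P)) = (u x ^ (2 * P)) ^ 2 := by rw [← pow_mul]; ring_nf
        have e2 : v x ^ (2 * (2 * P)) = (v x ^ (2 * P)) ^ 2 := by rw [← pow_mul]; ring_nf
        rw [e1, e2]
        nlinarith [sq_nonneg (u x ^ (2 * P) - 1), sq_nonneg (v x ^ (2 * P) - 1),
          sq_nonneg (u x ^ (2 * P) - v x ^ (2 * P))]
      rw [integral_const_mul, integral_add i12 i2, integral_add (integrable_const 1) i1] at h4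
      have h5 := hC g hg
      have h6 := hC g' hgb
      have h7 : kernelForm μ G g g ^ (2 * P) ≤ R ^ (2 * P) :=
        pow_le_pow_left₀ hQg (by linarith) _
      have h8 : kernelForm μ G g' g' ^ (2 * P) ≤ 2 ^ (2 * P) * R ^ (2 * P) := by
        rw [← mul_pow]
        exact pow_le_pow_left₀ (hG.posSemidef g' hgb) hQ' _
      have h9 : (1 : ℝ) ≤ R ^ (2 * P) := one_le_pow₀ hR1
      have h10 : ∫ _ : X, (1 : ℝ) ∂μ = m := by simp [hm]
      rw [h10] at h4
      have hC0 : 0 ≤ C := by linarith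
      have h11 := mul_le_mul_of_nonneg_left h7 hC0
      have h12 := mul_le_mul_of_nonneg_left h8 hC0
      have h13 := mul_le_mul_of_nonneg_left h9 hm0
      rw [hE]
      linarith
    refine (le_abs_self _).trans (abs_le_of_sq_le_sq ?_ (by positivity))
    refine (h1.trans (mul_le_mul h3 h2 (integral_nonneg fun x => sq_nonneg _)
      (by positivity))).trans (le_of_eq ?_)
    rw [mul_pow, mul_pow, Real.sq_sqrt (by positivity)]
    ring
  -- Taylor expansion
  have hpc := continuous_primF hφ.continuous
  have iu := (hub.comp_continuous hpc).integrable μ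
  have iv := (hvb.comp_continuous hpc).integrable μ
  have hfu : BddMeasurable fun x => φ (u x) := hub.comp_continuous hφ.continuous
  have ifw := (hfu.mul hwb).integrable μ
  have iW := (hWb.mul (hwb.pow 2)).integrable μ
  have hT : (∫ x, primF φ (u x) ∂μ) - s * (∫ x, φ (u x) * w x ∂μ) -
      s ^ 2 * L * (∫ x, (1 + u x ^ (2 * P) + v x ^ (2 * P)) * w x ^ 2 ∂μ) ≤
      ∫ x, primF φ (v x) ∂μ := by
    have i1 : Integrable (fun x => primF φ (u x) - s * (φ (u x) * w x)) μ :=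
      iu.sub (ifw.const_mul s)
    rw [← integral_const_mul, ← integral_const_mul, ← integral_sub iu (ifw.const_mul s),
      ← integral_sub i1 (iW.const_mul _)]
    refine integral_mono (i1.sub (iW.const_mul _)) iv fun x => ?_
    have h1 := (abs_le.1 (hφ.remainder_le (u x) (v x))).1
    have h2 : v x - u x = -s * w x := by rw [hvx]; ring
    rw [h2] at h1
    simp only
    linarith
  have hB : kernelForm μ G r g = kernelForm μ G r r + ∫ x, φ (u x) * w x ∂μ := by
    rw [hG.kernelForm_comm hrb hg]
    have h1 : kernelForm μ G g r = kernelForm μ G (fun x => r x + φ (u x)) r := by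
      unfold kernelForm
      congr 1 with x
      rw [hr]
      simp only [kernelResidual]
      ring
    rw [h1, hG.kernelForm_add_left hrb hfu hrb]
    rfl
  have hJ : kernelEnergy μ G φ g' = 1 / 2 * (kernelForm μ G g g + 2 * (-s) * kernelForm μ G r g +
      (-s) ^ 2 * kernelForm μ G r r) - ∫ x, primF φ (v x) ∂μ := by
    rw [← hG.kernelForm_add_mul_self hg hrb (-s)]
    rfl
  have hJg : kernelEnergy μ G φ g = 1 / 2 * kernelForm μ G g g - ∫ x, primF φ (u x) ∂μ := rfl
  have hR' : (1 : ℝ) ≤ R ^ P := one_le_pow₀ hR1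
  have h14 : kernelForm μ G r r ≤ R ^ P * kernelForm μ G r r := le_mul_of_one_le_left hQr hR'
  have h15 := mul_le_mul_of_nonneg_left hIw (by positivity : 0 ≤ s ^ 2 * L)
  have h16 := mul_le_mul_of_nonneg_left h14 (sq_nonneg s)
  rw [hJ, hJg, hB]
  have e1 : (-s) ^ 2 = s ^ 2 := by ring
  rw [e1]
  linarith

end IsGreenKernel
end Descent

/-- A deformation that decreases `J` and fixes the bottom of a mountain pass geometry has an orbit,
starting on a given path across the mountain range, that stays above the range. -/
theorem exists_orbit_above {E : Type*} [TopologicalSpace E] {D : E → E} {J Q : E → ℝ} {γ : ℝ → E}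
    (hD : Continuous D) (hJ : Continuous J) (hQ : Continuous Q) (hγ : Continuous γ)
    (hdec : ∀ g, J (D g) ≤ J g) (hQ0 : ∀ g, 0 ≤ Q g) (hfix : D (γ 0) = γ 0) (hγ0 : Q (γ 0) = 0)
    (hγ1 : J (γ 1) < 0) {r : ℝ} (hr : 0 ≤ r) (hmt : ∀ g, Q g ≤ r → Q g / 8 ≤ J g) :
    ∃ t ∈ Icc (0 : ℝ) 1, ∀ n, r / 8 ≤ J (D^[n] (γ t)) := by
  have hDn : ∀ n, Continuous (D^[n]) := fun n => hD.iterate n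
  have hdecn : ∀ n g, J (D^[n] g) ≤ J g := fun n g => by
    induction n with
    | zero => exact le_rfl
    | succ n ih => rw [Function.iterate_succ_apply']; exact (hdec _).trans ih
  have hfixn : ∀ n, D^[n] (γ 0) = γ 0 := fun n => Function.iterate_fixed hfix n
  set S : ℕ → Set ℝ := fun n => Icc (0 : ℝ) 1 ∩ {t | r / 8 ≤ J (D^[n] (γ t))} with hS
  have hcl : ∀ n, IsClosed {t | r / 8 ≤ J (D^[n] (γ t))} := fun n =>
    isClosed_le continuous_const (hJ.comp ((hDn n).comp hγ))
  have hne : ∀ n, (S n).Nonempty := fun n => by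
    have h1 : r ≤ Q (D^[n] (γ 1)) := by
      by_contra! h
      have h2 := hmt _ h.le
      have h3 := hQ0 (D^[n] (γ 1))
      have h4 := hdecn n (γ 1)
      linarith
    have h2 := intermediate_value_Icc (zero_le_one (α := ℝ))
      (hQ.comp ((hDn n).comp hγ)).continuousOn
    obtain ⟨t, ht, htr⟩ := h2 (show r ∈ Icc _ _ by
      simp only [Function.comp_apply, hfixn, hγ0]
      exact ⟨hr, h1⟩)
    simp only [Function.comp_apply] at htr
    refine ⟨t, ht, ?_⟩
    have := hmt (D^[n] (γ t)) htr.le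
    rw [htr] at this
    exact this
  have hmono : ∀ n, S (n + 1) ⊆ S n := fun n t ht => by
    refine ⟨ht.1, ?_⟩
    have := ht.2
    simp only [mem_ofPred_eq] at this ⊢
    rw [Function.iterate_succ_apply'] at this
    exact this.trans (hdec _)
  obtain ⟨t, ht⟩ := IsCompact.nonempty_iInter_of_sequence_nonempty_isCompact_isClosed S hmono hne
    (isCompact_Icc.inter_right (hcl 0)) fun n => isClosed_Icc.inter (hcl n)
  rw [mem_iInter] at ht
  exact ⟨t, (ht 0).1, fun n => (ht n).2⟩

section Descent

variable {X : Type*} [MeasurableSpace X] [MetricSpace X] [CompactSpace X] [BorelSpace X]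
  {μ : Measure X} [IsFiniteMeasure μ] {G : X → X → ℝ}

theorem ContinuousMap.continuous_integral_of_compactSpace :
    Continuous fun g : C(X, ℝ) => ∫ x, g x ∂μ := by
  refine continuous_iff_continuousAt.2 fun g => tendsto_iff_dist_tendsto_zero.2 ?_
  have h1 : Tendsto (fun h : C(X, ℝ) => dist h g * μ.real univ) (𝓝 g) (𝓝 0) := by
    have := (tendsto_iff_dist_tendsto_zero.1 (tendsto_id (α := C(X, ℝ)) (x := 𝓝 g))).mul_const
      (μ.real univ)
    simpa using this
  refine squeeze_zero (fun _ => dist_nonneg) (fun h => ?_) h1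
  rw [dist_eq_norm, ← integral_sub (h.continuous.bddMeasurable.integrable μ)
    (g.continuous.bddMeasurable.integrable μ)]
  refine norm_integral_le_of_norm_le_const (ae_of_all _ fun x => ?_)
  rw [← dist_eq_norm]
  exact ContinuousMap.dist_apply_le_dist x

namespace IsGreenKernel

/-- The integral operator on continuous functions. -/
noncomputable def kernelMap (hG : IsGreenKernel μ G) (g : C(X, ℝ)) : C(X, ℝ) :=
  ⟨kernelOp μ G g, hG.continuous_kernelOp g.continuous.bddMeasurable⟩

theorem continuous_kernelMap (hG : IsGreenKernel μ G) : Continuous hG.kernelMap := by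
  obtain ⟨C, hC1, hC⟩ := hG.exists_integral_pow_le Real.pi_pos (by linarith [Real.pi_pos])
  set A := C * (Nat.factorial 1 / π ^ 1) with hA
  have hA0 : 0 ≤ A := by positivity
  refine (LipschitzWith.of_dist_le_mul (K := A.toNNReal) fun g h => ?_).continuous
  rw [Real.coe_toNNReal _ hA0, ContinuousMap.dist_le (by positivity)]
  intro x
  have e : kernelOp μ G g x - kernelOp μ G h x = ∫ y, G x y * (g y - h y) ∂μ :=
    (hG.kernelOp_sub g.continuous.bddMeasurable h.continuous.bddMeasurable x).symm
  change dist (kernelOp μ G g x) (kernelOp μ G h x) ≤ _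
  rw [Real.dist_eq, e]
  refine (abs_integral_le_integral_abs).trans ?_
  have h1 : ∫ y, |G x y * (g y - h y)| ∂μ ≤ ∫ y, G x y * dist g h ∂μ := by
    refine integral_mono (hG.integrable_mul
      (g.continuous.bddMeasurable.sub h.continuous.bddMeasurable) x).abs
      ((hG.integrable_left x).mul_const _) fun y => ?_
    simp only
    rw [abs_mul, abs_of_nonneg (hG.nonneg x y), ← Real.dist_eq]
    exact mul_le_mul_of_nonneg_left (ContinuousMap.dist_apply_le_dist y) (hG.nonneg x y)
  refine h1.trans ?_
  rw [integral_mul_const]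
  refine mul_le_mul_of_nonneg_right ?_ dist_nonneg
  simpa [hA] using hC 1 x

theorem continuous_kernelForm_self (hG : IsGreenKernel μ G) {Y : Type*} [TopologicalSpace Y]
    {F : Y → C(X, ℝ)} (hF : Continuous F) : Continuous fun y => kernelForm μ G (F y) (F y) :=
  ContinuousMap.continuous_integral_of_compactSpace.comp
    (hF.mul (hG.continuous_kernelMap.comp hF))

theorem continuous_kernelEnergy (hG : IsGreenKernel μ G) {φ : ℝ → ℝ} (hφ : Continuous φ) :
    Continuous fun g : C(X, ℝ) => kernelEnergy μ G φ g := by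
  refine ((hG.continuous_kernelForm_self continuous_id).const_mul _).sub ?_
  exact ContinuousMap.continuous_integral_of_compactSpace.comp
    ((ContinuousMap.continuous_postcomp ⟨primF φ, continuous_primF hφ⟩).comp hG.continuous_kernelMap)

/-- The residual as a map on continuous functions. -/
noncomputable def residualMap (hG : IsGreenKernel μ G) {φ : ℝ → ℝ} (hφ : Continuous φ)
    (g : C(X, ℝ)) : C(X, ℝ) :=
  g - (⟨φ, hφ⟩ : C(ℝ, ℝ)).comp (hG.kernelMap g)

theorem continuous_residualMap (hG : IsGreenKernel μ G) {φ : ℝ → ℝ} (hφ : Continuous φ) :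
    Continuous (hG.residualMap hφ) :=
  continuous_id.sub
    ((ContinuousMap.continuous_postcomp (⟨φ, hφ⟩ : C(ℝ, ℝ))).comp hG.continuous_kernelMap)

theorem exists_kernelForm_residual_le (hG : IsGreenKernel μ G) {φ : ℝ → ℝ} {L : ℝ} {P : ℕ}
    (hφ : IsPolynomialNonlinearity φ L P) :
    ∃ A, 0 ≤ A ∧ ∀ g, BddMeasurable g →
      kernelForm μ G (kernelResidual μ G φ g) (kernelResidual μ G φ g) ≤
        A * (1 + kernelForm μ G g g) ^ P := by
  have hP := hφ.one_le
  have hL := hφ.const_nonneg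
  obtain ⟨C, hC0, hC⟩ := hG.exists_kernelForm_le
  obtain ⟨D, hD1, hD⟩ := hG.exists_integral_kernelOp_pow_le' P hP
  set m := μ.real univ with hm
  have hm0 : 0 ≤ m := measureReal_nonneg
  refine ⟨2 + 2 * (C * (L * (m + D))), by positivity, fun g hg => ?_⟩
  have hub := hG.bddMeasurable_kernelOp hg
  have hfu := hub.comp_continuous hφ.continuous
  have h1 := hG.kernelForm_add_mul_self hg hfu 1
  have h2 := hG.posSemidef _ (hg.add (hfu.const_mul 1))
  have h3 := hG.kernelForm_add_mul_self hg hfu (-1)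
  rw [h1] at h2
  have e : (fun x => g x + -1 * φ (kernelOp μ G g x)) = kernelResidual μ G φ g := by
    ext x
    simp only [kernelResidual]
    ring
  rw [e] at h3
  have h4 := hC _ hfu
  have h5 : ∫ x, φ (kernelOp μ G g x) ^ 2 ∂μ ≤ L * (m + D * kernelForm μ G g g ^ P) := by
    have i := (hub.pow (2 * P)).integrable μ
    calc ∫ x, φ (kernelOp μ G g x) ^ 2 ∂μ
        ≤ ∫ x, L * (1 + kernelOp μ G g x ^ (2 * P)) ∂μ :=
          integral_mono ((hfu.pow 2).integrable μ) (((integrable_const 1).add i).const_mul L)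
            fun x => hφ.sq_le _
      _ = L * (m + ∫ x, kernelOp μ G g x ^ (2 * P) ∂μ) := by
          rw [integral_const_mul, integral_add (integrable_const 1) i]
          simp [hm]
      _ ≤ _ := by gcongr; exact hD g hg
  have hQ := hG.posSemidef g hg
  set q := kernelForm μ G g g with hq
  have h6 : 1 + q ≤ (1 + q) ^ P := le_self_pow₀ (by linarith) (by omega)
  have h7 : q ^ P ≤ (1 + q) ^ P := pow_le_pow_left₀ hQ (by linarith) P
  have h8 : 1 ≤ (1 + q) ^ P := one_le_pow₀ (by linarith)
  have h9 : L * (m + D * q ^ P) ≤ L * (m + D) * (1 + q) ^ P := by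
    rw [mul_assoc, add_mul]
    gcongr
    exact le_mul_of_one_le_right hm0 h8
  have h10 := mul_le_mul_of_nonneg_left (h5.trans h9) hC0
  linarith

theorem exists_almost_critical (hG : IsGreenKernel μ G) {φ : ℝ → ℝ} {L : ℝ} {P : ℕ}
    (hφ : IsPolynomialNonlinearity φ L P) (hφ0 : φ 0 = 0) {r c : ℝ} (hr : 0 ≤ r)
    (hmt : ∀ g : C(X, ℝ), kernelForm μ G g g ≤ r → kernelForm μ G g g / 8 ≤ kernelEnergy μ G φ g)
    (e : C(X, ℝ)) (he : kernelEnergy μ G φ e < 0)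
    (hc : ∀ t ∈ Icc (0 : ℝ) 1, kernelEnergy μ G φ (t • e : C(X, ℝ)) ≤ c) {ε : ℝ} (hε : 0 < ε) :
    ∃ g : C(X, ℝ), kernelForm μ G (kernelResidual μ G φ g) (kernelResidual μ G φ g) ≤ ε ∧
      r / 8 ≤ kernelEnergy μ G φ g ∧ kernelEnergy μ G φ g ≤ c := by
  obtain ⟨A, hA0, hA⟩ := hG.exists_kernelEnergy_step_le hφ
  obtain ⟨B, hB0, hB⟩ := hG.exists_kernelForm_residual_le hφ
  have hφc := hφ.continuous
  set Q : C(X, ℝ) → ℝ := fun g => kernelForm μ G g g with hQ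
  set J : C(X, ℝ) → ℝ := fun g => kernelEnergy μ G φ g with hJ
  set ρ : C(X, ℝ) → C(X, ℝ) := hG.residualMap hφc with hρ
  have hQ0 : ∀ g, 0 ≤ Q g := fun g => hG.posSemidef _ g.continuous.bddMeasurable
  have hQc : Continuous Q := hG.continuous_kernelForm_self continuous_id
  have hρc : Continuous ρ := hG.continuous_residualMap hφc
  set σ : C(X, ℝ) → ℝ := fun g => 1 / (2 * (A + 1) * (1 + Q g + Q (ρ g)) ^ P) with hσ
  have hden : ∀ g, 0 < 2 * (A + 1) * (1 + Q g + Q (ρ g)) ^ P := fun g => by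
    have := hQ0 g
    have := hQ0 (ρ g)
    positivity
  have hσ0 : ∀ g, 0 < σ g := fun g => one_div_pos.2 (hden g)
  have hσ1 : ∀ g, σ g ≤ 1 := fun g => by
    rw [hσ]
    simp only
    rw [div_le_one (hden g)]
    have h1 : (1 : ℝ) ≤ (1 + Q g + Q (ρ g)) ^ P :=
      one_le_pow₀ (by linarith [hQ0 g, hQ0 (ρ g)])
    nlinarith
  have hσc : Continuous σ := by
    refine Continuous.div continuous_const ?_ fun g => (hden g).ne'
    have := hQc.comp hρc
    simp only [Function.comp_def] at this
    fun_prop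
  set D : C(X, ℝ) → C(X, ℝ) := fun g => g + (-σ g) • ρ g with hD
  have hDc : Continuous D := continuous_id.add ((hσc.neg).smul hρc)
  have hstep : ∀ g, J (D g) ≤ J g - σ g / 2 * Q (ρ g) := fun g => by
    have h1 := hA g g.continuous.bddMeasurable (σ g) (hσ0 g).le (hσ1 g)
    have h2 : J (D g) ≤ J g - σ g * Q (ρ g) + σ g ^ 2 * (A * (1 + Q g + Q (ρ g)) ^ P * Q (ρ g)) :=
      h1
    have h3 : σ g * (A * (1 + Q g + Q (ρ g)) ^ P) ≤ 1 / 2 := by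
      have e1 : σ g * (2 * (A + 1) * (1 + Q g + Q (ρ g)) ^ P) = 1 :=
        one_div_mul_cancel (hden g).ne'
      have h4 : 0 ≤ σ g * (1 + Q g + Q (ρ g)) ^ P := by
        have := (hσ0 g).le
        have := hQ0 g
        have := hQ0 (ρ g)
        positivity
      linarith
    have h5 := mul_le_mul_of_nonneg_left h3 (mul_nonneg (hσ0 g).le (hQ0 (ρ g)))
    linarith
  have hdec : ∀ g, J (D g) ≤ J g := fun g => by
    have := hstep g
    have h1 := mul_nonneg (half_pos (hσ0 g)).le (hQ0 (ρ g))
    linarith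
  have hρ0 : ρ 0 = 0 := by
    ext x
    change (0 : ℝ) - φ (∫ y, G x y * (0 : C(X, ℝ)) y ∂μ) = 0
    simp [hφ0]
  have hD0 : D 0 = 0 := by simp [hD, hρ0]
  have hQz : Q 0 = 0 := by
    simp only [hQ, kernelForm]
    simp
  obtain ⟨t, ht, horb⟩ := exists_orbit_above (γ := fun t : ℝ => t • e) hDc
    (hG.continuous_kernelEnergy hφc) hQc (by fun_prop) hdec hQ0 (by simpa using hD0)
    (by simpa using hQz) (by simpa using he) hr hmt
  set x : ℕ → C(X, ℝ) := fun n => D^[n] (t • e) with hx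
  have hxs : ∀ n, x (n + 1) = D (x n) := fun n => Function.iterate_succ_apply' _ _ _
  have hxc : ∀ n, J (x n) ≤ c := fun n => by
    induction n with
    | zero => exact hc t ht
    | succ n ih => rw [hxs]; exact (hdec _).trans ih
  by_contra! hcon
  have hbig : ∀ n, ε < Q (ρ (x n)) := fun n => by
    by_contra! h
    exact absurd (hxc n) (not_le.2 (hcon (x n) h (horb n)))
  have hsum : ∀ n, ∑ i ∈ Finset.range n, σ (x i) * Q (ρ (x i)) ≤ 2 * (c - J (x n)) := fun n => by
    induction n with
    | zero => simpa using hxc 0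
    | succ n ih =>
      rw [Finset.sum_range_succ]
      have := hstep (x n)
      rw [← hxs] at this
      linarith
  set T := 2 * (c - r / 8) with hT
  have hsum' : ∀ n, ∑ i ∈ Finset.range n, σ (x i) * Q (ρ (x i)) ≤ T := fun n => by
    have := hsum n
    have := horb n
    linarith
  have hsε : 0 < √ε := Real.sqrt_pos.2 hε
  have hN : ∀ n, √(Q (x n)) ≤ √(Q (x 0)) + (∑ i ∈ Finset.range n, σ (x i) * Q (ρ (x i))) / √ε :=
    fun n => by
    induction n with
    | zero => simp
    | succ n ih =>
      rw [Finset.sum_range_succ, add_div, ← add_assoc]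
      have h1 : √(Q (x (n + 1))) ≤ √(Q (x n)) + |-σ (x n)| * √(Q (ρ (x n))) := by
        rw [hxs]
        exact hG.sqrt_kernelForm_add_le (x n).continuous.bddMeasurable
          (ρ (x n)).continuous.bddMeasurable _
      have h2 : |-σ (x n)| * √(Q (ρ (x n))) ≤ σ (x n) * Q (ρ (x n)) / √ε := by
        rw [abs_neg, abs_of_pos (hσ0 _), mul_div_assoc]
        refine mul_le_mul_of_nonneg_left ?_ (hσ0 _).le
        rw [le_div_iff₀ hsε]
        nth_rewrite 2 [← Real.mul_self_sqrt (hQ0 (ρ (x n)))]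
        exact mul_le_mul_of_nonneg_left (Real.sqrt_le_sqrt (hbig n).le) (Real.sqrt_nonneg _)
      linarith
  set W := (√(Q (x 0)) + T / √ε) ^ 2 with hW
  have hQW : ∀ n, Q (x n) ≤ W := fun n => by
    have h1 : √(Q (x n)) ≤ √(Q (x 0)) + T / √ε := (hN n).trans (by gcongr; exact hsum' n)
    have h2 := pow_le_pow_left₀ (Real.sqrt_nonneg _) h1 2
    rwa [Real.sq_sqrt (hQ0 _)] at h2
  have hQρ : ∀ n, Q (ρ (x n)) ≤ B * (1 + W) ^ P := fun n =>
    (hB (x n) (x n).continuous.bddMeasurable).trans (mul_le_mul_of_nonneg_left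
      (pow_le_pow_left₀ (by have := hQ0 (x n); positivity) (by have := hQW n; linarith) P) hB0)
  have hσlow : ∀ n, 1 / (2 * (A + 1) * (1 + W + B * (1 + W) ^ P) ^ P) ≤ σ (x n) := fun n => by
    refine one_div_le_one_div_of_le (hden _) (mul_le_mul_of_nonneg_left ?_ (by positivity))
    refine pow_le_pow_left₀ ?_ (by linarith [hQW n, hQρ n]) P
    have := hQ0 (x n)
    have := hQ0 (ρ (x n))
    positivity
  set s₀ := 1 / (2 * (A + 1) * (1 + W + B * (1 + W) ^ P) ^ P) with hs₀
  have hs₀0 : 0 < s₀ := by positivity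
  obtain ⟨n, hn⟩ := exists_nat_gt (T / (s₀ * ε))
  rw [div_lt_iff₀ (by positivity)] at hn
  have h1 : (n : ℝ) * (s₀ * ε) ≤ ∑ i ∈ Finset.range n, σ (x i) * Q (ρ (x i)) := by
    rw [← nsmul_eq_mul, ← Finset.card_range n, ← Finset.sum_const, Finset.card_range]
    exact Finset.sum_le_sum fun i _ => mul_le_mul (hσlow i) (hbig i).le hε.le (hσ0 _).le
  linarith [hsum' n]

end IsGreenKernel
end Descent

theorem IsRegularization.exists_primF_le {f : ℝ → ℝ} {κ : ℝ} {φ : ℕ → ℝ → ℝ}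
    (hφ : IsRegularization f κ φ) {ε : ℝ} (hε : 0 < ε) :
    ∃ C, 0 ≤ C ∧ ∀ k s, primF (φ k) s ≤ ε * s ^ 2 + C * (s ^ 4 * Real.exp (4 * π * s ^ 2)) := by
  obtain ⟨C, hC, h⟩ := hφ.exp_bound
  obtain ⟨δ, hδ, hs⟩ := hφ.small ε hε
  refine ⟨C / δ ^ 3, by positivity, fun k s => ?_⟩
  rcases le_total s 0 with h0 | h0
  · rw [primF_eq_zero_of_nonpos (hφ.eq_zero k) h0]
    positivity
  have hle : ∀ c, (∀ t ∈ Icc 0 s, φ k t ≤ c) → primF (φ k) s ≤ s * c := fun c hc => by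
    have := intervalIntegral.integral_mono_on h0 ((hφ.continuous k).intervalIntegrable _ _)
      (continuous_const.intervalIntegrable (μ := volume) 0 s) hc
    rw [intervalIntegral.integral_const, smul_eq_mul, sub_zero] at this
    exact this
  rcases le_total s δ with h1 | h1
  · have h2 : primF (φ k) s ≤ s * (ε * s) := hle _ fun t ht => (hs k t ht.1 (ht.2.trans h1)).trans
      (mul_le_mul_of_nonneg_left ht.2 hε.le)
    have h3 : 0 ≤ C / δ ^ 3 * (s ^ 4 * Real.exp (4 * π * s ^ 2)) := by positivity
    linarith
  · have h2 : primF (φ k) s ≤ s * (C * Real.exp (4 * π * s ^ 2)) := hle _ fun t ht =>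
      (h k t).trans (by
        have := ht.1
        have := ht.2
        gcongr)
    have h3 : s * (C * Real.exp (4 * π * s ^ 2)) ≤
        C / δ ^ 3 * (s ^ 4 * Real.exp (4 * π * s ^ 2)) := by
      have h4 : δ ^ 3 ≤ s ^ 3 := pow_le_pow_left₀ hδ.le h1 3
      rw [div_mul_eq_mul_div, le_div_iff₀ (by positivity)]
      have h5 : 0 ≤ s * (C * Real.exp (4 * π * s ^ 2)) := by positivity
      have h6 := mul_le_mul_of_nonneg_left h4 h5
      refine h6.trans (le_of_eq ?_)
      ring
    have h4 : 0 ≤ ε * s ^ 2 := by positivity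
    linarith

section

variable {X : Type*} [MeasurableSpace X] [MetricSpace X] [CompactSpace X] [BorelSpace X]
  {μ : Measure X} [IsFiniteMeasure μ] {G : X → X → ℝ}

theorem IsGreenKernel.exists_mountain (hG : IsGreenKernel μ G) {f : ℝ → ℝ} {κ : ℝ}
    {φ : ℕ → ℝ → ℝ} (hφ : IsRegularization f κ φ) :
    ∃ r > 0, ∀ k, ∀ g : C(X, ℝ), kernelForm μ G g g ≤ r →
      kernelForm μ G g g / 8 ≤ kernelEnergy μ G (φ k) g := by
  obtain ⟨D, hD1, hD⟩ := hG.exists_integral_kernelOp_pow_le' 1 le_rfl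
  obtain ⟨E, hE0, hE⟩ := hG.exists_integral_pow_four_mul_exp_le
  have hD0 : 0 < D := by linarith
  obtain ⟨C, hC0, hC⟩ := hφ.exists_primF_le (ε := 1 / (8 * D)) (by positivity)
  refine ⟨min (1 / 4) (1 / (4 * (C * E + 1))), by positivity, fun k g hg => ?_⟩
  have hgb := g.continuous.bddMeasurable
  have hub := hG.bddMeasurable_kernelOp hgb
  set q := kernelForm μ G g g with hq
  have hq0 : 0 ≤ q := hG.posSemidef g hgb
  have hq1 : q ≤ 1 / 4 := hg.trans (min_le_left _ _)
  have hq2 : q * (C * E + 1) ≤ 1 / 4 := by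
    have := hg.trans (min_le_right _ _)
    rw [le_div_iff₀ (by positivity)] at this
    linarith
  have h1 : ∫ x, kernelOp μ G g x ^ 2 ∂μ ≤ D * q := by simpa using hD g hgb
  have h2 := hE g hgb hq1
  have i1 := ((hub.pow 2).integrable μ)
  have i2 := (((hub.pow 4).mul (hub.comp_continuous
    (φ := fun s => Real.exp (4 * π * s ^ 2)) (by fun_prop))).integrable μ)
  have h3 : ∫ x, primF (φ k) (kernelOp μ G g x) ∂μ ≤ 1 / (8 * D) * (D * q) + C * (E * q ^ 2) := by
    calc ∫ x, primF (φ k) (kernelOp μ G g x) ∂μ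
        ≤ ∫ x, (1 / (8 * D) * kernelOp μ G g x ^ 2 + C * (kernelOp μ G g x ^ 4 *
            Real.exp (4 * π * kernelOp μ G g x ^ 2))) ∂μ :=
          integral_mono ((hub.comp_continuous (continuous_primF (hφ.continuous k))).integrable μ)
            ((i1.const_mul _).add (i2.const_mul C)) fun x => hC k _
      _ ≤ _ := by
          rw [integral_add (i1.const_mul _) (i2.const_mul C), integral_const_mul,
            integral_const_mul]
          gcongr
  have h4 : 1 / (8 * D) * (D * q) = q / 8 := by
    field_simp
  rw [h4] at h3
  have h5 : C * (E * q ^ 2) ≤ q / 4 := by nlinarith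
  have h6 : kernelEnergy μ G (φ k) g = 1 / 2 * q - ∫ x, primF (φ k) (kernelOp μ G g x) ∂μ := rfl
  rw [h6]
  linarith

end

theorem IsCriticalNonlinearity.exists_le_primF {f : ℝ → ℝ} (hf : IsCriticalNonlinearity f) (R : ℝ) :
    ∃ s₁ > 0, ∀ s, s₁ ≤ s → R * Real.exp (4 * π * s ^ 2) / s ^ 2 ≤ primF f s := by
  have hpi := Real.pi_pos
  obtain ⟨s₀, hs₀⟩ := (tendsto_atTop.1 hf.tendsto (max R 0 * Real.exp (8 * π))).exists_forall_of_atTop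
  refine ⟨max (s₀ + 1) 1, by positivity, fun s hs => ?_⟩
  rw [max_le_iff] at hs
  obtain ⟨h1, h2⟩ := hs
  have hs0 : 0 < s := by linarith
  have hinv : 1 / s ≤ 1 := by rw [div_le_one hs0]; exact h2
  have hinv0 : 0 < 1 / s := by positivity
  have hpt : ∀ t ∈ Icc (s - 1 / s) s, max R 0 * Real.exp (4 * π * s ^ 2) / s ≤ f t := by
    intro t ht
    have h3 := hs₀ t (by linarith [ht.1])
    have ht0 : 0 ≤ t := by linarith [ht.1]
    have h4 : s ^ 2 - 2 ≤ t ^ 2 := by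
      have h5 : (s - 1 / s) ^ 2 ≤ t ^ 2 := pow_le_pow_left₀ (by linarith) ht.1 2
      have h6 : (s - 1 / s) ^ 2 = s ^ 2 - 2 + (1 / s) ^ 2 := by field_simp; ring
      nlinarith [sq_nonneg (1 / s)]
    have h7 : max R 0 * Real.exp (4 * π * s ^ 2) ≤ t * f t := by
      have h8 : Real.exp (4 * π * s ^ 2) ≤ Real.exp (8 * π) * Real.exp (4 * π * t ^ 2) := by
        rw [← Real.exp_add]
        exact Real.exp_le_exp.2 (by nlinarith)
      have h9 : max R 0 * Real.exp (8 * π) * Real.exp (4 * π * t ^ 2) ≤ t * f t := by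
        have := mul_le_mul_of_nonneg_right h3 (Real.exp_pos (4 * π * t ^ 2)).le
        rwa [mul_assoc (t * f t), ← Real.exp_add, neg_add_cancel, Real.exp_zero, mul_one] at this
      have := mul_le_mul_of_nonneg_left h8 (le_max_right R 0)
      linarith
    rw [div_le_iff₀ hs0]
    nlinarith [hf.nonneg t, ht.2]
  have h3 : max R 0 * Real.exp (4 * π * s ^ 2) / s ^ 2 ≤ primF f s - primF f (s - 1 / s) := by
    unfold primF
    rw [intervalIntegral.integral_interval_sub_left (hf.continuous.intervalIntegrable _ _)
      (hf.continuous.intervalIntegrable _ _)]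
    have := intervalIntegral.integral_mono_on (by linarith)
      (continuous_const.intervalIntegrable (μ := volume) (s - 1 / s) s)
      (hf.continuous.intervalIntegrable _ _) hpt
    rw [intervalIntegral.integral_const, smul_eq_mul] at this
    refine le_trans (le_of_eq ?_) this
    field_simp
    ring
  have h4 := primF_nonneg hf.continuous hf.nonneg hf.eq_zero (s - 1 / s)
  have h5 : R * Real.exp (4 * π * s ^ 2) / s ^ 2 ≤ max R 0 * Real.exp (4 * π * s ^ 2) / s ^ 2 := by
    gcongr
    exact le_max_left _ _
  linarith

section

variable {X : Type*} [MeasurableSpace X] [TopologicalSpace X]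

/-- Existence of functions of unit energy whose potentials concentrate like Moser functions. -/
def HasMoserFunctions (μ : Measure X) (G : X → X → ℝ) : Prop :=
  ∃ c > 0, ∀ l₀ : ℝ, ∃ l ≥ l₀, ∃ g : C(X, ℝ), kernelForm μ G g g ≤ 1 ∧
    ∃ E : Set X, MeasurableSet E ∧ c * Real.exp (-(4 * π * l)) ≤ μ.real E ∧
      ∀ x ∈ E, √l ≤ kernelOp μ G g x

end

section

variable {X : Type*} [MeasurableSpace X] [MetricSpace X] [CompactSpace X] [BorelSpace X]
  {μ : Measure X} [IsFiniteMeasure μ] {G : X → X → ℝ}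

theorem kernelForm_smul_smul (g : X → ℝ) (t : ℝ) :
    kernelForm μ G (fun x => t * g x) (fun x => t * g x) = t ^ 2 * kernelForm μ G g g := by
  rw [IsLogKernel.kernelForm_const_mul_left]
  unfold kernelForm
  simp only [IsLogKernel.kernelOp_const_mul]
  rw [← integral_const_mul, ← integral_const_mul]
  congr 1 with x
  ring

theorem IsGreenKernel.exists_low_path (hG : IsGreenKernel μ G) {f : ℝ → ℝ}
    (hf : IsCriticalNonlinearity f) (hM : HasMoserFunctions μ G) :
    ∃ e : C(X, ℝ), kernelEnergy μ G f e < 0 ∧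
      ∃ c < 1 / 2, ∀ t ∈ Icc (0 : ℝ) 1, kernelEnergy μ G f (t • e : C(X, ℝ)) ≤ c := by
  have hpi := Real.pi_gt_three
  obtain ⟨c, hc, hM⟩ := hM
  obtain ⟨s₁, hs₁, hF⟩ := hf.exists_le_primF (1 / c)
  obtain ⟨l, hl, g, hQ, E, hE, hμ, hu⟩ := hM (max 1 (s₁ ^ 2))
  rw [ge_iff_le, max_le_iff] at hl
  obtain ⟨hl1, hl2⟩ := hl
  have hgb := g.continuous.bddMeasurable
  have hub := hG.bddMeasurable_kernelOp hgb
  have hFc := continuous_primF hf.continuous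
  have hF0 := primF_nonneg hf.continuous hf.nonneg hf.eq_zero
  have hFm := primF_mono_of_nonneg hf.continuous hf.nonneg
  have hQ0 := hG.posSemidef g hgb
  have hJ : ∀ t : ℝ, kernelEnergy μ G f (t • g : C(X, ℝ)) =
      1 / 2 * (t ^ 2 * kernelForm μ G g g) - ∫ x, primF f (t * kernelOp μ G g x) ∂μ := fun t => by
    rw [← kernelForm_smul_smul]
    simp only [← IsLogKernel.kernelOp_const_mul]
    rfl
  have hint : ∀ t : ℝ, Integrable (fun x => primF f (t * kernelOp μ G g x)) μ := fun t =>
    ((hub.const_mul t).comp_continuous hFc).integrable μ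
  have hsmall : ∀ t : ℝ, 0 ≤ t → kernelEnergy μ G f (t • g : C(X, ℝ)) ≤ t ^ 2 / 2 := fun t ht => by
    rw [hJ]
    have h1 : 0 ≤ ∫ x, primF f (t * kernelOp μ G g x) ∂μ := integral_nonneg fun x => hF0 _
    nlinarith [sq_nonneg t]
  have hbig : ∀ t : ℝ, 1 ≤ t → kernelEnergy μ G f (t • g : C(X, ℝ)) ≤
      t ^ 2 / 2 - Real.exp (4 * π * l * (t ^ 2 - 1)) / (t ^ 2 * l) := fun t ht => by
    have h1 : μ.real E * primF f (t * √l) ≤ ∫ x, primF f (t * kernelOp μ G g x) ∂μ := by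
      calc μ.real E * primF f (t * √l) = ∫ _ in E, primF f (t * √l) ∂μ := by
            rw [setIntegral_const, smul_eq_mul]
        _ ≤ ∫ x in E, primF f (t * kernelOp μ G g x) ∂μ := by
            refine setIntegral_mono_on (integrable_const _).integrableOn (hint t).integrableOn hE
              fun x hx => hFm ?_
            have := hu x hx
            gcongr
        _ ≤ _ := setIntegral_le_integral (hint t) (ae_of_all _ fun x => hF0 _)
    have hsq : (t * √l) ^ 2 = t ^ 2 * l := by rw [mul_pow, Real.sq_sqrt (by linarith)]
    have h2 : s₁ ≤ t * √l := by
      have h3 : s₁ ≤ √l := Real.le_sqrt_of_sq_le hl2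
      nlinarith [Real.sqrt_nonneg l]
    have h3 := hF _ h2
    rw [hsq] at h3
    have h4 : Real.exp (4 * π * l * (t ^ 2 - 1)) / (t ^ 2 * l) ≤ μ.real E * primF f (t * √l) := by
      calc Real.exp (4 * π * l * (t ^ 2 - 1)) / (t ^ 2 * l)
          = (c * Real.exp (-(4 * π * l))) *
              (1 / c * Real.exp (4 * π * (t ^ 2 * l)) / (t ^ 2 * l)) := by
            have : Real.exp (4 * π * l * (t ^ 2 - 1)) =
              Real.exp (-(4 * π * l)) * Real.exp (4 * π * (t ^ 2 * l)) := by
              rw [← Real.exp_add]; ring_nf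
            rw [this]
            field_simp
        _ ≤ _ := mul_le_mul hμ h3 (by positivity) measureReal_nonneg
    rw [hJ]
    nlinarith [sq_nonneg t]
  have hlt : ∀ t : ℝ, 0 ≤ t → kernelEnergy μ G f (t • g : C(X, ℝ)) < 1 / 2 := fun t ht => by
    rcases lt_or_ge t 1 with h1 | h1
    · refine (hsmall t ht).trans_lt ?_
      nlinarith
    · refine (hbig t h1).trans_lt ?_
      have ht2 : 1 ≤ t ^ 2 := one_le_pow₀ h1
      set τ := t ^ 2 - 1 with hτ
      have hτ0 : 0 ≤ τ := by linarith
      have e1 : t ^ 2 = 1 + τ := by rw [hτ]; ring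
      have h2 : τ / 2 < Real.exp (4 * π * l * τ) / (t ^ 2 * l) := by
        rw [lt_div_iff₀ (by positivity), e1]
        have h3 := Real.quadratic_le_exp_of_nonneg (x := 4 * π * l * τ) (by positivity)
        have h4 : 0 ≤ l * τ := by positivity
        have h5 : 3 * (l * τ) ≤ π * (l * τ) := mul_le_mul_of_nonneg_right hpi.le h4
        have h6 : 9 * (l * τ) ^ 2 ≤ (π * (l * τ)) ^ 2 := by nlinarith
        have h7 : l * τ ^ 2 ≤ (l * τ) ^ 2 := by
          rw [mul_pow]
          nlinarith [sq_nonneg τ]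
        nlinarith
      linarith
  refine ⟨√2 • g, ?_, ?_⟩
  · refine (hbig (√2) (by rw [Real.one_le_sqrt]; norm_num)).trans_lt ?_
    rw [Real.sq_sqrt (by norm_num)]
    have h2 : 1 < Real.exp (4 * π * l * (2 - 1)) / (2 * l) := by
      rw [lt_div_iff₀ (by positivity)]
      have h3 := Real.add_one_le_exp (4 * π * l * (2 - 1))
      nlinarith
    linarith
  · have hcont : Continuous fun t : ℝ => kernelEnergy μ G f (t • (√2 • g) : C(X, ℝ)) :=
      (hG.continuous_kernelEnergy hf.continuous).comp (continuous_id.smul continuous_const)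
    obtain ⟨t₀, ht₀, hmax⟩ := isCompact_Icc.exists_isMaxOn (nonempty_Icc.2 zero_le_one)
      (hcont.continuousOn (s := Icc (0 : ℝ) 1))
    refine ⟨_, ?_, fun t ht => hmax ht⟩
    simp only [smul_smul]
    exact hlt _ (mul_nonneg ht₀.1 (Real.sqrt_nonneg _))

/-- Almost critical points of the regularized functionals at a level below `1/2`. -/
theorem IsGreenKernel.exists_almost_critical_seq (hG : IsGreenKernel μ G) {f : ℝ → ℝ}
    (hf : IsCriticalNonlinearity f) (hM : HasMoserFunctions μ G) :
    ∃ c < 1 / 2, ∀ (κ : ℝ) (φ : ℕ → ℝ → ℝ), IsRegularization f κ φ →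
      ∃ ρ > 0, ∃ k₀, ∀ k ≥ k₀, ∀ ε > 0, ∃ g : C(X, ℝ),
        kernelForm μ G (kernelResidual μ G (φ k) g) (kernelResidual μ G (φ k) g) ≤ ε ∧
          ρ ≤ kernelEnergy μ G (φ k) g ∧ kernelEnergy μ G (φ k) g ≤ c := by
  obtain ⟨e, he, c, hc, hpath⟩ := hG.exists_low_path hf hM
  refine ⟨(c + 1 / 2) / 2, by linarith, fun κ φ hφ => ?_⟩
  obtain ⟨r, hr, hmt⟩ := hG.exists_mountain hφ
  have heb := e.continuous.bddMeasurable
  have hub := hG.bddMeasurable_kernelOp heb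
  obtain ⟨A, hA0, hA⟩ := hub.exists_nonneg_bound
  set m := μ.real univ with hm
  have hm0 : 0 ≤ m := measureReal_nonneg
  set η := min ((1 / 2 - c) / 2) (-kernelEnergy μ G f e / 2) / (m + 1) with hη
  have hη0 : 0 < η := div_pos (lt_min (by linarith) (by linarith)) (by linarith)
  have hηm : η * m ≤ min ((1 / 2 - c) / 2) (-kernelEnergy μ G f e / 2) := by
    have : η * (m + 1) = min ((1 / 2 - c) / 2) (-kernelEnergy μ G f e / 2) := by
      rw [hη]
      field_simp
    linarith
  obtain ⟨k₀, hk₀⟩ := (hφ.primF_ge A η hη0).exists_forall_of_atTop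
  have hcmp : ∀ k ≥ k₀, ∀ t ∈ Icc (0 : ℝ) 1, kernelEnergy μ G (φ k) (t • e : C(X, ℝ)) ≤
      kernelEnergy μ G f (t • e : C(X, ℝ)) + η * m := fun k hk t ht => by
    have hvb := hG.bddMeasurable_kernelOp (t • e).continuous.bddMeasurable
    have hv : ∀ x, kernelOp μ G (t • e : C(X, ℝ)) x ≤ A := fun x => by
      have h1 : kernelOp μ G (t • e : C(X, ℝ)) x = t * kernelOp μ G e x :=
        IsLogKernel.kernelOp_const_mul e t x
      rw [h1]
      have h2 := (le_abs_self _).trans (hA x)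
      rcases le_total 0 (kernelOp μ G e x) with h | h
      · nlinarith [ht.1, ht.2]
      · nlinarith [ht.1, ht.2]
    have i1 := (hvb.comp_continuous (continuous_primF hf.continuous)).integrable μ
    have i2 := (hvb.comp_continuous (continuous_primF (hφ.continuous k))).integrable μ
    have h1 : (∫ x, primF f (kernelOp μ G (t • e : C(X, ℝ)) x) ∂μ) - η * m ≤
        ∫ x, primF (φ k) (kernelOp μ G (t • e : C(X, ℝ)) x) ∂μ := by
      have h2 : ∫ _ : X, η ∂μ = η * m := by simp [hm, mul_comm]
      rw [← h2, ← integral_sub i1 (integrable_const η)]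
      exact integral_mono (i1.sub (integrable_const η)) i2 fun x => hk₀ k hk _ (hv x)
    unfold kernelEnergy
    linarith
  refine ⟨r / 8, by linarith, k₀, fun k hk ε hε => ?_⟩
  obtain ⟨L, P, hpoly⟩ := hφ.polynomial k
  refine hG.exists_almost_critical hpoly (hφ.eq_zero k 0 le_rfl) hr.le (hmt k) e ?_ ?_ hε
  · have h1 := hcmp k hk 1 ⟨zero_le_one, le_rfl⟩
    rw [one_smul] at h1
    linarith [min_le_right ((1 / 2 - c) / 2) (-kernelEnergy μ G f e / 2)]
  · intro t ht
    have h1 := hcmp k hk t ht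
    have h2 := hpath t ht
    linarith [min_le_left ((1 / 2 - c) / 2) (-kernelEnergy μ G f e / 2)]

end

theorem IsRegularization.exists_primF_le_abs {f : ℝ → ℝ} {κ : ℝ} {φ : ℕ → ℝ → ℝ}
    (hφ : IsRegularization f κ φ) (hκ : 0 ≤ κ) :
    ∃ A, 0 ≤ A ∧ ∀ k s, primF (φ k) s ≤ κ * (s * φ k s) + A * |s| := by
  obtain ⟨C, hC0, hC⟩ := hφ.exp_bound
  obtain ⟨S, hS0, hS⟩ := hφ.primF_le
  refine ⟨C * Real.exp (4 * π * S ^ 2), by positivity, fun k s => ?_⟩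
  rcases le_total s 0 with hs | hs
  · rw [primF_eq_zero_of_nonpos (hφ.eq_zero k) hs, hφ.eq_zero k s hs]
    simp only [mul_zero, zero_add]
    positivity
  have h0 : 0 ≤ κ * (s * φ k s) := mul_nonneg hκ (mul_nonneg hs (hφ.nonneg k s))
  rcases le_total S s with h1 | h1
  · exact (hS k s h1).trans (le_add_of_nonneg_right (by positivity))
  · have h2 : primF (φ k) s ≤ C * Real.exp (4 * π * S ^ 2) * |s| := by
      unfold primF
      have h3 := intervalIntegral.norm_integral_le_of_norm_le_const (a := 0) (b := s)
        (f := φ k) (C := C * Real.exp (4 * π * S ^ 2)) (fun t ht => by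
          rw [uIoc_of_le hs] at ht
          rw [Real.norm_eq_abs, abs_of_nonneg (hφ.nonneg k t)]
          refine (hC k t).trans ?_
          have : t ^ 2 ≤ S ^ 2 := pow_le_pow_left₀ ht.1.le (ht.2.trans h1) 2
          have hpi := Real.pi_pos
          gcongr)
      rw [sub_zero] at h3
      exact (le_abs_self _).trans h3
    linarith

theorem exists_mul_exp_sq_le {a b ε : ℝ} (hab : a < b) (hε : 0 < ε) :
    ∃ N, 0 < N ∧ ∀ s, N ≤ s → s * Real.exp (a * s ^ 2) ≤ ε * Real.exp (b * s ^ 2) := by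
  have hd : 0 < b - a := by linarith
  refine ⟨1 / (ε * (b - a)), by positivity, fun s hs => ?_⟩
  have hs0 : 0 < s := lt_of_lt_of_le (by positivity) hs
  have h1 : b * s ^ 2 = a * s ^ 2 + (b - a) * s ^ 2 := by ring
  rw [h1, Real.exp_add]
  have h2 : s ≤ ε * Real.exp ((b - a) * s ^ 2) := by
    have h3 := Real.add_one_le_exp ((b - a) * s ^ 2)
    have h4 : 1 ≤ s * (ε * (b - a)) := by
      rwa [div_le_iff₀ (by positivity)] at hs
    have h5 : s ≤ ε * ((b - a) * s ^ 2) := by nlinarith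
    nlinarith
  calc s * Real.exp (a * s ^ 2) ≤ (ε * Real.exp ((b - a) * s ^ 2)) * Real.exp (a * s ^ 2) := by
        gcongr
    _ = _ := by ring

theorem IsRegularization.exists_mul_le {f : ℝ → ℝ} {κ : ℝ} {φ : ℕ → ℝ → ℝ}
    (hφ : IsRegularization f κ φ) {b ε : ℝ} (hb : 4 * π < b) (hε : 0 < ε) :
    ∃ A, 0 ≤ A ∧ ∀ k s, φ k s * s ≤ A * |s| + ε * Real.exp (b * s ^ 2) := by
  obtain ⟨C, hC0, hC⟩ := hφ.exp_bound
  obtain ⟨N, hN0, hN⟩ := exists_mul_exp_sq_le hb (div_pos hε hC0)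
  refine ⟨C * Real.exp (4 * π * N ^ 2), by positivity, fun k s => ?_⟩
  rcases le_total s 0 with hs | hs
  · rw [hφ.eq_zero k s hs, zero_mul]
    positivity
  rcases le_total N s with h1 | h1
  · have h2 := hN s h1
    have h3 : φ k s * s ≤ C * Real.exp (4 * π * s ^ 2) * s :=
      mul_le_mul_of_nonneg_right (hC k s) hs
    have h4 : C * (s * Real.exp (4 * π * s ^ 2)) ≤ C * (ε / C * Real.exp (b * s ^ 2)) :=
      mul_le_mul_of_nonneg_left h2 hC0.le
    have h5 : C * (ε / C * Real.exp (b * s ^ 2)) = ε * Real.exp (b * s ^ 2) := by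
      field_simp
    have h6 : 0 ≤ C * Real.exp (4 * π * N ^ 2) * |s| := by positivity
    nlinarith
  · have h3 : φ k s * s ≤ C * Real.exp (4 * π * N ^ 2) * s := by
      refine mul_le_mul_of_nonneg_right ((hC k s).trans ?_) hs
      have : s ^ 2 ≤ N ^ 2 := pow_le_pow_left₀ hs h1 2
      have hpi := Real.pi_pos
      gcongr
    rw [abs_of_nonneg hs]
    have : 0 ≤ ε * Real.exp (b * s ^ 2) := by positivity
    linarith

section

variable {X : Type*} [MeasurableSpace X] [MetricSpace X] [CompactSpace X] [BorelSpace X]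
  {μ : Measure X} [IsFiniteMeasure μ] {G : X → X → ℝ}

theorem IsGreenKernel.integral_comp_kernelOp_mul (hG : IsGreenKernel μ G) {φ : ℝ → ℝ}
    (hφ : Continuous φ) {g : X → ℝ} (hg : BddMeasurable g) :
    ∫ x, φ (kernelOp μ G g x) * kernelOp μ G g x ∂μ =
      kernelForm μ G g g - kernelForm μ G (kernelResidual μ G φ g) g := by
  have hK := hG.bddMeasurable_kernelOp hg
  have hr := hG.bddMeasurable_kernelResidual hφ hg
  unfold kernelForm
  rw [← integral_sub ((hg.mul hK).integrable μ) ((hr.mul hK).integrable μ)]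
  congr 1 with x
  unfold kernelResidual
  ring

theorem IsGreenKernel.exists_integral_abs_kernelOp_le (hG : IsGreenKernel μ G) :
    ∃ C, 0 ≤ C ∧ ∀ g : X → ℝ, BddMeasurable g →
      ∫ x, |kernelOp μ G g x| ∂μ ≤ C * √(kernelForm μ G g g) := by
  obtain ⟨C, hC1, hC⟩ := hG.exists_integral_kernelOp_pow_le' 1 le_rfl
  refine ⟨√(C * μ.real univ), Real.sqrt_nonneg _, fun g hg => ?_⟩
  have hK := hG.bddMeasurable_kernelOp hg
  have h1 := BddMeasurable.integral_mul_sq_le (μ := μ) hK.abs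
    (⟨measurable_const, 1, fun _ => by simp⟩ : BddMeasurable (fun _ : X => (1 : ℝ)))
  have h2 := hC g hg
  simp only [mul_one, one_pow, sq_abs, integral_const, smul_eq_mul, pow_one] at h1 h2
  rw [← Real.sqrt_mul (by positivity)]
  refine Real.le_sqrt_of_sq_le (h1.trans ?_)
  calc (∫ x, kernelOp μ G g x ^ 2 ∂μ) * μ.real univ ≤ C * kernelForm μ G g g * μ.real univ := by
        gcongr
    _ = _ := by ring

theorem IsGreenKernel.kernelForm_le_sqrt_mul_sqrt (hG : IsGreenKernel μ G) {g h : X → ℝ}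
    (hg : BddMeasurable g) (hh : BddMeasurable h) :
    |kernelForm μ G g h| ≤ √(kernelForm μ G g g) * √(kernelForm μ G h h) := by
  rw [← Real.sqrt_mul (hG.posSemidef g hg)]
  exact Real.abs_le_sqrt (hG.kernelForm_sq_le hg hh)

theorem IsGreenKernel.kernelForm_le_of_energy_le (hG : IsGreenKernel μ G) {κ A c : ℝ}
    (hκ : 0 ≤ κ)
    {φ : ℝ → ℝ} (hφ : Continuous φ) (hA : ∀ s, primF φ s ≤ κ * (s * φ s) + A * |s|)
    {g : X → ℝ} (hg : BddMeasurable g) (hJ : kernelEnergy μ G φ g ≤ c) :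
    (1 / 2 - κ) * kernelForm μ G g g ≤ c + A * ∫ x, |kernelOp μ G g x| ∂μ +
      κ * (√(kernelForm μ G (kernelResidual μ G φ g) (kernelResidual μ G φ g)) *
        √(kernelForm μ G g g)) := by
  have hK := hG.bddMeasurable_kernelOp hg
  have hr := hG.bddMeasurable_kernelResidual hφ hg
  have h1 := hG.integral_comp_kernelOp_mul hφ hg
  have h2 := (abs_le.mp (hG.kernelForm_le_sqrt_mul_sqrt hr hg)).1
  have hφK : BddMeasurable (fun x => φ (kernelOp μ G g x) * kernelOp μ G g x) :=
    (hK.comp_continuous hφ).mul hK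
  have h3 : ∫ x, primF φ (kernelOp μ G g x) ∂μ ≤
      κ * (∫ x, φ (kernelOp μ G g x) * kernelOp μ G g x ∂μ) +
        A * ∫ x, |kernelOp μ G g x| ∂μ := by
    rw [← integral_const_mul, ← integral_const_mul,
      ← integral_add ((hφK.const_mul κ).integrable μ) ((hK.abs.const_mul A).integrable μ)]
    refine integral_mono ((hK.comp_continuous (continuous_primF hφ)).integrable μ)
      (((hφK.const_mul κ).add (hK.abs.const_mul A)).integrable μ) fun x => ?_
    have := hA (kernelOp μ G g x)
    simp only
    rwa [mul_comm (φ _)]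
  unfold kernelEnergy at hJ
  rw [h1] at h3
  nlinarith

/-- Almost critical points of the regularized functionals at low energy levels are bounded and
stay away from zero. -/
theorem IsGreenKernel.exists_bound_of_almost_critical (hG : IsGreenKernel μ G) {f : ℝ → ℝ}
    {κ c ρ : ℝ} {φ : ℕ → ℝ → ℝ} (hφ : IsRegularization f κ φ) (hκ0 : 0 < κ)
    (hκ : κ < 1 / 2 - c) (hc : 0 ≤ c) (hρ : 0 < ρ) :
    ∃ A δ, 0 ≤ A ∧ 0 < δ ∧ ∀ k (g : X → ℝ), BddMeasurable g →
      √(kernelForm μ G (kernelResidual μ G (φ k) g) (kernelResidual μ G (φ k) g)) ≤ δ →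
      ρ ≤ kernelEnergy μ G (φ k) g → kernelEnergy μ G (φ k) g ≤ c →
      √(kernelForm μ G g g) ≤ A ∧ δ ≤ ∫ x, |kernelOp μ G g x| ∂μ := by
  obtain ⟨A₁, hA₁0, hA₁⟩ := hφ.exists_primF_le_abs hκ0.le
  obtain ⟨C₁, hC₁0, hC₁⟩ := hG.exists_integral_abs_kernelOp_le
  have hd : 0 < 1 / 2 - κ := by linarith
  set d := 1 / 2 - κ with hd_def
  -- crude bound, valid as soon as the residual is at most one
  set A := (c + A₁ * C₁ + κ) / d + 1 with hA_def
  have hA0 : 1 ≤ A := by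
    rw [hA_def]
    have : 0 ≤ (c + A₁ * C₁ + κ) / d := by positivity
    linarith
  have hbound : ∀ k (g : X → ℝ), BddMeasurable g →
      √(kernelForm μ G (kernelResidual μ G (φ k) g) (kernelResidual μ G (φ k) g)) ≤ 1 →
      kernelEnergy μ G (φ k) g ≤ c → √(kernelForm μ G g g) ≤ A := by
    intro k g hg hr hJ
    have h1 := hG.kernelForm_le_of_energy_le hκ0.le (hφ.continuous k) (hA₁ k) hg hJ
    have h2 := hC₁ g hg
    have hQ := Real.mul_self_sqrt (hG.posSemidef g hg)
    set x := √(kernelForm μ G g g)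
    have hx0 : 0 ≤ x := Real.sqrt_nonneg _
    rw [← hQ] at h1
    by_contra hlt
    push Not at hlt
    have hx1 : 1 ≤ x := hA0.trans hlt.le
    have h3 : d * (x * x) ≤ c * x + A₁ * C₁ * x + κ * x := by
      have e1 : A₁ * ∫ x, |kernelOp μ G g x| ∂μ ≤ A₁ * (C₁ * x) :=
        mul_le_mul_of_nonneg_left h2 hA₁0
      have e2 := mul_le_mul_of_nonneg_left (mul_le_mul_of_nonneg_right hr hx0) hκ0.le
      nlinarith
    have h4 : d * x ≤ c + A₁ * C₁ + κ := by
      have : x * (d * x) ≤ x * (c + A₁ * C₁ + κ) := by nlinarith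
      exact le_of_mul_le_mul_left this (by linarith)
    have h5 : x ≤ (c + A₁ * C₁ + κ) / d := by
      rw [le_div_iff₀ hd]
      linarith
    linarith
  obtain ⟨q, hq1, hq2⟩ : ∃ q, c / d < q ∧ q < 1 := exists_between (by
    rw [div_lt_one hd]; linarith)
  have hq0 : 0 < q := lt_of_le_of_lt (by positivity) hq1
  have hpi := Real.pi_pos
  obtain ⟨b, hb1, hb2⟩ : ∃ b, 4 * π < b ∧ b < 4 * π / q := exists_between (by
    rw [lt_div_iff₀ hq0]
    nlinarith)
  rw [lt_div_iff₀ hq0] at hb2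
  obtain ⟨C₂, hC₂⟩ := hG.exists_integral_exp_le (by linarith) hq0.le hb2
  have hC₂p : 0 < |C₂| + 1 := by positivity
  obtain ⟨A₂, hA₂0, hA₂⟩ := hφ.exists_mul_le hb1 (ε := ρ / (2 * (|C₂| + 1))) (by positivity)
  rw [div_lt_iff₀ hd] at hq1
  obtain ⟨δ, hδ0, hδ1, hδ2, hδ3⟩ : ∃ δ > 0, δ ≤ 1 ∧ δ * (A₁ + κ * A) ≤ q * d - c ∧
      δ * (A₂ + A) ≤ ρ / 2 := by
    have hp1 : 0 < A₁ + κ * A := by positivity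
    have hp2 : 0 < A₂ + A := by positivity
    have hp3 : 0 < q * d - c := by linarith
    refine ⟨min 1 (min ((q * d - c) / (A₁ + κ * A)) (ρ / 2 / (A₂ + A))), by positivity,
      min_le_left _ _, ?_, ?_⟩
    · rw [← le_div_iff₀ hp1]
      exact (min_le_right _ _).trans (min_le_left _ _)
    · rw [← le_div_iff₀ hp2]
      exact (min_le_right _ _).trans (min_le_right _ _)
  refine ⟨A, δ, by linarith, hδ0, fun k g hg hr hJ1 hJ2 => ?_⟩
  have hgA := hbound k g hg (hr.trans hδ1) hJ2
  refine ⟨hgA, ?_⟩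
  by_contra hlt
  push Not at hlt
  have hQ0 := Real.sqrt_nonneg (kernelForm μ G g g)
  have hR0 := Real.sqrt_nonneg
    (kernelForm μ G (kernelResidual μ G (φ k) g) (kernelResidual μ G (φ k) g))
  have hprod := mul_le_mul hr hgA hQ0 hδ0.le
  have hK := hG.bddMeasurable_kernelOp hg
  have hQq : kernelForm μ G g g ≤ q := by
    have h1 := hG.kernelForm_le_of_energy_le hκ0.le (hφ.continuous k) (hA₁ k) hg hJ2
    have e1 : A₁ * ∫ x, |kernelOp μ G g x| ∂μ ≤ A₁ * δ :=
      mul_le_mul_of_nonneg_left hlt.le hA₁0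
    have e2 := mul_le_mul_of_nonneg_left hprod hκ0.le
    have : d * kernelForm μ G g g ≤ d * q := by nlinarith
    exact le_of_mul_le_mul_left this hd
  have hexp := hC₂ g hg hQq
  have hφK : BddMeasurable (fun x => φ k (kernelOp μ G g x) * kernelOp μ G g x) :=
    (hK.comp_continuous (hφ.continuous k)).mul hK
  have hKe : BddMeasurable (fun x => Real.exp (b * kernelOp μ G g x ^ 2)) :=
    hK.comp_continuous (φ := fun s => Real.exp (b * s ^ 2)) (by fun_prop)
  have h2 : ∫ x, φ k (kernelOp μ G g x) * kernelOp μ G g x ∂μ ≤ A₂ * δ + ρ / 2 := by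
    calc ∫ x, φ k (kernelOp μ G g x) * kernelOp μ G g x ∂μ
        ≤ ∫ x, (A₂ * |kernelOp μ G g x| +
          ρ / (2 * (|C₂| + 1)) * Real.exp (b * kernelOp μ G g x ^ 2)) ∂μ :=
          integral_mono (hφK.integrable μ)
            (((hK.abs.const_mul _).add (hKe.const_mul _)).integrable μ) fun x => hA₂ k _
      _ = A₂ * (∫ x, |kernelOp μ G g x| ∂μ) +
          ρ / (2 * (|C₂| + 1)) * ∫ x, Real.exp (b * kernelOp μ G g x ^ 2) ∂μ := by
          rw [integral_add ((hK.abs.const_mul _).integrable μ) ((hKe.const_mul _).integrable μ),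
            integral_const_mul, integral_const_mul]
      _ ≤ A₂ * δ + ρ / (2 * (|C₂| + 1)) * (|C₂| + 1) := by
          gcongr
          exact hexp.trans ((le_abs_self _).trans (by linarith))
      _ = A₂ * δ + ρ / 2 := by
          congr 1
          field_simp
  rw [hG.integral_comp_kernelOp_mul (hφ.continuous k) hg] at h2
  have h3 := (abs_le.mp (hG.kernelForm_le_sqrt_mul_sqrt
    (hG.bddMeasurable_kernelResidual (hφ.continuous k) hg) hg)).2
  have h4 : 0 ≤ ∫ x, primF (φ k) (kernelOp μ G g x) ∂μ :=
    integral_nonneg fun x => primF_nonneg (hφ.continuous k) (hφ.nonneg k) (hφ.eq_zero k) _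
  unfold kernelEnergy at hJ1
  nlinarith

end

section

variable {X : Type*} [MeasurableSpace X] [MetricSpace X] [CompactSpace X] [BorelSpace X]
  {μ : Measure X} [IsFiniteMeasure μ] {G : X → X → ℝ}

theorem IsGreenKernel.exists_integral_le (hG : IsGreenKernel μ G) :
    ∃ C, 0 ≤ C ∧ ∀ x, ∫ y, G x y ∂μ ≤ C := by
  have hpi := Real.pi_pos
  obtain ⟨C, hC1, hC⟩ := hG.exists_integral_pow_le hpi (by linarith)
  refine ⟨C * (1 / π), by positivity, fun x => ?_⟩
  simpa using hC 1 x

theorem IsGreenKernel.integrable_prod_of_integrable (hG : IsGreenKernel μ G) {g : X → ℝ}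
    (hg : Measurable g) (hgi : Integrable g μ) :
    Integrable (fun p : X × X => G p.1 p.2 * g p.2) (μ.prod μ) := by
  obtain ⟨C, hC0, hC⟩ := hG.exists_integral_le
  have hm : Measurable (fun p : X × X => G p.1 p.2 * g p.2) :=
    (hG.measurable : Measurable fun p : X × X => G p.1 p.2).mul (hg.comp measurable_snd)
  rw [integrable_prod_iff' hm.aestronglyMeasurable]
  have e : ∀ y, (fun x => G x y) = G y := fun y => funext fun x => hG.symm x y
  constructor
  · refine ae_of_all _ fun y => ?_
    simp only
    exact Integrable.mul_const (by rw [e]; exact hG.integrable_left y) _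
  · refine Integrable.mono' (hgi.abs.const_mul C)
      (hm.norm.stronglyMeasurable.integral_prod_left').aestronglyMeasurable
      (ae_of_all _ fun y => ?_)
    simp only [norm_mul, Real.norm_eq_abs]
    rw [integral_mul_const, abs_mul, abs_abs, abs_of_nonneg (integral_nonneg fun _ => abs_nonneg _)]
    refine mul_le_mul_of_nonneg_right ?_ (abs_nonneg _)
    simp only [abs_of_nonneg (hG.nonneg _ _)]
    rw [e]
    exact hC y

theorem IsGreenKernel.measurable_kernelOp (hG : IsGreenKernel μ G) {g : X → ℝ}
    (hg : Measurable g) : Measurable (kernelOp μ G g) := by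
  have hm : Measurable (fun p : X × X => G p.1 p.2 * g p.2) :=
    (hG.measurable : Measurable fun p : X × X => G p.1 p.2).mul (hg.comp measurable_snd)
  exact (hm.stronglyMeasurable.integral_prod_right').measurable

theorem IsGreenKernel.exists_integral_abs_kernelOp_sub_le (hG : IsGreenKernel μ G) :
    ∃ C, 0 ≤ C ∧ ∀ g h : X → ℝ, Measurable g → Integrable g μ → Measurable h → Integrable h μ →
      Integrable (fun x => |kernelOp μ G g x - kernelOp μ G h x|) μ ∧
      ∫ x, |kernelOp μ G g x - kernelOp μ G h x| ∂μ ≤ C * ∫ x, |g x - h x| ∂μ := by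
  obtain ⟨C, hC0, hC⟩ := hG.exists_integral_le
  refine ⟨C, hC0, fun g h hg hgi hh hhi => ?_⟩
  have i1 := hG.integrable_prod_of_integrable hg hgi
  have i2 := hG.integrable_prod_of_integrable hh hhi
  have i3 := hG.integrable_prod_of_integrable (g := fun x => |g x - h x|) (hg.sub hh).abs
    (hgi.sub hhi).abs
  have hI : Integrable (fun x => |kernelOp μ G g x - kernelOp μ G h x|) μ :=
    (i1.integral_prod_left.sub i2.integral_prod_left).abs
  refine ⟨hI, ?_⟩
  calc ∫ x, |kernelOp μ G g x - kernelOp μ G h x| ∂μ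
      ≤ ∫ x, ∫ y, G x y * |g y - h y| ∂μ ∂μ := by
        refine integral_mono_ae hI i3.integral_prod_left ?_
        filter_upwards [i1.prod_right_ae, i2.prod_right_ae] with x h1 h2
        unfold kernelOp
        rw [← integral_sub h1 h2]
        refine (abs_integral_le_integral_abs).trans (le_of_eq ?_)
        congr 1 with y
        rw [← mul_sub, abs_mul, abs_of_nonneg (hG.nonneg x y)]
    _ = ∫ y, ∫ x, G x y * |g y - h y| ∂μ ∂μ := integral_integral_swap i3
    _ ≤ ∫ y, C * |g y - h y| ∂μ := by
        refine integral_mono i3.integral_prod_right ((hgi.sub hhi).abs.const_mul C) fun y => ?_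
        simp only
        rw [integral_mul_const]
        refine mul_le_mul_of_nonneg_right ?_ (abs_nonneg _)
        simp only [hG.symm _ y]
        exact hC y
    _ = _ := integral_const_mul _ _

theorem IsGreenKernel.totallyBounded_kernelOp (hG : IsGreenKernel μ G) (M : ℝ) :
    TotallyBounded {v : BoundedContinuousFunction X ℝ |
      ∃ g : X → ℝ, Measurable g ∧ (∀ x, |g x| ≤ M) ∧ ⇑v = kernelOp μ G g} := by
  obtain ⟨C, hC0, hC⟩ := hG.exists_integral_le
  refine TotallyBounded.subset subset_closure (IsCompact.totallyBounded
    (BoundedContinuousFunction.arzela_ascoli (Icc (-(C * M)) (C * M)) isCompact_Icc _ ?_ ?_))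
  · rintro v x ⟨g, hg, hM, hv⟩
    rw [hv, mem_Icc, ← abs_le]
    have hb : BddMeasurable g := ⟨hg, M, hM⟩
    have hM0 : 0 ≤ M := (abs_nonneg _).trans (hM x)
    calc |kernelOp μ G g x| ≤ ∫ y, |G x y * g y| ∂μ := abs_integral_le_integral_abs
      _ ≤ ∫ y, G x y * M ∂μ := by
          refine integral_mono (hG.integrable_mul hb x).abs ((hG.integrable_left x).mul_const M)
            fun y => ?_
          simp only
          rw [abs_mul, abs_of_nonneg (hG.nonneg x y)]
          exact mul_le_mul_of_nonneg_left (hM y) (hG.nonneg x y)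
      _ = (∫ y, G x y ∂μ) * M := integral_mul_const _ _
      _ ≤ C * M := mul_le_mul_of_nonneg_right (hC x) hM0
  · intro x₀
    rw [Metric.equicontinuousAt_iff_right]
    intro ε hε
    have h1 := (hG.integral_abs_sub_tendsto x₀).mul_const M
    rw [zero_mul] at h1
    filter_upwards [h1.eventually (gt_mem_nhds hε)] with x hx
    rintro ⟨v, g, hg, hM, hv⟩
    rw [dist_comm, Real.dist_eq]
    simp only [hv]
    exact (hG.abs_kernelOp_sub_le hg hM x₀ x).trans_lt hx

/-- A Green operator maps uniformly integrable sequences to relatively compact ones. -/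
theorem IsGreenKernel.exists_subseq_kernelOp (hG : IsGreenKernel μ G) {h : ℕ → X → ℝ}
    (hb : ∀ n, BddMeasurable (h n))
    (hui : ∀ ε > 0, ∃ M, ∀ n, ∃ h' : X → ℝ, Measurable h' ∧ (∀ x, |h' x| ≤ M) ∧
      ∫ x, |h n x - h' x| ∂μ ≤ ε) :
    ∃ w : X → ℝ, Measurable w ∧ Integrable w μ ∧ ∃ σ : ℕ → ℕ, StrictMono σ ∧
      Tendsto (fun j => ∫ x, |kernelOp μ G (h (σ j)) x - w x| ∂μ) atTop (𝓝 0) := by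
  let V : (g : X → ℝ) → BddMeasurable g → BoundedContinuousFunction X ℝ := fun g hg =>
    BoundedContinuousFunction.mkOfCompact ⟨kernelOp μ G g, hG.continuous_kernelOp hg⟩
  have hV : ∀ g hg, ⇑(V g hg) = kernelOp μ G g := fun _ _ => rfl
  let L := BoundedContinuousFunction.toLp (E := ℝ) 1 μ ℝ
  have hL : ∀ v : BoundedContinuousFunction X ℝ, L v =ᵐ[μ] v := fun v =>
    BoundedContinuousFunction.coeFn_toLp 1 μ ℝ v
  obtain ⟨C, hC0, hC⟩ := hG.exists_integral_abs_kernelOp_sub_le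
  let T : ℕ → Lp ℝ 1 μ := fun n => L (V (h n) (hb n))
  have hT : TotallyBounded (range T) := by
    rw [Metric.totallyBounded_iff]
    intro ε hε
    obtain ⟨M, hM⟩ := hui (ε / 2 / (C + 1)) (by positivity)
    have h1 := (hG.totallyBounded_kernelOp M).image L.uniformContinuous
    rw [Metric.totallyBounded_iff] at h1
    obtain ⟨t, ht, hcov⟩ := h1 (ε / 2) (by positivity)
    refine ⟨t, ht, ?_⟩
    rintro _ ⟨n, rfl⟩
    obtain ⟨h', hh', hM', hle⟩ := hM n
    have hb' : BddMeasurable h' := ⟨hh', M, hM'⟩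
    have h2 := hcov (mem_image_of_mem L (show V h' hb' ∈ _ from ⟨h', hh', hM', hV _ hb'⟩))
    rw [mem_iUnion₂] at h2 ⊢
    obtain ⟨y, hy, hyb⟩ := h2
    refine ⟨y, hy, ?_⟩
    have h3 : dist (T n) (L (V h' hb')) < ε / 2 := by
      rw [dist_eq_norm, L1.norm_eq_integral_norm]
      have e : ∫ x, ‖(T n - L (V h' hb')) x‖ ∂μ =
          ∫ x, |kernelOp μ G (h n) x - kernelOp μ G h' x| ∂μ := by
        refine integral_congr_ae ?_
        filter_upwards [Lp.coeFn_sub (T n) (L (V h' hb')), hL (V (h n) (hb n)),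
          hL (V h' hb')] with x e1 e2 e3
        rw [e1, Pi.sub_apply, e2, e3, Real.norm_eq_abs]
        rfl
      rw [e]
      refine (hC _ _ (hb n).1 ((hb n).integrable μ) hh' (hb'.integrable μ)).2.trans_lt ?_
      calc C * ∫ x, |h n x - h' x| ∂μ ≤ C * (ε / 2 / (C + 1)) :=
            mul_le_mul_of_nonneg_left hle hC0
        _ < (C + 1) * (ε / 2 / (C + 1)) := by
            have : 0 < ε / 2 / (C + 1) := by positivity
            linarith
        _ = ε / 2 := by field_simp
    rw [mem_ball] at hyb ⊢
    calc dist (T n) y ≤ dist (T n) (L (V h' hb')) + dist (L (V h' hb')) y := dist_triangle _ _ _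
      _ < ε := by linarith
  have hcomp : IsCompact (closure (range T)) :=
    hT.closure.isCompact_of_isClosed isClosed_closure
  obtain ⟨w, -, σ, hσ, hlim⟩ := hcomp.tendsto_subseq fun n => subset_closure (mem_range_self n)
  have hwm := Lp.aestronglyMeasurable w
  refine ⟨hwm.mk w, hwm.stronglyMeasurable_mk.measurable,
    (L1.integrable_coeFn w).congr hwm.ae_eq_mk, σ, hσ, ?_⟩
  rw [tendsto_iff_dist_tendsto_zero] at hlim
  refine hlim.congr fun j => ?_
  rw [dist_eq_norm, L1.norm_eq_integral_norm]
  refine integral_congr_ae ?_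
  filter_upwards [Lp.coeFn_sub ((T ∘ σ) j) w, hL (V (h (σ j)) (hb (σ j))),
    hwm.ae_eq_mk] with x e1 e2 e3
  rw [e1, Pi.sub_apply, ← e3, Real.norm_eq_abs]
  simp only [Function.comp_apply, T]
  rw [e2]
  rfl

end

section

variable {X : Type*} [MeasurableSpace X] {μ : Measure X}

theorem eLpNorm_one_eq_ofReal_integral_abs {g : X → ℝ} (hg : Integrable g μ) :
    eLpNorm g 1 μ = ENNReal.ofReal (∫ x, |g x| ∂μ) := by
  rw [eLpNorm_one_eq_lintegral_enorm, ← ofReal_integral_norm_eq_lintegral_enorm hg]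
  rfl

theorem exists_subseq_ae_of_tendsto_integral_abs {F : ℕ → X → ℝ} {w : X → ℝ}
    (hF : ∀ n, Integrable (F n) μ) (hw : Integrable w μ)
    (hlim : Tendsto (fun n => ∫ x, |F n x - w x| ∂μ) atTop (𝓝 0)) :
    ∃ σ : ℕ → ℕ, StrictMono σ ∧ ∀ᵐ x ∂μ, Tendsto (fun n => F (σ n) x) atTop (𝓝 (w x)) := by
  refine TendstoInMeasure.exists_seq_tendsto_ae (f := F) (g := w)
    (tendstoInMeasure_of_tendsto_eLpNorm (p := 1) one_ne_zero
      (fun n => (hF n).aestronglyMeasurable) hw.aestronglyMeasurable ?_)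
  have : ∀ n, eLpNorm (F n - w) 1 μ = ENNReal.ofReal (∫ x, |F n x - w x| ∂μ) := fun n =>
    eLpNorm_one_eq_ofReal_integral_abs ((hF n).sub hw)
  simp only [this]
  simpa using ENNReal.tendsto_ofReal hlim

theorem tendsto_integral_abs_sub_of_ae [IsFiniteMeasure μ] {h : ℕ → X → ℝ} {w : X → ℝ}
    (hh : ∀ n, Integrable (h n) μ) (hw : Integrable w μ)
    (hui : ∀ ε > 0, ∃ M, ∀ n, ∫ x, |{x | M ≤ |h n x|}.indicator (h n) x| ∂μ ≤ ε)
    (hm : ∀ n, Measurable (h n))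
    (hlim : ∀ᵐ x ∂μ, Tendsto (fun n => h n x) atTop (𝓝 (w x))) :
    Tendsto (fun n => ∫ x, |h n x - w x| ∂μ) atTop (𝓝 0) := by
  have key := tendsto_Lp_finite_of_tendsto_ae (μ := μ) le_rfl ENNReal.one_ne_top
    (fun n => (hh n).aestronglyMeasurable) (memLp_one_iff_integrable.2 hw)
    (unifIntegrable_of le_rfl ENNReal.one_ne_top (fun n => (hh n).aestronglyMeasurable)
      (fun ε hε => ?_)) hlim
  · have : ∀ n, eLpNorm (h n - w) 1 μ = ENNReal.ofReal (∫ x, |h n x - w x| ∂μ) := fun n =>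
      eLpNorm_one_eq_ofReal_integral_abs ((hh n).sub hw)
    simp only [this] at key
    have h2 := (ENNReal.continuousAt_toReal ENNReal.zero_ne_top).tendsto.comp key
    simp only [ENNReal.toReal_zero] at h2
    refine h2.congr fun n => ?_
    simp only [Function.comp_apply]
    exact ENNReal.toReal_ofReal (integral_nonneg fun x => abs_nonneg _)
  · obtain ⟨M, hM⟩ := hui ε hε
    refine ⟨M.toNNReal, fun n => ?_⟩
    have hs : {x | M.toNNReal ≤ ‖h n x‖₊} = {x | M ≤ |h n x|} := by
      ext x
      rw [mem_ofPred_eq, mem_ofPred_eq, Real.toNNReal_le_iff_le_coe, coe_nnnorm, Real.norm_eq_abs]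
    rw [hs]
    have hms : MeasurableSet {x | M ≤ |h n x|} := measurableSet_le measurable_const (hm n).abs
    rw [eLpNorm_one_eq_ofReal_integral_abs ((hh n).indicator hms)]
    exact ENNReal.ofReal_le_ofReal (hM n)

end

section

variable {X : Type*} [MeasurableSpace X] [MetricSpace X] [CompactSpace X] [BorelSpace X]
  {μ : Measure X} [IsFiniteMeasure μ] {G : X → X → ℝ}

theorem IsCriticalNonlinearity.mul_self_nonneg {f : ℝ → ℝ} (hf : IsCriticalNonlinearity f)
    (s : ℝ) : 0 ≤ f s * s := by
  rcases le_total s 0 with hs | hs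
  · rw [hf.eq_zero s hs, zero_mul]
  · exact mul_nonneg (hf.nonneg s) hs

theorem IsRegularization.mul_self_nonneg {f : ℝ → ℝ} {κ : ℝ} {φ : ℕ → ℝ → ℝ}
    (hφ : IsRegularization f κ φ) (k : ℕ) (s : ℝ) : 0 ≤ φ k s * s := by
  rcases le_total s 0 with hs | hs
  · rw [hφ.eq_zero k s hs, zero_mul]
  · exact mul_nonneg (hφ.nonneg k s) hs

/-- Existence of a nontrivial weak solution of `u = K f(u)`. -/
theorem IsGreenKernel.exists_weak_solution (hG : IsGreenKernel μ G) {f : ℝ → ℝ}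
    (hf : IsCriticalNonlinearity f) (hM : HasMoserFunctions μ G) :
    ∃ u : X → ℝ, Measurable u ∧ Integrable (fun x => f (u x)) μ ∧
      Integrable (fun x => f (u x) * u x) μ ∧
      u =ᵐ[μ] kernelOp μ G (fun x => f (u x)) ∧ ¬ u =ᵐ[μ] fun _ => 0 := by
  obtain ⟨c₀, hc₀, hseq⟩ := hG.exists_almost_critical_seq hf hM
  obtain ⟨c, hc0, hcc, hc⟩ : ∃ c, 0 ≤ c ∧ c₀ ≤ c ∧ c < 1 / 2 :=
    ⟨max c₀ 0, le_max_right _ _, le_max_left _ _, max_lt hc₀ (by norm_num)⟩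
  obtain ⟨κ, hκ0, hκ⟩ : ∃ κ, 0 < κ ∧ κ < 1 / 2 - c := exists_between (by linarith)
  obtain ⟨φ, hφ⟩ := hf.exists_isRegularization hκ0
  obtain ⟨ρ, hρ, k₀, hk₀⟩ := hseq κ φ hφ
  obtain ⟨A, δ, hA0, hδ0, hAδ⟩ := hG.exists_bound_of_almost_critical hφ hκ0 hκ hc0 hρ
  choose g hgr hgJ1 hgJ2 using fun n : ℕ => hk₀ (k₀ + n) (Nat.le_add_right _ _)
    ((δ / (n + 1)) ^ 2) (by positivity)
  have hgb : ∀ n, BddMeasurable (g n) := fun n => (g n).continuous.bddMeasurable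
  set r : ℕ → X → ℝ := fun n => kernelResidual μ G (φ (k₀ + n)) (g n) with hr_def
  have hrb : ∀ n, BddMeasurable (r n) := fun n =>
    hG.bddMeasurable_kernelResidual (hφ.continuous _) (hgb n)
  have hrn : ∀ n, √(kernelForm μ G (r n) (r n)) ≤ δ / (n + 1) := fun n =>
    Real.sqrt_le_left (by positivity) |>.2 (hgr n)
  have hrδ : ∀ n, √(kernelForm μ G (r n) (r n)) ≤ δ := fun n =>
    (hrn n).trans (div_le_self hδ0.le (by
      have : (0 : ℝ) ≤ n := Nat.cast_nonneg n
      linarith))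
  have hAg := fun n => hAδ _ (g n) (hgb n) (hrδ n) (hgJ1 n) ((hgJ2 n).trans hcc)
  set U : ℕ → X → ℝ := fun n => kernelOp μ G (g n) with hU_def
  have hUb : ∀ n, BddMeasurable (U n) := fun n => hG.bddMeasurable_kernelOp (hgb n)
  set h : ℕ → X → ℝ := fun n x => φ (k₀ + n) (U n x) with hh_def
  have hhb : ∀ n, BddMeasurable (h n) := fun n => (hUb n).comp_continuous (hφ.continuous _)
  have hh0 : ∀ n x, 0 ≤ h n x := fun n x => hφ.nonneg _ _
  have hhU0 : ∀ n x, 0 ≤ h n x * U n x := fun n x => hφ.mul_self_nonneg _ _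
  have hUeq : ∀ n x, U n x = kernelOp μ G (h n) x + kernelOp μ G (r n) x := fun n x => by
    rw [← hG.kernelOp_add (hhb n) (hrb n)]
    simp only [hU_def, hr_def, hh_def, kernelResidual, add_sub_cancel]
  have hhUb : ∀ n, BddMeasurable (fun x => h n x * U n x) := fun n => (hhb n).mul (hUb n)
  set D := A * A + δ * A with hD_def
  have hD0 : 0 ≤ D := by positivity
  have hD : ∀ n, ∫ x, h n x * U n x ∂μ ≤ D := fun n => by
    have h1 := hG.integral_comp_kernelOp_mul (hφ.continuous (k₀ + n)) (hgb n)
    have h2 := (abs_le.mp (hG.kernelForm_le_sqrt_mul_sqrt (hrb n) (hgb n))).1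
    have h3 := mul_le_mul (hrδ n) (hAg n).1 (Real.sqrt_nonneg _) hδ0.le
    have h4 := Real.mul_self_sqrt (hG.posSemidef _ (hgb n))
    have h5 := mul_le_mul (hAg n).1 (hAg n).1 (Real.sqrt_nonneg _) hA0
    simp only [hh_def, hU_def]
    rw [h1]
    simp only [hr_def] at h2 h3
    linarith
  obtain ⟨C, hC0, hC⟩ := hφ.exp_bound
  have hpi := Real.pi_pos
  have hbound : ∀ N : ℝ, ∀ n x, U n x ≤ N → h n x ≤ C * Real.exp (4 * π * N ^ 2) := by
    intro N n x hx
    rcases le_total (U n x) 0 with h0 | h0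
    · simp only [hh_def]
      rw [hφ.eq_zero _ _ h0]
      positivity
    · refine (hC _ _).trans ?_
      have : U n x ^ 2 ≤ N ^ 2 := pow_le_pow_left₀ h0 hx 2
      gcongr
  have htail : ∀ ε > 0, ∃ N : ℝ, ∀ n (k : X → ℝ), Measurable k →
      (∀ x, |k x| ≤ h n x) → (∀ x, U n x ≤ N → k x = 0) → ∫ x, |k x| ∂μ ≤ ε := by
    intro ε hε
    refine ⟨(D + 1) / ε, fun n k hk hk1 hk2 => ?_⟩
    have hN : 0 < (D + 1) / ε := by positivity
    obtain ⟨Bd, hBd⟩ := (hhb n).2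
    have hkb : BddMeasurable k := ⟨hk, Bd, fun x => (hk1 x).trans ((le_abs_self _).trans (hBd x))⟩
    calc ∫ x, |k x| ∂μ ≤ ∫ x, ((D + 1) / ε)⁻¹ * (h n x * U n x) ∂μ := by
          refine integral_mono (hkb.abs.integrable μ) (((hhUb n).const_mul _).integrable μ)
            fun x => ?_
          simp only
          rcases le_or_gt (U n x) ((D + 1) / ε) with h1 | h1
          · rw [hk2 x h1, abs_zero]
            exact mul_nonneg (by positivity) (hhU0 n x)
          · refine (hk1 x).trans ?_
            rw [← div_eq_inv_mul, le_div_iff₀ hN]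
            exact mul_le_mul_of_nonneg_left h1.le (hh0 n x)
      _ = ((D + 1) / ε)⁻¹ * ∫ x, h n x * U n x ∂μ := integral_const_mul _ _
      _ ≤ ((D + 1) / ε)⁻¹ * (D + 1) := by
          gcongr
          exact (hD n).trans (by linarith)
      _ = ε := by field_simp
  obtain ⟨w, hwm, hwi, σ, hσ, hlim⟩ := hG.exists_subseq_kernelOp hhb (by
    intro ε hε
    obtain ⟨N, hN⟩ := htail ε hε
    refine ⟨C * Real.exp (4 * π * N ^ 2), fun n => ?_⟩
    have hms : MeasurableSet {x | U n x ≤ N} := measurableSet_le (hUb n).1 measurable_const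
    refine ⟨{x | U n x ≤ N}.indicator (h n), (hhb n).1.indicator hms, fun x => ?_, ?_⟩
    · by_cases hx : x ∈ {x | U n x ≤ N}
      · rw [indicator_of_mem hx, abs_of_nonneg (hh0 n x)]
        exact hbound N n x hx
      · rw [indicator_of_notMem hx, abs_zero]
        positivity
    · refine hN n _ ((hhb n).1.sub ((hhb n).1.indicator hms)) (fun x => ?_) (fun x hx => ?_)
      · by_cases hx : x ∈ {x | U n x ≤ N}
        · rw [indicator_of_mem hx, sub_self, abs_zero]
          exact hh0 n x
        · rw [indicator_of_notMem hx, sub_zero, abs_of_nonneg (hh0 n x)]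
      · rw [indicator_of_mem (show x ∈ {x | U n x ≤ N} from hx), sub_self])
  -- the functions `U n` converge to the same limit
  have hKh : ∀ n, BddMeasurable (kernelOp μ G (h n)) := fun n => hG.bddMeasurable_kernelOp (hhb n)
  have hKr : ∀ n, BddMeasurable (kernelOp μ G (r n)) := fun n => hG.bddMeasurable_kernelOp (hrb n)
  obtain ⟨C₁, hC₁0, hC₁⟩ := hG.exists_integral_abs_kernelOp_le
  have hrlim : Tendsto (fun n => ∫ x, |kernelOp μ G (r n) x| ∂μ) atTop (𝓝 0) := by
    have h1 : Tendsto (fun n : ℕ => C₁ * (δ / ((n : ℝ) + 1))) atTop (𝓝 0) := by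
      have := (tendsto_const_div_atTop_nhds_zero_nat δ).comp (tendsto_add_atTop_nat 1)
      simpa using this.const_mul C₁
    refine squeeze_zero (fun n => integral_nonneg fun x => abs_nonneg _) (fun n => ?_) h1
    exact (hC₁ _ (hrb n)).trans (mul_le_mul_of_nonneg_left (hrn n) hC₁0)
  have hUlim : Tendsto (fun j => ∫ x, |U (σ j) x - w x| ∂μ) atTop (𝓝 0) := by
    have h1 := hlim.add (hrlim.comp hσ.tendsto_atTop)
    rw [add_zero] at h1
    refine squeeze_zero (fun n => integral_nonneg fun x => abs_nonneg _) (fun n => ?_) h1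
    simp only [Function.comp_apply]
    have i1 : Integrable (fun x => |kernelOp μ G (h (σ n)) x - w x|) μ :=
      (((hKh _).integrable μ).sub hwi).abs
    rw [← integral_add i1 ((hKr _).abs.integrable μ)]
    refine integral_mono (((hUb _).integrable μ).sub hwi).abs
      ((((hKh _).integrable μ).sub hwi).abs.add ((hKr _).abs.integrable μ)) fun x => ?_
    simp only
    rw [hUeq]
    calc |kernelOp μ G (h (σ n)) x + kernelOp μ G (r (σ n)) x - w x|
        = |(kernelOp μ G (h (σ n)) x - w x) + kernelOp μ G (r (σ n)) x| := by ring_nf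
      _ ≤ _ := abs_add_le _ _
  obtain ⟨τ, hτ, hae⟩ := exists_subseq_ae_of_tendsto_integral_abs
    (fun j => (hUb (σ j)).integrable μ) hwi hUlim
  have hs_lim : Tendsto (fun j => k₀ + σ (τ j)) atTop atTop :=
    tendsto_atTop_mono (fun j => Nat.le_add_left _ _) (hσ.tendsto_atTop.comp hτ.tendsto_atTop)
  have hhae : ∀ᵐ x ∂μ, Tendsto (fun j => h (σ (τ j)) x) atTop (𝓝 (f (w x))) := by
    filter_upwards [hae] with x hx
    exact hφ.tendsto _ _ _ hs_lim hx
  have hfw : Measurable fun x => f (w x) := hf.continuous.measurable.comp hwm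
  have hint2 : Integrable (fun x => f (w x) * w x) μ := by
    refine ⟨(hfw.mul hwm).aestronglyMeasurable, ?_⟩
    rw [hasFiniteIntegral_iff_ofReal (ae_of_all _ fun x => hf.mul_self_nonneg _)]
    calc ∫⁻ x, ENNReal.ofReal (f (w x) * w x) ∂μ
        = ∫⁻ x, liminf (fun j => ENNReal.ofReal (h (σ (τ j)) x * U (σ (τ j)) x)) atTop ∂μ := by
          refine lintegral_congr_ae ?_
          filter_upwards [hae, hhae] with x h1 h2
          exact (ENNReal.tendsto_ofReal (h2.mul h1)).liminf_eq.symm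
      _ ≤ liminf (fun j => ∫⁻ x, ENNReal.ofReal (h (σ (τ j)) x * U (σ (τ j)) x) ∂μ) atTop :=
          lintegral_liminf_le fun j => (hhUb _).1.ennreal_ofReal
      _ ≤ liminf (fun _ : ℕ => ENNReal.ofReal D) atTop := by
          refine liminf_le_liminf (Eventually.of_forall fun j => ?_)
          rw [← ofReal_integral_eq_lintegral_ofReal ((hhUb _).integrable μ)
            (ae_of_all _ (hhU0 _))]
          exact ENNReal.ofReal_le_ofReal (hD _)
      _ < ⊤ := by
          rw [liminf_const]
          exact ENNReal.ofReal_lt_top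
  obtain ⟨B₁, hB₁⟩ := (isCompact_Icc (a := (0 : ℝ)) (b := 1)).exists_bound_of_continuousOn
    hf.continuous.continuousOn
  have hint1 : Integrable (fun x => f (w x)) μ := by
    refine Integrable.mono' (hint2.add (integrable_const |B₁|)) hfw.aestronglyMeasurable
      (ae_of_all _ fun x => ?_)
    simp only [Pi.add_apply]
    have h0 := hf.mul_self_nonneg (w x)
    rw [Real.norm_eq_abs, abs_of_nonneg (hf.nonneg _)]
    rcases le_total (w x) 0 with h1 | h1
    · rw [hf.eq_zero _ h1] at h0 ⊢
      rw [zero_mul, zero_add]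
      exact abs_nonneg _
    rcases le_total (w x) 1 with h2 | h2
    · have := (le_abs_self _).trans ((hB₁ (w x) ⟨h1, h2⟩).trans (le_abs_self _))
      linarith
    · have := mul_le_mul_of_nonneg_left h2 (hf.nonneg (w x))
      linarith [abs_nonneg B₁]
  have hL1 := tendsto_integral_abs_sub_of_ae (fun j => (hhb (σ (τ j))).integrable μ) hint1
    (by
      intro ε hε
      obtain ⟨N, hN⟩ := htail ε hε
      refine ⟨C * Real.exp (4 * π * N ^ 2) + 1, fun n => ?_⟩
      have hms : MeasurableSet {x | C * Real.exp (4 * π * N ^ 2) + 1 ≤ |h (σ (τ n)) x|} :=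
        measurableSet_le measurable_const (hhb _).1.abs
      refine hN (σ (τ n)) _ ((hhb _).1.indicator hms) (fun x => ?_) (fun x hx => ?_)
      · have h1 := norm_indicator_le_norm_self (s := {x | C * Real.exp (4 * π * N ^ 2) + 1 ≤
          |h (σ (τ n)) x|}) (h (σ (τ n))) x
        rwa [Real.norm_eq_abs, Real.norm_eq_abs, abs_of_nonneg (hh0 _ x)] at h1
      · refine indicator_of_notMem (fun hx' => ?_) _
        have h1 : C * Real.exp (4 * π * N ^ 2) + 1 ≤ |h (σ (τ n)) x| := hx'
        rw [abs_of_nonneg (hh0 _ x)] at h1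
        linarith [hbound N _ x hx])
    (fun j => (hhb _).1) hhae
  have hwK : ∫ x, |w x - kernelOp μ G (fun x => f (w x)) x| ∂μ ≤ 0 := by
    obtain ⟨C₂, hC₂0, hC₂⟩ := hG.exists_integral_abs_kernelOp_sub_le
    have h1 := (hlim.comp hτ.tendsto_atTop).add (hL1.const_mul C₂)
    rw [mul_zero, add_zero] at h1
    refine ge_of_tendsto' h1 fun j => ?_
    simp only [Function.comp_apply]
    obtain ⟨i1, i2⟩ := hC₂ (h (σ (τ j))) (fun x => f (w x)) (hhb _).1 ((hhb _).integrable μ)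
      hfw hint1
    have i3 : Integrable (fun x => |kernelOp μ G (h (σ (τ j))) x - w x|) μ :=
      (((hKh _).integrable μ).sub hwi).abs
    refine le_trans ?_ (add_le_add_right i2 _)
    rw [← integral_add i3 i1]
    refine integral_mono_of_nonneg (ae_of_all _ fun x => abs_nonneg _) (i3.add i1)
      (ae_of_all _ fun x => ?_)
    simp only
    rw [abs_sub_comm (kernelOp μ G (h (σ (τ j))) x) (w x)]
    exact abs_sub_le _ _ _
  have hKw_int : Integrable (kernelOp μ G fun x => f (w x)) μ :=
    (hG.integrable_prod_of_integrable hfw hint1).integral_prod_left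
  refine ⟨w, hwm, hint1, hint2, ?_, fun hw0 => ?_⟩
  · have h1 := (integral_eq_zero_iff_of_nonneg (μ := μ)
      (f := fun x => |w x - kernelOp μ G (fun x => f (w x)) x|) (fun x => abs_nonneg _)
      (hwi.sub hKw_int).abs).1 (le_antisymm hwK (integral_nonneg fun x => abs_nonneg _))
    filter_upwards [h1] with x hx
    exact sub_eq_zero.1 (abs_eq_zero.1 hx)
  · have h1 : δ ≤ 0 := by
      refine ge_of_tendsto' hUlim fun j => ?_
      refine (hAg (σ j)).2.trans (le_of_eq (integral_congr_ae ?_))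
      filter_upwards [hw0] with x hx
      rw [hx, sub_zero]
    linarith

end

section

variable {X : Type*} [MeasurableSpace X] [MetricSpace X] [CompactSpace X] [BorelSpace X]
  {μ : Measure X} [IsFiniteMeasure μ] {G : X → X → ℝ}

theorem IsGreenKernel.ae_integrable_mul (hG : IsGreenKernel μ G) {h : X → ℝ} (hm : Measurable h)
    (hi : Integrable h μ) : ∀ᵐ x ∂μ, Integrable (fun y => G x y * h y) μ :=
  (hG.integrable_prod_of_integrable hm hi).prod_right_ae

theorem IsGreenKernel.kernelForm_le_integral_mul (hG : IsGreenKernel μ G) {h u k : X → ℝ}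
    (hm : Measurable h) (hi : Integrable h μ) (hu : u =ᵐ[μ] kernelOp μ G h)
    (hk : BddMeasurable k) (hk0 : ∀ x, 0 ≤ k x) (hkh : ∀ x, k x ≤ h x)
    (hku : Integrable (fun x => k x * u x) μ) :
    kernelForm μ G k k ≤ ∫ x, k x * u x ∂μ := by
  refine integral_mono_ae ((hk.mul (hG.bddMeasurable_kernelOp hk)).integrable μ) hku ?_
  filter_upwards [hu, hG.ae_integrable_mul hm hi] with x h1 h2
  rw [h1]
  refine mul_le_mul_of_nonneg_left (integral_mono (hG.integrable_mul hk x) h2 fun y => ?_) (hk0 x)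
  exact mul_le_mul_of_nonneg_left (hkh y) (hG.nonneg x y)

theorem IsGreenKernel.integrable_exp_sq_kernelOp (hG : IsGreenKernel μ G) {h u : X → ℝ}
    (hm : Measurable h) (hi : Integrable h μ) (h0 : ∀ x, 0 ≤ h x)
    (hu : u =ᵐ[μ] kernelOp μ G h) (hum : Measurable u) (hhu : Integrable (fun x => h x * u x) μ)
    {a : ℝ} (ha : 0 < a) : Integrable (fun x => Real.exp (a * u x ^ 2)) μ := by
  have hpi := Real.pi_pos
  have hu0 : ∀ᵐ x ∂μ, 0 ≤ u x := by
    filter_upwards [hu] with x hx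
    rw [hx]
    exact hG.kernelOp_nonneg h0 x
  set q := π / a with hq_def
  have hq : 0 < q := by positivity
  -- the part of `h` above a high level has small energy
  obtain ⟨M, hM⟩ : ∃ M : ℕ, ∫ x, {x | (M : ℝ) < h x}.indicator (fun x => h x * u x) x ∂μ ≤ q := by
    have hlim : Tendsto (fun M : ℕ => ∫ x, {x | (M : ℝ) < h x}.indicator
        (fun x => h x * u x) x ∂μ) atTop (𝓝 (∫ _, (0 : ℝ) ∂μ)) := by
      refine tendsto_integral_of_dominated_convergence (fun x => |h x * u x|) (fun M => ?_)
        hhu.abs (fun M => ae_of_all _ fun x => ?_) (ae_of_all _ fun x => ?_)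
      · exact ((hm.mul hum).indicator (measurableSet_lt measurable_const hm)).aestronglyMeasurable
      · exact norm_indicator_le_norm_self _ _
      · refine tendsto_const_nhds.congr' ?_
        obtain ⟨N, hN⟩ := exists_nat_ge (h x)
        filter_upwards [eventually_ge_atTop N] with M hM
        refine (indicator_of_notMem (fun hx => ?_) _).symm
        have h1 : (M : ℝ) < h x := hx
        have h2 : (N : ℝ) ≤ M := by exact_mod_cast hM
        linarith
    rw [integral_zero] at hlim
    exact (hlim.eventually (ge_mem_nhds hq)).exists
  set S := {x | (M : ℝ) < h x} with hS_def
  have hS : MeasurableSet S := measurableSet_lt measurable_const hm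
  set h₁ : X → ℝ := Sᶜ.indicator h with hh₁
  set h₂ : X → ℝ := S.indicator h with hh₂
  have h₁b : BddMeasurable h₁ := by
    refine ⟨hm.indicator hS.compl, M, fun x => ?_⟩
    by_cases hx : x ∈ Sᶜ
    · rw [hh₁, indicator_of_mem hx, abs_of_nonneg (h0 x)]
      exact not_lt.1 hx
    · rw [hh₁, indicator_of_notMem hx, abs_zero]
      positivity
  have h₂0 : ∀ x, 0 ≤ h₂ x := fun x => indicator_nonneg (fun x _ => h0 x) x
  have h₂h : ∀ x, h₂ x ≤ h x := fun x => indicator_le_self' (fun x _ => h0 x) x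
  have h₂m : Measurable h₂ := hm.indicator hS
  set k : ℕ → X → ℝ := fun j x => min (h₂ x) j with hk_def
  have hk0 : ∀ j x, 0 ≤ k j x := fun j x => le_min (h₂0 x) (Nat.cast_nonneg j)
  have hkh₂ : ∀ j x, k j x ≤ h₂ x := fun j x => min_le_left _ _
  have hkb : ∀ j, BddMeasurable (k j) := fun j =>
    ⟨h₂m.min measurable_const, j, fun x => by
      rw [abs_of_nonneg (hk0 j x)]; exact min_le_right _ _⟩
  have hkQ : ∀ j, kernelForm μ G (k j) (k j) ≤ q := fun j => by
    have hle : ∀ᵐ x ∂μ, k j x * u x ≤ S.indicator (fun x => h x * u x) x := by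
      filter_upwards [hu0] with x hx
      refine (mul_le_mul_of_nonneg_right (hkh₂ j x) hx).trans (le_of_eq ?_)
      by_cases hxS : x ∈ S
      · rw [hh₂, indicator_of_mem hxS, indicator_of_mem hxS]
      · rw [hh₂, indicator_of_notMem hxS, indicator_of_notMem hxS, zero_mul]
    have hind : Integrable (S.indicator fun x => h x * u x) μ := hhu.indicator hS
    have hku : Integrable (fun x => k j x * u x) μ := by
      refine Integrable.mono' hind ((hkb j).1.mul hum).aestronglyMeasurable ?_
      filter_upwards [hu0, hle] with x hx h1
      rwa [Real.norm_eq_abs, abs_of_nonneg (mul_nonneg (hk0 j x) hx)]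
    refine (hG.kernelForm_le_integral_mul hm hi hu (hkb j) (hk0 j)
      (fun x => (hkh₂ j x).trans (h₂h x)) hku).trans ?_
    exact (integral_mono_ae hku hind hle).trans hM
  obtain ⟨C, hC⟩ := hG.exists_integral_exp_le (b := 2 * a) (q := q) (by positivity) hq.le (by
    rw [hq_def]
    have : 2 * a * (π / a) = 2 * π := by field_simp
    rw [this]
    linarith)
  have hexp₂ : ∫⁻ x, ENNReal.ofReal (Real.exp (2 * a * kernelOp μ G h₂ x ^ 2)) ∂μ ≤
      ENNReal.ofReal C := by
    calc ∫⁻ x, ENNReal.ofReal (Real.exp (2 * a * kernelOp μ G h₂ x ^ 2)) ∂μ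
        = ∫⁻ x, liminf (fun j => ENNReal.ofReal
            (Real.exp (2 * a * kernelOp μ G (k j) x ^ 2))) atTop ∂μ := by
          refine lintegral_congr_ae ?_
          filter_upwards [hG.ae_integrable_mul hm hi] with x hx
          have hlim : Tendsto (fun j => kernelOp μ G (k j) x) atTop (𝓝 (kernelOp μ G h₂ x)) := by
            refine tendsto_integral_of_dominated_convergence (fun y => G x y * h y)
              (fun j => ((hG.measurable_left x).mul (hkb j).1).aestronglyMeasurable) hx
              (fun j => ae_of_all _ fun y => ?_) (ae_of_all _ fun y => ?_)
            · rw [Real.norm_eq_abs, abs_of_nonneg (mul_nonneg (hG.nonneg x y) (hk0 j y))]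
              exact mul_le_mul_of_nonneg_left ((hkh₂ j y).trans (h₂h y)) (hG.nonneg x y)
            · refine tendsto_const_nhds.congr' ?_
              obtain ⟨N, hN⟩ := exists_nat_ge (h₂ y)
              filter_upwards [eventually_ge_atTop N] with j hj
              simp only [hk_def]
              rw [min_eq_left (hN.trans (by exact_mod_cast hj))]
          refine (ENNReal.tendsto_ofReal ?_).liminf_eq.symm
          exact (Real.continuous_exp.tendsto _).comp ((hlim.pow 2).const_mul (2 * a))
      _ ≤ liminf (fun j => ∫⁻ x, ENNReal.ofReal
            (Real.exp (2 * a * kernelOp μ G (k j) x ^ 2)) ∂μ) atTop :=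
          lintegral_liminf_le fun j => by
            have := (hG.measurable_kernelOp (hkb j).1)
            fun_prop
      _ ≤ liminf (fun _ : ℕ => ENNReal.ofReal C) atTop := by
          refine liminf_le_liminf (Eventually.of_forall fun j => ?_)
          have hb : BddMeasurable (fun x => Real.exp (2 * a * kernelOp μ G (k j) x ^ 2)) :=
            (hG.bddMeasurable_kernelOp (hkb j)).comp_continuous
              (φ := fun s => Real.exp (2 * a * s ^ 2)) (by fun_prop)
          rw [← ofReal_integral_eq_lintegral_ofReal (hb.integrable μ)
            (ae_of_all _ fun x => (Real.exp_pos _).le)]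
          exact ENNReal.ofReal_le_ofReal (hC _ (hkb j) (hkQ j))
      _ = ENNReal.ofReal C := liminf_const _
  have hint₂ : Integrable (fun x => Real.exp (2 * a * kernelOp μ G h₂ x ^ 2)) μ := by
    have hKm := hG.measurable_kernelOp h₂m
    refine ⟨(by fun_prop : Measurable _).aestronglyMeasurable, ?_⟩
    rw [hasFiniteIntegral_iff_ofReal (ae_of_all _ fun x => (Real.exp_pos _).le)]
    exact hexp₂.trans_lt ENNReal.ofReal_lt_top
  obtain ⟨D, hD0, hD⟩ := (hG.bddMeasurable_kernelOp h₁b).exists_nonneg_bound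
  refine Integrable.mono' (hint₂.const_mul (Real.exp (2 * a * D ^ 2)))
    (by fun_prop : Measurable _).aestronglyMeasurable ?_
  filter_upwards [hu, hG.ae_integrable_mul hm hi] with x h1 h2
  rw [Real.norm_eq_abs, abs_of_pos (Real.exp_pos _), ← Real.exp_add, Real.exp_le_exp]
  have h3 : u x = kernelOp μ G h₁ x + kernelOp μ G h₂ x := by
    rw [h1]
    unfold kernelOp
    have i2 : Integrable (fun y => G x y * h₂ y) μ := by
      have : (fun y => G x y * h₂ y) = S.indicator fun y => G x y * h y := by
        ext y
        by_cases hy : y ∈ S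
        · rw [hh₂, indicator_of_mem hy, indicator_of_mem hy]
        · rw [hh₂, indicator_of_notMem hy, indicator_of_notMem hy, mul_zero]
      rw [this]
      exact h2.indicator hS
    rw [← integral_add (hG.integrable_mul h₁b x) i2]
    congr 1 with y
    rw [← mul_add, hh₁, hh₂, indicator_compl_add_self_apply]
  have h4 : kernelOp μ G h₁ x ^ 2 ≤ D ^ 2 := sq_le_sq' (abs_le.1 (hD x)).1 (abs_le.1 (hD x)).2
  have h5 : u x ^ 2 ≤ 2 * D ^ 2 + 2 * kernelOp μ G h₂ x ^ 2 := by
    rw [h3]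
    nlinarith [sq_nonneg (kernelOp μ G h₁ x - kernelOp μ G h₂ x)]
  nlinarith

theorem IsGreenKernel.exists_abs_kernelOp_le_of_sq (hG : IsGreenKernel μ G) {h : X → ℝ}
    (hm : Measurable h) (h2 : Integrable (fun x => h x ^ 2) μ) :
    ∃ C, ∀ x, |kernelOp μ G h x| ≤ C := by
  have hpi := Real.pi_pos
  obtain ⟨C, hC1, hC⟩ := hG.exists_integral_pow_le hpi (by linarith)
  refine ⟨C * ((2 : ℕ).factorial / π ^ 2) + ∫ x, h x ^ 2 ∂μ, fun x => ?_⟩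
  have i1 := hG.integrable_pow hpi (by linarith) 2 x
  have hle : ∀ y, |G x y * h y| ≤ G x y ^ 2 + h y ^ 2 := fun y => by
    rw [abs_le]
    constructor <;> nlinarith [sq_nonneg (G x y - h y), sq_nonneg (G x y + h y)]
  have i2 : Integrable (fun y => G x y * h y) μ :=
    Integrable.mono' (i1.add h2) ((hG.measurable_left x).mul hm).aestronglyMeasurable
      (ae_of_all _ hle)
  calc |kernelOp μ G h x| ≤ ∫ y, |G x y * h y| ∂μ := abs_integral_le_integral_abs
    _ ≤ ∫ y, (G x y ^ 2 + h y ^ 2) ∂μ := integral_mono i2.abs (i1.add h2) hle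
    _ = (∫ y, G x y ^ 2 ∂μ) + ∫ y, h y ^ 2 ∂μ := integral_add i1 h2
    _ ≤ _ := by gcongr; exact hC 2 x

/-- Existence of a nontrivial continuous solution of `u = K f(u)`. -/
theorem IsGreenKernel.exists_solution (hG : IsGreenKernel μ G) {f : ℝ → ℝ}
    (hf : IsCriticalNonlinearity f) (hM : HasMoserFunctions μ G) :
    ∃ u : X → ℝ, Continuous u ∧ (∀ x, 0 ≤ u x) ∧ (¬ u =ᵐ[μ] fun _ => 0) ∧
      ∀ x, u x = kernelOp μ G (fun y => f (u y)) x := by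
  obtain ⟨w, hwm, hi1, hi2, hwK, hw0⟩ := hG.exists_weak_solution hf hM
  have hpi := Real.pi_pos
  have hfw : Measurable fun x => f (w x) := hf.continuous.measurable.comp hwm
  obtain ⟨C, hC0, hC⟩ := hf.exp_bound
  have hexp := hG.integrable_exp_sq_kernelOp hfw hi1 (fun x => hf.nonneg _) hwK hwm hi2
    (a := 8 * π) (by positivity)
  have hsq : Integrable (fun x => f (w x) ^ 2) μ := by
    refine Integrable.mono' (hexp.const_mul (C ^ 2)) (hfw.pow_const 2).aestronglyMeasurable
      (ae_of_all _ fun x => ?_)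
    rw [Real.norm_eq_abs, abs_of_nonneg (sq_nonneg _)]
    have h1 := pow_le_pow_left₀ (hf.nonneg _) (hC (w x)) 2
    rw [mul_pow, ← Real.exp_nat_mul] at h1
    rwa [show (2 : ℕ) * (4 * π * w x ^ 2) = 8 * π * w x ^ 2 by push_cast; ring] at h1
  obtain ⟨D, hD⟩ := hG.exists_abs_kernelOp_le_of_sq hfw hsq
  set u := kernelOp μ G fun x => f (w x) with hu_def
  have hub : BddMeasurable u := ⟨hG.measurable_kernelOp hfw, D, hD⟩
  have hueq : ∀ x, u x = kernelOp μ G (fun y => f (u y)) x := fun x => by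
    conv_lhs => rw [hu_def]
    unfold kernelOp
    refine integral_congr_ae ?_
    filter_upwards [hwK] with y hy
    rw [hy]
  have hfu : BddMeasurable fun y => f (u y) := hub.comp_continuous hf.continuous
  refine ⟨u, ?_, fun x => hG.kernelOp_nonneg (fun y => hf.nonneg _) x,
    fun h0 => hw0 (hwK.trans h0), hueq⟩
  rw [show u = kernelOp μ G (fun y => f (u y)) from funext hueq]
  exact hG.continuous_kernelOp hfu

end

section LogPotential

/-- Lebesgue measure on the closed unit disc. -/
noncomputable def discMeasure : Measure ℂ := volume.restrict (closedBall 0 1)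

instance : IsFiniteMeasure discMeasure := by
  unfold discMeasure
  exact isFiniteMeasure_restrict.2 measure_closedBall_lt_top.ne

theorem integrable_indicator_norm_rpow {s R : ℝ} (hs : s < 2) (hR : 0 < R) :
    Integrable (fun z : ℂ => (Iio R).indicator (fun r : ℝ => r ^ (-s)) ‖z‖) := by
  rw [integrable_fun_norm_addHaar]
  have h1 : IntegrableOn (fun r : ℝ => r ^ (1 - s)) (Ioo 0 R) :=
    (intervalIntegral.integrableOn_Ioo_rpow_iff hR).2 (by linarith)
  have h2 : (fun y : ℝ => y ^ (Module.finrank ℝ ℂ - 1) •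
      (Iio R).indicator (fun r : ℝ => r ^ (-s)) y) =ᵐ[volume.restrict (Ioi 0)]
      (Iio R).indicator (fun r : ℝ => r ^ (1 - s)) := by
    filter_upwards [ae_restrict_mem measurableSet_Ioi] with r hr
    by_cases h : r ∈ Iio R
    · rw [indicator_of_mem h, indicator_of_mem h, Complex.finrank_real_complex, sub_eq_add_neg,
        rpow_add hr]
      simp
    · rw [indicator_of_notMem h, indicator_of_notMem h, smul_zero]
  rw [IntegrableOn, integrable_congr h2, integrable_indicator_iff measurableSet_Iio,
    IntegrableOn, Measure.restrict_restrict measurableSet_Iio, inter_comm, Ioi_inter_Iio]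
  exact h1

theorem exists_riesz_bound {s : ℝ} (hs0 : 0 ≤ s) (hs : s < 2) :
    ∃ C, 0 ≤ C ∧ ∀ x : ℂ, Integrable (fun y => ‖x - y‖ ^ (-s)) discMeasure ∧
      ∫ y, ‖x - y‖ ^ (-s) ∂discMeasure ≤ C := by
  set h : ℂ → ℝ := fun z => (Iio (1 : ℝ)).indicator (fun r : ℝ => r ^ (-s)) ‖z‖ with hh
  have hi : Integrable h := integrable_indicator_norm_rpow hs one_pos
  have h0 : ∀ z, 0 ≤ h z := fun z => by
    simp only [hh, indicator]
    split_ifs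
    · positivity
    · exact le_rfl
  have hle : ∀ z : ℂ, ‖z‖ ^ (-s) ≤ 1 + h z := fun z => by
    by_cases hz : ‖z‖ ∈ Iio (1 : ℝ)
    · simp only [hh, indicator_of_mem hz]; linarith
    · simp only [hh, indicator_of_notMem hz]
      rw [add_zero]
      exact rpow_le_one_of_one_le_of_nonpos (not_lt.1 hz) (by linarith)
  have hix : ∀ x : ℂ, Integrable (fun y => 1 + h (x - y)) discMeasure := fun x =>
    (integrable_const _).add (hi.comp_sub_left x).integrableOn
  have hint : ∀ x : ℂ, Integrable (fun y => ‖x - y‖ ^ (-s)) discMeasure := fun x => by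
    refine (hix x).mono' ?_ (ae_of_all _ fun y => ?_)
    · exact ((measurable_const.sub measurable_id).norm.pow_const _).aestronglyMeasurable
    · rw [norm_of_nonneg (by positivity)]
      exact hle _
  refine ⟨discMeasure.real univ + ∫ z, h z, by
    have : 0 ≤ ∫ z, h z := integral_nonneg (f := h) h0
    positivity, fun x => ⟨hint x, ?_⟩⟩
  calc ∫ y, ‖x - y‖ ^ (-s) ∂discMeasure ≤ ∫ y, (1 + h (x - y)) ∂discMeasure :=
        integral_mono (hint x) (hix x) fun y => hle _
    _ = discMeasure.real univ + ∫ y, h (x - y) ∂discMeasure := by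
        have : Integrable (fun y => h (x - y)) discMeasure := (hi.comp_sub_left x).integrableOn
        rw [integral_add (integrable_const _) this]
        simp
    _ ≤ discMeasure.real univ + ∫ y, h (x - y) := by
        gcongr
        · exact ae_of_all _ fun y => h0 _
        · exact hi.comp_sub_left x
        · exact Measure.restrict_le_self
    _ = _ := by rw [integral_sub_left_eq_self h volume x]

theorem integrable_inv_norm_sub (x : ℂ) : Integrable (fun y => ‖x - y‖⁻¹) discMeasure := by
  obtain ⟨C, -, h⟩ := exists_riesz_bound zero_le_one one_lt_two
  simpa [rpow_neg_one] using (h x).1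

theorem Real.abs_log_le_add_inv {r : ℝ} (hr : 0 ≤ r) : |log r| ≤ r + r⁻¹ := by
  rcases hr.eq_or_lt with rfl | hr
  · simp
  have h1 := log_le_sub_one_of_pos hr
  have h2 := log_le_sub_one_of_pos (inv_pos.2 hr)
  have := inv_pos.2 hr
  rw [log_inv] at h2
  exact abs_le.2 ⟨by linarith, by linarith⟩

theorem ae_norm_le_one : ∀ᵐ y ∂discMeasure, ‖y‖ ≤ 1 := by
  filter_upwards [ae_restrict_mem (μ := volume) (measurableSet_closedBall (x := (0 : ℂ)) (ε := 1))]
    with y hy using by simpa using hy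

theorem ae_ne_discMeasure (x : ℂ) : ∀ᵐ y ∂discMeasure, y ≠ x := by
  refine ae_restrict_of_ae ?_
  rw [ae_iff]
  simp

theorem integrable_log_norm_sub (x : ℂ) : Integrable (fun y => log ‖x - y‖) discMeasure := by
  refine ((integrable_const (‖x‖ + 1)).add (integrable_inv_norm_sub x)).mono' ?_ ?_
  · exact (measurable_const.sub measurable_id).norm.log.aestronglyMeasurable
  · filter_upwards [ae_norm_le_one] with y hy
    have := norm_sub_le x y
    have := Real.abs_log_le_add_inv (norm_nonneg (x - y))
    simp only [Pi.add_apply, norm_eq_abs]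
    linarith

variable {g : ℂ → ℝ}

theorem BddMeasurable.integrable_mul_left {X : Type*} [MeasurableSpace X] {μ : Measure X}
    {g k : X → ℝ} (hg : BddMeasurable g) (hk : Integrable k μ) :
    Integrable (fun y => k y * g y) μ := by
  obtain ⟨C, hC⟩ := hg.2
  exact hk.mul_bdd (c := C) hg.1.aestronglyMeasurable (ae_of_all _ hC)

/-- Logarithmic potential of a density on the unit disc. -/
noncomputable def logPotential (g : ℂ → ℝ) (x : ℂ) : ℝ :=
  ∫ y, log ‖x - y‖ * g y ∂discMeasure

/-- The gradient of `log ‖·‖`. -/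
noncomputable def newton (z : ℂ) : ℂ := ((‖z‖ ^ 2)⁻¹ : ℝ) • z

/-- The gradient of the logarithmic potential. -/
noncomputable def newtonPotential (g : ℂ → ℝ) (x : ℂ) : ℂ :=
  ∫ y, g y • newton (x - y) ∂discMeasure

/-- The gradient of `½ log (‖·‖² + ε²)`. -/
noncomputable def newtonReg (ε : ℝ) (z : ℂ) : ℂ := ((‖z‖ ^ 2 + ε ^ 2)⁻¹ : ℝ) • z

theorem norm_newton (z : ℂ) : ‖newton z‖ = ‖z‖⁻¹ := by
  rw [newton, norm_smul, norm_inv, norm_pow, norm_norm]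
  rcases eq_or_ne ‖z‖ 0 with h | h
  · simp [h]
  · field_simp

theorem newton_eq_conj_inv (z : ℂ) : newton z = (starRingEnd ℂ) z⁻¹ := by
  rw [newton, Complex.inv_def]
  simp [Complex.normSq_eq_norm_sq, mul_comm]

theorem measurable_newton : Measurable newton :=
  (((measurable_norm.pow_const 2).inv).smul measurable_id)

theorem hasFDerivAt_logReg {ε : ℝ} (hε : 0 < ε) (x y : ℂ) :
    HasFDerivAt (fun x => 2⁻¹ * log (‖x - y‖ ^ 2 + ε ^ 2)) (innerSL ℝ (newtonReg ε (x - y))) x := by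
  have h1 : HasFDerivAt (fun x : ℂ => ‖x - y‖ ^ 2)
      (2 • (innerSL ℝ (x - y)).comp (ContinuousLinearMap.id ℝ ℂ)) x :=
    ((hasFDerivAt_id x).sub_const y).norm_sq
  have h2 := ((h1.add_const (ε ^ 2)).log (by positivity)).const_mul (2⁻¹ : ℝ)
  refine h2.congr_fderiv ?_
  ext v
  have : (inner ℝ (newtonReg ε (x - y)) v : ℝ) = (‖x - y‖ ^ 2 + ε ^ 2)⁻¹ * inner ℝ (x - y) v := by
    rw [newtonReg, real_inner_smul_left]
  rw [innerSL_apply_apply, this]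
  simp only [smul_apply, ContinuousLinearMap.comp_apply, innerSL_apply_apply,
    ContinuousLinearMap.id_apply, smul_eq_mul, nsmul_eq_mul, Nat.cast_ofNat]
  ring

theorem norm_newtonReg_le {ε : ℝ} (hε : 0 < ε) (z : ℂ) : ‖newtonReg ε z‖ ≤ ε⁻¹ := by
  rw [newtonReg, norm_smul, norm_of_nonneg (by positivity), inv_mul_le_iff₀ (by positivity),
    ← div_eq_mul_inv, le_div_iff₀ hε]
  nlinarith [sq_nonneg (‖z‖ - ε), norm_nonneg z]

theorem norm_newtonReg_sub_newton_le {ε : ℝ} (hε : 0 < ε) (z : ℂ) :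
    ‖newtonReg ε z - newton z‖ ≤ √ε * ‖z‖ ^ (-(3 / 2 : ℝ)) := by
  rcases eq_or_ne z 0 with rfl | hz
  · simp only [newtonReg, newton, smul_zero, sub_zero, norm_zero]; positivity
  have hr : 0 < ‖z‖ := norm_pos_iff.2 hz
  set a := √‖z‖ with ha
  set b := √ε with hb
  have ha0 : 0 < a := sqrt_pos.2 hr
  have hb0 : 0 < b := sqrt_pos.2 hε
  have ha2 : ‖z‖ = a ^ 2 := (sq_sqrt hr.le).symm
  have hb2 : ε = b ^ 2 := (sq_sqrt hε.le).symm
  have hp : ‖z‖ ^ (-(3 / 2 : ℝ)) = (a ^ 3)⁻¹ := by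
    rw [rpow_neg hr.le, ha, sqrt_eq_rpow, ← rpow_natCast, ← rpow_mul hr.le]; norm_num
  rw [newtonReg, newton, ← sub_smul, norm_smul, hp, ha2, hb2, norm_eq_abs]
  have : ((a ^ 2) ^ 2 + (b ^ 2) ^ 2)⁻¹ - ((a ^ 2) ^ 2)⁻¹ =
      -(b ^ 4 / (a ^ 4 * (a ^ 4 + b ^ 4))) := by field_simp; ring
  rw [this, abs_neg, abs_of_nonneg (by positivity)]
  rw [show b ^ 4 / (a ^ 4 * (a ^ 4 + b ^ 4)) * a ^ 2 = b * (a ^ 3)⁻¹ * (b ^ 3 * a / (a ^ 4 + b ^ 4))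
    by field_simp]
  refine mul_le_of_le_one_right (by positivity) ((div_le_one (by positivity)).2 ?_)
  nlinarith [sq_nonneg (a ^ 2 - b ^ 2), sq_nonneg (a * b - b ^ 2), sq_nonneg (a - b),
    mul_pos ha0 hb0, sq_nonneg (a ^ 2 - a * b)]

theorem logReg_sub_log_mem {ε r : ℝ} (hε : 0 < ε) (hr : 0 < r) :
    0 ≤ 2⁻¹ * log (r ^ 2 + ε ^ 2) - log r ∧ 2⁻¹ * log (r ^ 2 + ε ^ 2) - log r ≤ ε * r⁻¹ := by
  have h2 : log (r ^ 2) = 2 * log r := by rw [log_pow]; norm_num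
  constructor
  · have := log_le_log (by positivity : 0 < r ^ 2) (by nlinarith : r ^ 2 ≤ r ^ 2 + ε ^ 2)
    linarith
  · have h1 : log (r ^ 2 + ε ^ 2) ≤ log ((r + ε) ^ 2) :=
      log_le_log (by positivity) (by nlinarith [mul_pos hr hε])
    have h3 : log ((r + ε) ^ 2) = 2 * log (r + ε) := by rw [log_pow]; norm_num
    have h4 : log (r + ε) - log r ≤ ε * r⁻¹ := by
      rw [← log_div (by positivity) (by positivity)]
      have := log_le_sub_one_of_pos (by positivity : 0 < (r + ε) / r)
      have e : (r + ε) / r - 1 = ε * r⁻¹ := by field_simp; ring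
      linarith
    linarith

end LogPotential

section LogPotentialDeriv

variable {g : ℂ → ℝ}

theorem BddMeasurable.integrable_smul {X : Type*} [MeasurableSpace X] {μ : Measure X}
    {g : X → ℝ} {k : X → ℂ} (hg : BddMeasurable g) (hk : Integrable k μ) :
    Integrable (fun y => g y • k y) μ := by
  obtain ⟨C, hC⟩ := hg.2
  exact hk.bdd_smul C hg.1.aestronglyMeasurable (ae_of_all _ hC)

theorem measurable_newtonReg (ε : ℝ) : Measurable (newtonReg ε) :=
  ((((measurable_norm.pow_const 2).add_const _).inv).smul measurable_id)

theorem integrable_newtonReg {ε : ℝ} (hε : 0 < ε) (x : ℂ) :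
    Integrable (fun y => newtonReg ε (x - y)) discMeasure :=
  (integrable_const ε⁻¹).mono'
    ((measurable_newtonReg ε).comp (measurable_const.sub measurable_id)).aestronglyMeasurable
    (ae_of_all _ fun _ => norm_newtonReg_le hε _)

theorem integrable_newton (x : ℂ) : Integrable (fun y => newton (x - y)) discMeasure :=
  (integrable_inv_norm_sub x).mono'
    (measurable_newton.comp (measurable_const.sub measurable_id)).aestronglyMeasurable
    (ae_of_all _ fun _ => (norm_newton _).le)

theorem integrable_logReg {ε : ℝ} (hε : 0 < ε) (x : ℂ) :
    Integrable (fun y => 2⁻¹ * log (‖x - y‖ ^ 2 + ε ^ 2)) discMeasure := by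
  refine ((integrable_log_norm_sub x).norm.add ((integrable_inv_norm_sub x).const_mul ε)).mono' ?_ ?_
  · have : Measurable fun y : ℂ => ‖x - y‖ := (measurable_const.sub measurable_id).norm
    exact (((this.pow_const 2).add_const _).log.const_mul _).aestronglyMeasurable
  · filter_upwards [ae_ne_discMeasure x] with y hy
    have hr : 0 < ‖x - y‖ := norm_pos_iff.2 (sub_ne_zero.2 hy.symm)
    obtain ⟨h1, h2⟩ := logReg_sub_log_mem hε hr
    simp only [Pi.add_apply, norm_eq_abs]
    have h3 := abs_add_le (log ‖x - y‖) (2⁻¹ * log (‖x - y‖ ^ 2 + ε ^ 2) - log ‖x - y‖)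
    rw [add_sub_cancel, abs_of_nonneg h1] at h3
    linarith

theorem inner_integral_left {X : Type*} [MeasurableSpace X] {μ : Measure X} {k : X → ℂ}
    (hk : Integrable k μ) (v : ℂ) : (inner ℝ (∫ y, k y ∂μ) v : ℝ) = ∫ y, inner ℝ (k y) v ∂μ := by
  simp_rw [real_inner_comm v]
  exact (integral_inner hk v).symm

theorem hasFDerivAt_integral_logReg (hg : BddMeasurable g) {ε : ℝ} (hε : 0 < ε) (x : ℂ) :
    HasFDerivAt (fun x => ∫ y, (2⁻¹ * log (‖x - y‖ ^ 2 + ε ^ 2)) * g y ∂discMeasure)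
      (innerSL ℝ (∫ y, g y • newtonReg ε (x - y) ∂discMeasure)) x := by
  obtain ⟨C, hC0, hC⟩ := hg.exists_nonneg_bound
  have hF' : AEStronglyMeasurable (fun y => g y • innerSL ℝ (newtonReg ε (x - y))) discMeasure := by
    refine hg.1.aestronglyMeasurable.smul ?_
    refine (innerSL ℝ).continuous.comp_aestronglyMeasurable ?_
    exact (integrable_newtonReg hε x).aestronglyMeasurable
  have hb : ∀ x y, ‖g y • innerSL ℝ (newtonReg ε (x - y))‖ ≤ C * ε⁻¹ := fun x y => by
    rw [norm_smul, innerSL_apply_norm]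
    exact mul_le_mul (hC y) (norm_newtonReg_le hε _) (norm_nonneg _) hC0
  have key := hasFDerivAt_integral_of_dominated_of_fderiv_le (μ := discMeasure) (𝕜 := ℝ)
    (F := fun x y => (2⁻¹ * log (‖x - y‖ ^ 2 + ε ^ 2)) * g y) (x₀ := x) (s := univ)
    (F' := fun x y => g y • innerSL ℝ (newtonReg ε (x - y))) (bound := fun _ => C * ε⁻¹)
    univ_mem (Eventually.of_forall fun x =>
      (hg.integrable_mul_left (integrable_logReg hε x)).aestronglyMeasurable)
    (hg.integrable_mul_left (integrable_logReg hε x)) hF'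
    (ae_of_all _ fun y x _ => hb x y) (integrable_const _)
    (ae_of_all _ fun y x _ => (hasFDerivAt_logReg hε x y).mul_const (g y))
  refine key.congr_fderiv ?_
  ext v
  rw [ContinuousLinearMap.integral_apply ((integrable_const (C * ε⁻¹)).mono' hF'
    (ae_of_all _ fun y => hb x y)), innerSL_apply_apply,
    inner_integral_left (hg.integrable_smul (integrable_newtonReg hε x))]
  simp only [smul_apply, innerSL_apply_apply, real_inner_smul_left, smul_eq_mul]

theorem tendsto_integral_logReg (hg : BddMeasurable g) (x : ℂ) :
    Tendsto (fun n : ℕ => ∫ y, (2⁻¹ * log (‖x - y‖ ^ 2 + (1 / ((n : ℝ) + 1)) ^ 2)) * g y ∂discMeasure)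
      atTop (𝓝 (logPotential g x)) := by
  obtain ⟨C, hC0, hC⟩ := hg.exists_nonneg_bound
  have h0 := tendsto_one_div_add_atTop_nhds_zero_nat (𝕜 := ℝ)
  rw [tendsto_iff_norm_sub_tendsto_zero]
  have h1 := h0.mul_const (C * ∫ y, ‖x - y‖⁻¹ ∂discMeasure)
  rw [zero_mul] at h1
  refine squeeze_zero (fun n => norm_nonneg _) (fun n => ?_) h1
  have hε : (0 : ℝ) < 1 / ((n : ℝ) + 1) := by positivity
  set ε := (1 : ℝ) / ((n : ℝ) + 1)
  rw [logPotential, ← integral_sub (hg.integrable_mul_left (integrable_logReg hε x))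
    (hg.integrable_mul_left (integrable_log_norm_sub x)), ← integral_const_mul,
    ← integral_const_mul]
  refine norm_integral_le_of_norm_le (((integrable_inv_norm_sub x).const_mul _).const_mul _) ?_
  filter_upwards [ae_ne_discMeasure x] with y hy
  have hr : 0 < ‖x - y‖ := norm_pos_iff.2 (sub_ne_zero.2 hy.symm)
  obtain ⟨h1, h2⟩ := logReg_sub_log_mem hε hr
  rw [← sub_mul, norm_mul, norm_of_nonneg h1, show ε * (C * ‖x - y‖⁻¹) = ε * ‖x - y‖⁻¹ * C by ring]
  exact mul_le_mul h2 (hC y) (norm_nonneg _) (by positivity)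

theorem tendstoUniformly_newtonReg (hg : BddMeasurable g) :
    TendstoUniformly (fun (n : ℕ) x => ∫ y, g y • newtonReg (1 / ((n : ℝ) + 1)) (x - y) ∂discMeasure)
      (newtonPotential g) atTop := by
  obtain ⟨C, hC0, hC⟩ := hg.exists_nonneg_bound
  obtain ⟨D, hD0, hD⟩ := exists_riesz_bound (s := 3 / 2) (by norm_num) (by norm_num)
  have h0 := tendsto_one_div_add_atTop_nhds_zero_nat (𝕜 := ℝ)
  have h1 := (h0.sqrt).mul_const (C * D)
  rw [sqrt_zero, zero_mul] at h1
  rw [Metric.tendstoUniformly_iff]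
  intro η hη
  filter_upwards [h1.eventually (gt_mem_nhds hη)] with n hn x
  refine lt_of_le_of_lt ?_ hn
  have hε : (0 : ℝ) < 1 / ((n : ℝ) + 1) := by positivity
  set ε := (1 : ℝ) / ((n : ℝ) + 1)
  rw [dist_comm, dist_eq_norm, newtonPotential,
    ← integral_sub (hg.integrable_smul (integrable_newtonReg hε x))
      (hg.integrable_smul (integrable_newton x))]
  calc _ ≤ ∫ y, √ε * (C * ‖x - y‖ ^ (-(3 / 2 : ℝ))) ∂discMeasure := by
        refine norm_integral_le_of_norm_le (((hD x).1.const_mul _).const_mul _)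
          (ae_of_all _ fun y => ?_)
        rw [← smul_sub, norm_smul, show √ε * (C * ‖x - y‖ ^ (-(3 / 2 : ℝ))) =
          C * (√ε * ‖x - y‖ ^ (-(3 / 2 : ℝ))) by ring]
        exact mul_le_mul (hC y) (norm_newtonReg_sub_newton_le hε _) (norm_nonneg _) hC0
    _ ≤ √ε * (C * D) := by
        rw [integral_const_mul, integral_const_mul]
        have := (hD x).2
        gcongr

theorem continuous_integral_newtonReg (hg : BddMeasurable g) {ε : ℝ} (hε : 0 < ε) :
    Continuous (fun x => ∫ y, g y • newtonReg ε (x - y) ∂discMeasure) := by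
  obtain ⟨C, hC0, hC⟩ := hg.exists_nonneg_bound
  refine continuous_of_dominated (bound := fun _ => C * ε⁻¹)
    (fun x => (hg.integrable_smul (integrable_newtonReg hε x)).aestronglyMeasurable)
    (fun x => ae_of_all _ fun y => ?_) (integrable_const _) (ae_of_all _ fun y => ?_)
  · rw [norm_smul]
    exact mul_le_mul (hC y) (norm_newtonReg_le hε _) (norm_nonneg _) hC0
  · have h1 : Continuous fun x : ℂ => x - y := continuous_id.sub continuous_const
    have h2 : Continuous fun x : ℂ => ‖x - y‖ ^ 2 + ε ^ 2 := by fun_prop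
    have h3 : Continuous fun x : ℂ => (‖x - y‖ ^ 2 + ε ^ 2)⁻¹ := h2.inv₀ fun x => by positivity
    have h4 : Continuous fun x : ℂ => newtonReg ε (x - y) := h3.smul h1
    exact h4.const_smul (g y)

theorem continuous_newtonPotential (hg : BddMeasurable g) : Continuous (newtonPotential g) :=
  (tendstoUniformly_newtonReg hg).continuous (Frequently.of_forall fun n =>
    continuous_integral_newtonReg hg (by positivity))

theorem hasFDerivAt_logPotential (hg : BddMeasurable g) (x : ℂ) :
    HasFDerivAt (logPotential g) (innerSL ℝ (newtonPotential g x)) x := by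
  refine hasFDerivAt_of_tendstoUniformly (l := atTop) (𝕜 := ℝ)
    (f := fun (n : ℕ) x => ∫ y, (2⁻¹ * log (‖x - y‖ ^ 2 + (1 / ((n : ℝ) + 1)) ^ 2)) * g y ∂discMeasure)
    (f' := fun n x => innerSL ℝ (∫ y, g y • newtonReg (1 / ((n : ℝ) + 1)) (x - y) ∂discMeasure))
    (g' := fun x => innerSL ℝ (newtonPotential g x)) ?_
    (fun n x => hasFDerivAt_integral_logReg hg (by positivity) x)
    (fun x => tendsto_integral_logReg hg x) x
  have := tendstoUniformly_newtonReg hg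
  rw [Metric.tendstoUniformly_iff] at this ⊢
  intro η hη
  filter_upwards [this η hη] with n hn x
  have h := hn x
  rw [dist_eq_norm] at h ⊢
  rwa [← map_sub, innerSL_apply_norm]

end LogPotentialDeriv

section NewtonPairing

variable {g : ℂ → ℝ} {ψ : ℂ → ℝ}

theorem fderiv_eq_zero_of_notMem_tsupport {x : ℂ} (hx : x ∉ tsupport ψ) : fderiv ℝ ψ x = 0 := by
  by_contra h
  exact hx (support_fderiv_subset ℝ h)

theorem exists_norm_fderiv_le (hψ : ContDiff ℝ 1 ψ) (hc : HasCompactSupport ψ) :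
    ∃ C, 0 ≤ C ∧ ∀ x, ‖fderiv ℝ ψ x‖ ≤ C := by
  obtain ⟨C, hC⟩ := (hψ.continuous_fderiv one_ne_zero).bounded_above_of_compact_support
    (hc.fderiv ℝ)
  exact ⟨C, (norm_nonneg _).trans (hC 0), hC⟩

theorem integral_fderiv_newton_zero (hψ : ContDiff ℝ 1 ψ) (hc : HasCompactSupport ψ) :
    ∫ x, fderiv ℝ ψ x (newton x) = -(2 * π) * ψ 0 := by
  obtain ⟨C, hC0, hC⟩ := exists_norm_fderiv_le hψ hc
  obtain ⟨R, hR0, hR⟩ : ∃ R, 0 < R ∧ ∀ x, R < ‖x‖ → x ∉ tsupport ψ := by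
    obtain ⟨R, hR⟩ := hc.isCompact.isBounded.subset_closedBall (0 : ℂ)
    refine ⟨max R 1, by positivity, fun x hx h => ?_⟩
    have := hR h
    rw [mem_closedBall_zero_iff] at this
    exact absurd (this.trans (le_max_left R 1)) (not_le.2 hx)
  set e : ℝ → ℂ := fun θ => Complex.exp (θ * Complex.I) with he
  have hen : ∀ θ, ‖e θ‖ = 1 := fun θ => Complex.norm_exp_ofReal_mul_I θ
  have hec : Continuous e := by fun_prop
  set h : ℝ × ℝ → ℝ := fun p => fderiv ℝ ψ ((p.1 : ℂ) * e p.2) (e p.2) with hh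
  have hcont : Continuous h := by
    have h1 : Continuous fun p : ℝ × ℝ => (p.1 : ℂ) * e p.2 := by fun_prop
    exact ((hψ.continuous_fderiv one_ne_zero).comp h1).clm_apply (hec.comp continuous_snd)
  have hnz : ∀ r θ, R < r → (r : ℂ) * e θ ∉ tsupport ψ := fun r θ hr => hR _ (by
    rwa [norm_mul, hen, mul_one, Complex.norm_real, norm_of_nonneg (hR0.trans hr).le])
  rw [← Complex.integral_comp_polarCoord_symm]
  have e1 : ∫ p in polarCoord.target, p.1 • (fderiv ℝ ψ (Complex.polarCoord.symm p)
      (newton (Complex.polarCoord.symm p))) = ∫ p in polarCoord.target, h p := by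
    refine setIntegral_congr_fun polarCoord.open_target.measurableSet fun p hp => ?_
    have hp1 : 0 < p.1 := by
      rw [polarCoord_target] at hp; exact hp.1
    have hz : Complex.polarCoord.symm p = (p.1 : ℂ) * e p.2 := by
      rw [Complex.polarCoord_symm_apply, he]
      simp [Complex.exp_mul_I]
    have hn : newton ((p.1 : ℂ) * e p.2) = (p.1⁻¹ : ℝ) • e p.2 := by
      rw [newton, norm_mul, hen, mul_one, Complex.norm_real, norm_of_nonneg hp1.le,
        ← Complex.real_smul, smul_smul]
      congr 1
      field_simp
    simp only [hz, hn, map_smul, hh, smul_smul]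
    rw [mul_inv_cancel₀ hp1.ne', one_smul]
  rw [e1, polarCoord_target]
  have hint : Integrable h ((volume.restrict (Ioi (0 : ℝ))).prod (volume.restrict (Ioo (-π) π))) := by
    have : Integrable (fun p : ℝ × ℝ => (Ioc 0 R).indicator (fun _ => C) p.1 * (1 : ℝ))
        ((volume.restrict (Ioi (0 : ℝ))).prod (volume.restrict (Ioo (-π) π))) := by
      refine Integrable.mul_prod (f := (Ioc 0 R).indicator fun _ => C) (g := fun _ => (1 : ℝ)) ?_
        (integrable_const _)
      rw [integrable_indicator_iff measurableSet_Ioc]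
      refine IntegrableOn.mono_measure ?_ Measure.restrict_le_self
      exact integrableOn_const measure_Ioc_lt_top.ne
    refine this.mono' hcont.aestronglyMeasurable ?_
    rw [Measure.prod_restrict]
    filter_upwards [ae_restrict_mem (measurableSet_Ioi.prod measurableSet_Ioo)] with p hp
    by_cases hpR : p.1 ≤ R
    · rw [indicator_of_mem (show p.1 ∈ Ioc 0 R from ⟨hp.1, hpR⟩), mul_one]
      calc ‖h p‖ ≤ ‖fderiv ℝ ψ ((p.1 : ℂ) * e p.2)‖ * ‖e p.2‖ := ContinuousLinearMap.le_opNorm _ _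
        _ ≤ C := by rw [hen, mul_one]; exact hC _
    · rw [indicator_of_notMem fun h => hpR h.2, hh]
      simp only [fderiv_eq_zero_of_notMem_tsupport (hnz _ p.2 (not_le.1 hpR))]
      simp
  rw [Measure.volume_eq_prod, ← Measure.prod_restrict, integral_prod_symm _ hint]
  have e2 : ∀ θ, ∫ r in Ioi (0 : ℝ), h (r, θ) = -ψ 0 := fun θ => by
    have hd : ∀ r : ℝ, HasDerivAt (fun r : ℝ => ψ ((r : ℂ) * e θ)) (h (r, θ)) r := fun r => by
      have h1 : HasDerivAt (fun r : ℝ => (r : ℂ) * e θ) (e θ) r := by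
        simpa using (Complex.ofRealCLM.hasDerivAt (x := r)).mul_const (e θ)
      exact ((hψ.differentiable one_ne_zero _).hasFDerivAt).comp_hasDerivAt r h1
    have := integral_Ioi_of_hasDerivAt_of_tendsto (m := (0 : ℝ)) (a := 0)
      (hd 0).continuousAt.continuousWithinAt (fun r _ => hd r) ?_ ?_
    · rw [this]; simp
    · have hcs : HasCompactSupport fun r => h (r, θ) := by
        refine HasCompactSupport.intro (isCompact_Icc (a := -R) (b := R)) fun r hr => ?_
        have : R < ‖(r : ℂ) * e θ‖ := by
          rw [norm_mul, hen, mul_one, Complex.norm_real, norm_eq_abs]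
          by_contra hcon
          exact hr (abs_le.1 (not_lt.1 hcon))
        simp only [hh, fderiv_eq_zero_of_notMem_tsupport (hR _ this)]
        simp
      exact ((hcont.comp (by fun_prop : Continuous fun r : ℝ => (r, θ))).integrable_of_hasCompactSupport
        hcs).integrableOn
    · refine tendsto_const_nhds.congr' ?_
      filter_upwards [eventually_gt_atTop R] with r hr
      exact (image_eq_zero_of_notMem_tsupport (hnz r θ hr)).symm
  simp_rw [e2]
  rw [integral_const]
  simp only [measureReal_restrict_apply_univ, Real.volume_real_Ioo, smul_eq_mul]
  rw [max_eq_left (by linarith [pi_pos])]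
  ring

theorem integral_fderiv_newton (hψ : ContDiff ℝ 1 ψ) (hc : HasCompactSupport ψ) (a : ℂ) :
    ∫ x, fderiv ℝ ψ x (newton (x - a)) = -(2 * π) * ψ a := by
  have h1 := integral_fderiv_newton_zero (ψ := fun x => ψ (x + a))
    (hψ.comp (contDiff_id.add contDiff_const))
    (hc.comp_homeomorph (Homeomorph.addRight a))
  rw [← integral_add_right_eq_self _ a]
  simp only [fderiv_comp_add_right, zero_add] at h1
  simpa using h1

theorem integral_fderiv_kernel (hψ : ContDiff ℝ 1 ψ) (hc : HasCompactSupport ψ)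
    (hg : BddMeasurable g) {k : ℂ → ℂ → ℂ} (hk : Measurable (Function.uncurry k)) {D : ℝ}
    (hD : ∀ x ∈ tsupport ψ, Integrable (k x) discMeasure ∧ ∫ y, ‖k x y‖ ∂discMeasure ≤ D)
    {c : ℂ → ℝ} (hpol : ∀ᵐ y ∂discMeasure, ∫ x, fderiv ℝ ψ x (k x y) = c y) :
    ∫ x, fderiv ℝ ψ x (∫ y, g y • k x y ∂discMeasure) = ∫ y, g y * c y ∂discMeasure := by
  obtain ⟨C, hC0, hC⟩ := hg.exists_nonneg_bound
  have hint : Integrable (fun p : ℂ × ℂ => g p.2 * fderiv ℝ ψ p.1 (k p.1 p.2))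
      (volume.prod discMeasure) := by
    have hmk : Measurable fun p : ℂ × ℂ => fderiv ℝ ψ p.1 (k p.1 p.2) := by
      have h1 : Measurable fun p : ℂ × ℂ => (fderiv ℝ ψ p.1, k p.1 p.2) :=
        ((hψ.continuous_fderiv one_ne_zero).measurable.comp measurable_fst).prodMk hk
      exact isBoundedBilinearMap_apply.continuous.measurable.comp h1
    have hm : Measurable fun p : ℂ × ℂ => g p.2 * fderiv ℝ ψ p.1 (k p.1 p.2) :=
      (hg.1.comp measurable_snd).mul hmk
    have hle : ∀ x y, ‖g y * fderiv ℝ ψ x (k x y)‖ ≤ C * ‖fderiv ℝ ψ x‖ * ‖k x y‖ := fun x y => by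
      rw [norm_mul, mul_assoc]
      exact mul_le_mul (hC y) (ContinuousLinearMap.le_opNorm _ _) (norm_nonneg _) hC0
    have hz : ∀ x, x ∉ tsupport ψ → ∀ y, g y * fderiv ℝ ψ x (k x y) = 0 := fun x hx y => by
      rw [fderiv_eq_zero_of_notMem_tsupport hx]; simp
    rw [integrable_prod_iff hm.aestronglyMeasurable]
    refine ⟨ae_of_all _ fun x => ?_, ?_⟩
    · by_cases hx : x ∈ tsupport ψ
      · exact ((hD x hx).1.norm.const_mul (C * ‖fderiv ℝ ψ x‖)).mono'
          (hm.comp (measurable_const.prodMk measurable_id)).aestronglyMeasurable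
          (ae_of_all _ fun y => hle x y)
      · simp only [hz x hx]
        exact integrable_zero _ _ _
    · have hi : Integrable (fun x => C * D * ‖fderiv ℝ ψ x‖) :=
        (((hψ.continuous_fderiv one_ne_zero).integrable_of_hasCompactSupport
          (hc.fderiv ℝ)).norm).const_mul _
      refine hi.mono' ?_ (ae_of_all _ fun x => ?_)
      · exact hm.norm.stronglyMeasurable.integral_prod_right.aestronglyMeasurable
      · rw [norm_of_nonneg (integral_nonneg fun _ => norm_nonneg _)]
        by_cases hx : x ∈ tsupport ψ
        · calc ∫ y, ‖g y * fderiv ℝ ψ x (k x y)‖ ∂discMeasure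
              ≤ ∫ y, C * ‖fderiv ℝ ψ x‖ * ‖k x y‖ ∂discMeasure := by
                refine integral_mono_of_nonneg (ae_of_all _ fun _ => norm_nonneg _)
                  ((hD x hx).1.norm.const_mul _) (ae_of_all _ fun y => hle x y)
            _ ≤ C * ‖fderiv ℝ ψ x‖ * D := by
                rw [integral_const_mul]
                exact mul_le_mul_of_nonneg_left (hD x hx).2 (by positivity)
            _ = _ := by ring
        · simp only [fderiv_eq_zero_of_notMem_tsupport hx]
          simp
  have e1 : ∀ x, fderiv ℝ ψ x (∫ y, g y • k x y ∂discMeasure) =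
      ∫ y, g y * fderiv ℝ ψ x (k x y) ∂discMeasure := fun x => by
    by_cases hx : x ∈ tsupport ψ
    · rw [← ContinuousLinearMap.integral_comp_comm _ (hg.integrable_smul (hD x hx).1)]
      simp only [map_smul, smul_eq_mul]
    · rw [fderiv_eq_zero_of_notMem_tsupport hx]; simp
  simp_rw [e1]
  rw [integral_integral_swap hint]
  refine integral_congr_ae ?_
  filter_upwards [hpol] with y hy
  rw [integral_const_mul, hy]

theorem integral_fderiv_newtonPotential (hψ : ContDiff ℝ 1 ψ) (hc : HasCompactSupport ψ)
    (hg : BddMeasurable g) :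
    ∫ x, fderiv ℝ ψ x (newtonPotential g x) = ∫ y, g y * (-(2 * π) * ψ y) ∂discMeasure := by
  obtain ⟨D, hD0, hD⟩ := exists_riesz_bound zero_le_one one_lt_two
  refine integral_fderiv_kernel hψ hc hg (k := fun x y => newton (x - y))
    (measurable_newton.comp (measurable_fst.sub measurable_snd)) (D := D)
    (fun x _ => ⟨integrable_newton x, ?_⟩) (ae_of_all _ fun y => integral_fderiv_newton hψ hc y)
  simp only [norm_newton, ← rpow_neg_one]
  exact (hD x).2

/-- Logarithmic potential of the charges reflected across the unit circle. -/
noncomputable def reflPotential (g : ℂ → ℝ) (x : ℂ) : ℝ :=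
  ∫ y, log ‖1 - x * y‖ * g y ∂discMeasure

/-- The gradient of `log ‖1 - · * y‖`. -/
noncomputable def reflKernel (x y : ℂ) : ℂ := (starRingEnd ℂ) (-y / (1 - x * y))

/-- The gradient of the reflected logarithmic potential. -/
noncomputable def reflGradient (g : ℂ → ℝ) (x : ℂ) : ℂ :=
  ∫ y, g y • reflKernel x y ∂discMeasure

theorem measurable_reflKernel : Measurable (Function.uncurry reflKernel) := by
  have h : Measurable fun p : ℂ × ℂ => -p.2 / (1 - p.1 * p.2) :=
    measurable_snd.neg.div (measurable_const.sub (measurable_fst.mul measurable_snd))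
  exact Complex.continuous_conj.measurable.comp h

theorem one_sub_le_norm_one_sub_mul {x y : ℂ} {r : ℝ} (hx : ‖x‖ ≤ r) (hy : ‖y‖ ≤ 1) :
    1 - r ≤ ‖1 - x * y‖ := by
  have h1 : ‖x * y‖ ≤ r := by
    rw [norm_mul]
    calc ‖x‖ * ‖y‖ ≤ ‖x‖ * 1 := by gcongr
      _ ≤ r := by linarith
  have h2 := norm_sub_norm_le (1 : ℂ) (x * y)
  rw [norm_one] at h2
  linarith

theorem norm_reflKernel_le {x y : ℂ} {r : ℝ} (hr : r < 1) (hx : ‖x‖ ≤ r) (hy : ‖y‖ ≤ 1) :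
    ‖reflKernel x y‖ ≤ (1 - r)⁻¹ := by
  have h := one_sub_le_norm_one_sub_mul hx hy
  have h0 : 0 < 1 - r := by linarith
  rw [reflKernel, RCLike.norm_conj, norm_div, norm_neg, div_eq_mul_inv]
  calc ‖y‖ * ‖1 - x * y‖⁻¹ ≤ 1 * (1 - r)⁻¹ := by gcongr
    _ = _ := one_mul _

theorem integrable_reflKernel {x : ℂ} (hx : ‖x‖ < 1) :
    Integrable (reflKernel x) discMeasure := by
  refine (integrable_const (1 - ‖x‖)⁻¹).mono'
    (measurable_reflKernel.comp (measurable_const.prodMk measurable_id)).aestronglyMeasurable ?_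
  filter_upwards [ae_norm_le_one] with y hy using norm_reflKernel_le hx le_rfl hy

theorem integrable_log_norm_one_sub {x : ℂ} (hx : ‖x‖ < 1) :
    Integrable (fun y => log ‖1 - x * y‖) discMeasure := by
  refine (integrable_const (2 + (1 - ‖x‖)⁻¹)).mono' ?_ ?_
  · have : Measurable fun y : ℂ => ‖1 - x * y‖ :=
      (measurable_const.sub (measurable_const.mul measurable_id)).norm
    exact this.log.aestronglyMeasurable
  · filter_upwards [ae_norm_le_one] with y hy
    have h1 := Real.abs_log_le_add_inv (norm_nonneg (1 - x * y))
    have h2 := one_sub_le_norm_one_sub_mul le_rfl hy (x := x)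
    have h3 : ‖1 - x * y‖ ≤ 2 := by
      refine (norm_sub_le _ _).trans ?_
      rw [norm_one, norm_mul]
      nlinarith [norm_nonneg x, norm_nonneg y]
    have h4 : ‖1 - x * y‖⁻¹ ≤ (1 - ‖x‖)⁻¹ := inv_anti₀ (by linarith) h2
    rw [norm_eq_abs]
    linarith

theorem hasFDerivAt_log_norm_comp {F : ℂ → ℂ} {F' : ℂ} {x : ℂ} (hF : HasDerivAt F F' x)
    (h0 : F x ≠ 0) :
    HasFDerivAt (fun x => log ‖F x‖) (innerSL ℝ ((starRingEnd ℂ) (F' / F x))) x := by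
  have h1 := (hF.hasFDerivAt.restrictScalars ℝ).norm_sq.log (by positivity)
  have h2 := h1.const_mul (2⁻¹ : ℝ)
  have e : (fun x => 2⁻¹ * Real.log (‖F x‖ ^ 2)) = fun x => Real.log ‖F x‖ := by
    funext x
    rw [Real.log_pow]; push_cast; ring
  rw [e] at h2
  refine h2.congr_fderiv ?_
  ext v
  have hn : (‖F x‖ ^ 2 : ℝ) ≠ 0 := by positivity
  simp only [smul_apply, ContinuousLinearMap.comp_apply, innerSL_apply_apply,
    smul_eq_mul, nsmul_eq_mul, Nat.cast_ofNat, ContinuousLinearMap.coe_restrictScalars',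
    Complex.inner, ContinuousLinearMap.toSpanSingleton_apply, Complex.conj_conj]
  rw [div_eq_mul_inv, Complex.inv_def, Complex.normSq_eq_norm_sq]
  simp only [Complex.mul_re, Complex.mul_im, Complex.conj_re, Complex.conj_im, Complex.ofReal_re,
    Complex.ofReal_im]
  ring

theorem hasFDerivAt_reflPotential (hg : BddMeasurable g) {x : ℂ} (hx : ‖x‖ < 1) :
    HasFDerivAt (reflPotential g) (innerSL ℝ (reflGradient g x)) x := by
  obtain ⟨C, hC0, hC⟩ := hg.exists_nonneg_bound
  obtain ⟨r, hxr, hr⟩ := exists_between hx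
  have h0r : 0 < 1 - r := by linarith
  have hs : ball (0 : ℂ) r ∈ 𝓝 x := isOpen_ball.mem_nhds (by simpa using hxr)
  have hF' : AEStronglyMeasurable (fun y => g y • innerSL ℝ (reflKernel x y)) discMeasure := by
    refine hg.1.aestronglyMeasurable.smul ?_
    exact (innerSL ℝ).continuous.comp_aestronglyMeasurable
      (integrable_reflKernel hx).aestronglyMeasurable
  have hb : ∀ᵐ y ∂discMeasure, ∀ x ∈ ball (0 : ℂ) r,
      ‖g y • innerSL ℝ (reflKernel x y)‖ ≤ C * (1 - r)⁻¹ := by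
    filter_upwards [ae_norm_le_one] with y hy x hx
    rw [norm_smul, innerSL_apply_norm]
    have hx' : ‖x‖ ≤ r := by simpa using (mem_ball_zero_iff.1 hx).le
    exact mul_le_mul (hC y) (norm_reflKernel_le hr hx' hy) (norm_nonneg _) hC0
  have key := hasFDerivAt_integral_of_dominated_of_fderiv_le (μ := discMeasure) (𝕜 := ℝ)
    (F := fun x y => log ‖1 - x * y‖ * g y) (x₀ := x) (s := ball (0 : ℂ) r)
    (F' := fun x y => g y • innerSL ℝ (reflKernel x y)) (bound := fun _ => C * (1 - r)⁻¹)
    hs (by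
      filter_upwards [hs] with x hx
      have hx1 : ‖x‖ < 1 := (mem_ball_zero_iff.1 hx).trans hr
      exact (hg.integrable_mul_left (integrable_log_norm_one_sub hx1)).aestronglyMeasurable)
    (hg.integrable_mul_left (integrable_log_norm_one_sub hx)) hF' hb (integrable_const _) (by
      filter_upwards [ae_norm_le_one] with y hy x hx
      have hx1 : ‖x‖ < 1 := (mem_ball_zero_iff.1 hx).trans hr
      refine HasFDerivAt.mul_const (hasFDerivAt_log_norm_comp ?_ ?_) (g y)
      · simpa using ((hasDerivAt_id x).mul_const y).const_sub 1
      · have := one_sub_le_norm_one_sub_mul le_rfl hy (x := x)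
        exact norm_pos_iff.1 (by linarith))
  refine key.congr_fderiv ?_
  ext v
  rw [ContinuousLinearMap.integral_apply ((integrable_const (C * (1 - r)⁻¹)).mono' hF'
    (hb.mono fun y hy => hy x (by simpa using hxr))), innerSL_apply_apply, reflGradient,
    inner_integral_left (hg.integrable_smul (integrable_reflKernel hx))]
  simp only [smul_apply, innerSL_apply_apply, real_inner_smul_left, smul_eq_mul]

theorem continuousOn_reflGradient (hg : BddMeasurable g) :
    ContinuousOn (reflGradient g) (ball 0 1) := by
  obtain ⟨C, hC0, hC⟩ := hg.exists_nonneg_bound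
  refine continuousOn_of_forall_continuousAt fun x hx => ?_
  obtain ⟨r, hxr, hr⟩ := exists_between (mem_ball_zero_iff.1 hx)
  have hs : ball (0 : ℂ) r ∈ 𝓝 x := isOpen_ball.mem_nhds (by simpa using hxr)
  refine continuousAt_of_dominated (bound := fun _ => C * (1 - r)⁻¹) ?_ ?_ (integrable_const _) ?_
  · filter_upwards [hs] with x hx
    exact (hg.integrable_smul (integrable_reflKernel
      ((mem_ball_zero_iff.1 hx).trans hr))).aestronglyMeasurable
  · filter_upwards [hs] with x hx
    filter_upwards [ae_norm_le_one] with y hy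
    rw [norm_smul]
    exact mul_le_mul (hC y) (norm_reflKernel_le hr (mem_ball_zero_iff.1 hx).le hy)
      (norm_nonneg _) hC0
  · filter_upwards [ae_norm_le_one] with y hy
    have h1 : 1 - x * y ≠ 0 := by
      have := one_sub_le_norm_one_sub_mul le_rfl hy (x := x)
      exact norm_pos_iff.1 (by linarith)
    have h2 : ContinuousAt (fun x : ℂ => reflKernel x y) x := by
      refine Complex.continuous_conj.continuousAt.comp ?_
      exact continuousAt_const.div (continuousAt_const.sub (continuousAt_id.mul continuousAt_const)) h1
    exact h2.const_smul (g y)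

theorem integral_fderiv_reflGradient (hψ : ContDiff ℝ 1 ψ) (hc : HasCompactSupport ψ)
    (hg : BddMeasurable g) (hs : tsupport ψ ⊆ ball 0 1) :
    ∫ x, fderiv ℝ ψ x (reflGradient g x) = 0 := by
  obtain ⟨r, hr, hrs⟩ : ∃ r < 1, ∀ x ∈ tsupport ψ, ‖x‖ ≤ r := by
    rcases (tsupport ψ).eq_empty_or_nonempty with h | h
    · exact ⟨0, one_pos, by simp [h]⟩
    · obtain ⟨x, hx, hmax⟩ := hc.isCompact.exists_isMaxOn h continuous_norm.continuousOn
      exact ⟨‖x‖, mem_ball_zero_iff.1 (hs hx), fun y hy => hmax hy⟩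
  have key := integral_fderiv_kernel hψ hc hg measurable_reflKernel
    (D := ∫ _, (1 - r)⁻¹ ∂discMeasure) (c := fun _ => 0) (fun x hx => ?_) ?_
  · rw [show (fun x => fderiv ℝ ψ x (reflGradient g x)) =
      fun x => fderiv ℝ ψ x (∫ y, g y • reflKernel x y ∂discMeasure) from rfl, key]
    simp
  · have hi := integrable_reflKernel (mem_ball_zero_iff.1 (hs hx))
    refine ⟨hi, integral_mono_ae hi.norm (integrable_const _) ?_⟩
    filter_upwards [ae_norm_le_one] with y hy using norm_reflKernel_le hr (hrs x hx) hy
  · filter_upwards [ae_norm_le_one, ae_ne_discMeasure 0] with y hy hy0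
    have h1 : ∀ x, reflKernel x y = newton (x - y⁻¹) := fun x => by
      rw [newton_eq_conj_inv, reflKernel]
      congr 1
      rcases eq_or_ne (1 - x * y) 0 with h | h
      · rw [h, div_zero, eq_comm, inv_eq_zero]
        field_simp
        linear_combination -h
      · have : x - y⁻¹ ≠ 0 := fun h' => h (by
          have : x = y⁻¹ := sub_eq_zero.1 h'
          rw [this, inv_mul_cancel₀ hy0, sub_self])
        have e : x - y⁻¹ = (1 - x * y) * (-y⁻¹) := by field_simp; ring
        rw [e]
        field_simp
    simp_rw [h1]
    rw [integral_fderiv_newton hψ hc, image_eq_zero_of_notMem_tsupport (f := ψ) (x := y⁻¹) ?_, mul_zero]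
    intro h
    have := mem_ball_zero_iff.1 (hs h)
    rw [norm_inv] at this
    exact absurd this (not_lt.2 ((one_le_inv₀ (norm_pos_iff.2 hy0)).2 hy))

end NewtonPairing

section SectorKernel

/-- The circular sector `0 < arg x < π / 2 ^ j` of the unit disc. -/
def openModel (j : ℕ) : Set ℂ := {x | ‖x‖ < 1 ∧ ∀ k ≤ j, 0 < (x ^ 2 ^ k).im}

/-- The closed circular sector. -/
def closedModel (j : ℕ) : Set ℂ := {x | ‖x‖ ≤ 1 ∧ ∀ k ≤ j, 0 ≤ (x ^ 2 ^ k).im}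

/-- Cross ratio in the half disc whose logarithm gives the Green function. -/
noncomputable def halfDiscRatio (z w : ℂ) : ℝ :=
  4 * (z.im * w.im) * ((1 - ‖z‖ ^ 2) * (1 - ‖w‖ ^ 2)) / (‖z - w‖ ^ 2 * ‖1 - z * w‖ ^ 2)

/-- The Green function of the Dirichlet Laplacian on the circular sector. -/
noncomputable def sectorGreen (j : ℕ) (x y : ℂ) : ℝ :=
  (4 * π)⁻¹ * log (1 + halfDiscRatio (x ^ 2 ^ j) (y ^ 2 ^ j))

theorem isOpen_openModel (j : ℕ) : IsOpen (openModel j) := by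
  have : openModel j = ball 0 1 ∩ ⋂ k ∈ Finset.range (j + 1), {x : ℂ | 0 < (x ^ 2 ^ k).im} := by
    ext x
    simp [openModel]
  rw [this]
  refine isOpen_ball.inter (isOpen_biInter_finset fun k _ => ?_)
  exact isOpen_lt continuous_const (Complex.continuous_im.comp (continuous_pow _))

theorem isClosed_closedModel (j : ℕ) : IsClosed (closedModel j) := by
  have : closedModel j = closedBall 0 1 ∩ ⋂ k ≤ j, {x : ℂ | 0 ≤ (x ^ 2 ^ k).im} := by
    ext x
    simp [closedModel]
  rw [this]
  refine isClosed_closedBall.inter (isClosed_biInter fun k _ => ?_)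
  exact isClosed_le continuous_const (Complex.continuous_im.comp (continuous_pow _))

theorem isCompact_closedModel (j : ℕ) : IsCompact (closedModel j) :=
  (isCompact_closedBall (0 : ℂ) 1).of_isClosed_subset (isClosed_closedModel j)
    fun x hx => by simpa using hx.1

theorem openModel_subset (j : ℕ) : openModel j ⊆ closedModel j :=
  fun _ hx => ⟨hx.1.le, fun k hk => (hx.2 k hk).le⟩

theorem openModel_subset_ball (j : ℕ) : openModel j ⊆ ball 0 1 :=
  fun _ hx => by simpa using hx.1

variable {j : ℕ} {x y z w : ℂ}

theorem one_sub_norm_sq_nonneg (hz : ‖z‖ ≤ 1) : 0 ≤ 1 - ‖z‖ ^ 2 := by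
  nlinarith [norm_nonneg z]

theorem halfDiscRatio_nonneg (hz : ‖z‖ ≤ 1) (hw : ‖w‖ ≤ 1) (hzi : 0 ≤ z.im) (hwi : 0 ≤ w.im) :
    0 ≤ halfDiscRatio z w := by
  have := one_sub_norm_sq_nonneg hz
  have := one_sub_norm_sq_nonneg hw
  unfold halfDiscRatio
  positivity

theorem halfDiscRatio_symm (z w : ℂ) : halfDiscRatio z w = halfDiscRatio w z := by
  unfold halfDiscRatio
  rw [norm_sub_rev z w, mul_comm z w, mul_comm z.im, mul_comm (1 - ‖z‖ ^ 2)]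

theorem halfDiscRatio_le (hz : ‖z‖ ≤ 1) (hw : ‖w‖ ≤ 1) (hzi : 0 ≤ z.im) (hwi : 0 ≤ w.im) :
    halfDiscRatio z w ≤ 4 * (z.im * w.im) / ‖z - w‖ ^ 2 := by
  have h1 := one_sub_norm_sq_nonneg hz
  have h2 := one_sub_norm_sq_nonneg hw
  have h3 : (1 - ‖z‖ ^ 2) * (1 - ‖w‖ ^ 2) ≤ ‖1 - z * w‖ ^ 2 := by
    have h4 : 1 - ‖z‖ * ‖w‖ ≤ ‖1 - z * w‖ := by
      have := norm_sub_norm_le (1 : ℂ) (z * w)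
      rwa [norm_one, norm_mul] at this
    have h5 : ‖z‖ * ‖w‖ ≤ 1 := mul_le_one₀ hz (norm_nonneg _) hw
    have h6 : (1 - ‖z‖ * ‖w‖) ^ 2 ≤ ‖1 - z * w‖ ^ 2 :=
      pow_le_pow_left₀ (by linarith) h4 2
    nlinarith [sq_nonneg (‖z‖ - ‖w‖)]
  unfold halfDiscRatio
  rw [← div_mul_div_comm, div_eq_mul_inv _ (‖1 - z * w‖ ^ 2)]
  refine mul_le_of_le_one_right (by positivity) ?_
  rw [← div_eq_mul_inv]
  exact div_le_one_of_le₀ h3 (by positivity)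

theorem im_mul_im_sq_div_le (ha : 0 ≤ z.im) (hb : 0 ≤ w.im) :
    4 * ((z ^ 2).im * (w ^ 2).im) / ‖z ^ 2 - w ^ 2‖ ^ 2 ≤ 4 * (z.im * w.im) / ‖z - w‖ ^ 2 := by
  have h1 : z ^ 2 - w ^ 2 = (z - w) * (z + w) := by ring
  have h2 : 4 * (z.re * w.re) ≤ ‖z + w‖ ^ 2 := by
    rw [Complex.sq_norm, Complex.normSq_apply]
    simp only [Complex.add_re, Complex.add_im]
    nlinarith [sq_nonneg (z.re - w.re), sq_nonneg (z.im + w.im)]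
  have h3 : 4 * ((z ^ 2).im * (w ^ 2).im) = 4 * (z.im * w.im) * (4 * (z.re * w.re)) := by
    simp only [pow_two, Complex.mul_im]
    ring
  rw [h1, norm_mul, mul_pow, h3, ← div_mul_div_comm]
  refine mul_le_of_le_one_right (by positivity) ?_
  exact div_le_one_of_le₀ h2 (by positivity)

theorem im_mul_im_pow_div_le (hx : ∀ k ≤ j, 0 ≤ (x ^ 2 ^ k).im) (hy : ∀ k ≤ j, 0 ≤ (y ^ 2 ^ k).im) :
    4 * ((x ^ 2 ^ j).im * (y ^ 2 ^ j).im) / ‖x ^ 2 ^ j - y ^ 2 ^ j‖ ^ 2 ≤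
      4 * (x.im * y.im) / ‖x - y‖ ^ 2 := by
  induction j with
  | zero => simp
  | succ j ih =>
    refine le_trans ?_ (ih (fun k hk => hx k (by omega)) fun k hk => hy k (by omega))
    rw [pow_succ, pow_mul, pow_mul]
    exact im_mul_im_sq_div_le (hx j (by omega)) (hy j (by omega))

theorem norm_pow_le_one_of_mem (hx : x ∈ closedModel j) : ‖x ^ 2 ^ j‖ ≤ 1 := by
  rw [norm_pow]
  exact pow_le_one₀ (norm_nonneg _) hx.1

theorem norm_pow_lt_one_of_mem (hx : x ∈ openModel j) : ‖x ^ 2 ^ j‖ < 1 := by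
  rw [norm_pow]
  exact pow_lt_one₀ (norm_nonneg _) hx.1 (by positivity)

theorem one_add_halfDiscRatio_pow_le (hx : x ∈ closedModel j) (hy : y ∈ closedModel j)
    (hxy : x ≠ y) : 1 + halfDiscRatio (x ^ 2 ^ j) (y ^ 2 ^ j) ≤ 4 / ‖x - y‖ ^ 2 := by
  have h1 := halfDiscRatio_le (norm_pow_le_one_of_mem hx) (norm_pow_le_one_of_mem hy)
    (hx.2 j le_rfl) (hy.2 j le_rfl)
  have h2 := im_mul_im_pow_div_le hx.2 hy.2
  have h0 : 0 < ‖x - y‖ ^ 2 := by have := norm_pos_iff.2 (sub_ne_zero.2 hxy); positivity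
  have h3 : 1 + 4 * (x.im * y.im) / ‖x - y‖ ^ 2 ≤ 4 / ‖x - y‖ ^ 2 := by
    rw [← div_self h0.ne', ← add_div]
    refine div_le_div_of_nonneg_right ?_ h0.le
    have hx1 : x.re ^ 2 + x.im ^ 2 ≤ 1 := by
      have := hx.1
      have h := Complex.sq_norm x
      rw [Complex.normSq_apply] at h
      nlinarith [norm_nonneg x]
    have hy1 : y.re ^ 2 + y.im ^ 2 ≤ 1 := by
      have := hy.1
      have h := Complex.sq_norm y
      rw [Complex.normSq_apply] at h
      nlinarith [norm_nonneg y]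
    rw [Complex.sq_norm, Complex.normSq_apply]
    simp only [Complex.sub_re, Complex.sub_im]
    nlinarith [sq_nonneg (x.re + y.re), sq_nonneg (x.im - y.im)]
  linarith

theorem sectorGreen_symm (x y : ℂ) : sectorGreen j x y = sectorGreen j y x := by
  rw [sectorGreen, halfDiscRatio_symm, sectorGreen]

theorem sectorGreen_nonneg (hx : x ∈ closedModel j) (hy : y ∈ closedModel j) :
    0 ≤ sectorGreen j x y := by
  have := halfDiscRatio_nonneg (norm_pow_le_one_of_mem hx) (norm_pow_le_one_of_mem hy)
    (hx.2 j le_rfl) (hy.2 j le_rfl)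
  exact mul_nonneg (by positivity) (log_nonneg (by linarith))

theorem sectorGreen_le (hx : x ∈ closedModel j) (hy : y ∈ closedModel j) (hxy : x ≠ y) :
    sectorGreen j x y ≤ (2 * π)⁻¹ * log (2 / ‖x - y‖) := by
  have h := halfDiscRatio_nonneg (norm_pow_le_one_of_mem hx) (norm_pow_le_one_of_mem hy)
    (hx.2 j le_rfl) (hy.2 j le_rfl)
  have h1 := log_le_log (by linarith) (one_add_halfDiscRatio_pow_le hx hy hxy)
  have h2 : (4 : ℝ) / ‖x - y‖ ^ 2 = (2 / ‖x - y‖) ^ 2 := by rw [div_pow]; norm_num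
  rw [h2, log_pow] at h1
  rw [sectorGreen, mul_inv, mul_inv]
  have hp := inv_pos.2 pi_pos
  push_cast at h1
  nlinarith

theorem sectorGreen_eq_zero (hx : x ∈ closedModel j) (hx' : x ∉ openModel j) (y : ℂ) :
    sectorGreen j x y = 0 := by
  have : halfDiscRatio (x ^ 2 ^ j) (y ^ 2 ^ j) = 0 := by
    by_cases h1 : ‖x‖ = 1
    · simp [halfDiscRatio, norm_pow, h1]
    · have h2 : ‖x‖ < 1 := lt_of_le_of_ne hx.1 h1
      have h3 : ∃ k ≤ j, (x ^ 2 ^ k).im = 0 := by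
        by_contra! hcon
        exact hx' ⟨h2, fun k hk => lt_of_le_of_ne (hx.2 k hk) (hcon k hk).symm⟩
      obtain ⟨k, hk, h0⟩ := h3
      have h4 : (x ^ 2 ^ j).im = 0 := by
        obtain ⟨i, rfl⟩ := Nat.exists_eq_add_of_le hk
        rw [pow_add, pow_mul, ← Complex.conj_eq_iff_im, map_pow, Complex.conj_eq_iff_im.2 h0]
      simp [halfDiscRatio, h4]
  rw [sectorGreen, this, add_zero, log_one, mul_zero]

theorem one_sub_mul_ne_zero (hz : ‖z‖ ≤ 1) (hw : ‖w‖ < 1) : 1 - z * w ≠ 0 := by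
  rw [mul_comm]
  have := one_sub_le_norm_one_sub_mul le_rfl hz (x := w)
  exact norm_pos_iff.1 (by linarith)

theorem pow_injOn_openModel (hx : x ∈ openModel j) (hy : y ∈ openModel j)
    (h : x ^ 2 ^ j = y ^ 2 ^ j) : x = y := by
  have key : ∀ k ≤ j, x ^ 2 ^ k = y ^ 2 ^ k → x = y := by
    intro k
    induction k with
    | zero => intro _ h; simpa using h
    | succ k ih =>
      intro hk h
      rw [pow_succ, pow_mul, pow_mul, sq_eq_sq_iff_eq_or_eq_neg] at h
      rcases h with h | h
      · exact ih (by omega) h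
      · have h1 := hx.2 k (by omega)
        have h2 := hy.2 k (by omega)
        rw [h, Complex.neg_im] at h1
        linarith
  exact key j le_rfl h

theorem sectorGreen_pos (hx : x ∈ openModel j) (hy : y ∈ openModel j) (hxy : x ≠ y) :
    0 < sectorGreen j x y := by
  have h1 := hx.2 j le_rfl
  have h2 := hy.2 j le_rfl
  have h3 : 0 < 1 - ‖x ^ 2 ^ j‖ ^ 2 := by
    nlinarith [norm_pow_lt_one_of_mem hx, norm_nonneg (x ^ 2 ^ j)]
  have h4 : 0 < 1 - ‖y ^ 2 ^ j‖ ^ 2 := by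
    nlinarith [norm_pow_lt_one_of_mem hy, norm_nonneg (y ^ 2 ^ j)]
  have h5 : 0 < ‖x ^ 2 ^ j - y ^ 2 ^ j‖ :=
    norm_pos_iff.2 (sub_ne_zero.2 fun h => hxy (pow_injOn_openModel hx hy h))
  have h6 : 0 < ‖1 - x ^ 2 ^ j * y ^ 2 ^ j‖ :=
    norm_pos_iff.2 (one_sub_mul_ne_zero (norm_pow_lt_one_of_mem hx).le (norm_pow_lt_one_of_mem hy))
  have : 0 < halfDiscRatio (x ^ 2 ^ j) (y ^ 2 ^ j) := by
    unfold halfDiscRatio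
    positivity
  exact mul_pos (by positivity) (log_pos (by linarith))

theorem measurable_sectorGreen (j : ℕ) : Measurable (Function.uncurry (sectorGreen j)) := by
  have h1 : Measurable fun p : ℂ × ℂ => p.1 ^ 2 ^ j := measurable_fst.pow_const _
  have h2 : Measurable fun p : ℂ × ℂ => p.2 ^ 2 ^ j := measurable_snd.pow_const _
  have h3 := Complex.measurable_im.comp h1
  have h4 := Complex.measurable_im.comp h2
  refine Measurable.const_mul (Measurable.log (measurable_const.add (Measurable.div ?_ ?_))) _
  · exact ((h3.mul h4).const_mul 4).mul ((measurable_const.sub (h1.norm.pow_const 2)).mul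
      (measurable_const.sub (h2.norm.pow_const 2)))
  · exact ((h1.sub h2).norm.pow_const 2).mul
      ((measurable_const.sub (h1.mul h2)).norm.pow_const 2)

theorem continuousAt_sectorGreen (hx : x ∈ closedModel j) (hy : y ∈ openModel j)
    (hxy : y ^ 2 ^ j ≠ x ^ 2 ^ j) : ContinuousAt (fun x => sectorGreen j x y) x := by
  have h5 : ‖x ^ 2 ^ j - y ^ 2 ^ j‖ ≠ 0 := norm_ne_zero_iff.2 (sub_ne_zero.2 hxy.symm)
  have h6 : ‖1 - x ^ 2 ^ j * y ^ 2 ^ j‖ ≠ 0 :=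
    norm_ne_zero_iff.2 (one_sub_mul_ne_zero (norm_pow_le_one_of_mem hx) (norm_pow_lt_one_of_mem hy))
  have h1 : ContinuousAt (fun x : ℂ => x ^ 2 ^ j) x := (continuous_pow _).continuousAt
  have h3 : ContinuousAt (fun x : ℂ => (x ^ 2 ^ j).im) x := Complex.continuous_im.continuousAt.comp h1
  have h := halfDiscRatio_nonneg (norm_pow_le_one_of_mem hx) (norm_pow_lt_one_of_mem hy).le
    (hx.2 j le_rfl) (hy.2 j le_rfl).le
  refine ContinuousAt.mul continuousAt_const (ContinuousAt.log (continuousAt_const.add ?_)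
    (by positivity))
  refine ContinuousAt.div ?_ ?_ (by positivity)
  · exact (continuousAt_const.mul (h3.mul continuousAt_const)).mul
      ((continuousAt_const.sub (h1.norm.pow 2)).mul continuousAt_const)
  · exact ((h1.sub continuousAt_const).norm.pow 2).mul
      ((continuousAt_const.sub (h1.mul continuousAt_const)).norm.pow 2)

theorem log_one_add_halfDiscRatio (hz : ‖z‖ < 1) (hw : ‖w‖ < 1) (hzi : 0 < z.im)
    (hwi : 0 < w.im) (hzw : z ≠ w) :
    log (1 + halfDiscRatio z w) = -2 * (log ‖z - w‖ + log ‖1 - z * w‖ -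
      log ‖z - (starRingEnd ℂ) w‖ - log ‖1 - z * (starRingEnd ℂ) w‖) := by
  have h1 : 0 < ‖z - w‖ := norm_pos_iff.2 (sub_ne_zero.2 hzw)
  have h2 : 0 < ‖1 - z * w‖ := norm_pos_iff.2 (one_sub_mul_ne_zero hz.le hw)
  have h3 : 0 < ‖z - (starRingEnd ℂ) w‖ := norm_pos_iff.2 fun h => by
    have := congrArg Complex.im h
    simp at this
    linarith
  have h4 : 0 < ‖1 - z * (starRingEnd ℂ) w‖ :=
    norm_pos_iff.2 (one_sub_mul_ne_zero hz.le (by rwa [RCLike.norm_conj]))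
  have e : 1 + halfDiscRatio z w = (‖z - (starRingEnd ℂ) w‖ * ‖1 - z * (starRingEnd ℂ) w‖ /
      (‖z - w‖ * ‖1 - z * w‖)) ^ 2 := by
    rw [halfDiscRatio, div_pow, mul_pow, mul_pow, eq_div_iff (by positivity), add_mul,
      div_mul_cancel₀ _ (by positivity)]
    simp only [Complex.sq_norm, Complex.normSq_apply, Complex.sub_re, Complex.sub_im,
      Complex.mul_re, Complex.mul_im, Complex.one_re, Complex.one_im, Complex.conj_re,
      Complex.conj_im]
    ring
  rw [e, log_pow, log_div (by positivity) (by positivity), log_mul h3.ne' h4.ne',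
    log_mul h1.ne' h2.ne']
  push_cast
  ring

end SectorKernel

section SectorLogKernel

variable {j : ℕ}

instance (j : ℕ) : CompactSpace (closedModel j) :=
  isCompact_iff_compactSpace.1 (isCompact_closedModel j)

theorem measurableSet_openModel (j : ℕ) : MeasurableSet (openModel j) :=
  (isOpen_openModel j).measurableSet

theorem measurableSet_closedModel (j : ℕ) : MeasurableSet (closedModel j) :=
  (isClosed_closedModel j).measurableSet

/-- Lebesgue measure on the open sector, seen as a measure on the closed sector. -/
noncomputable def modelMeasure (j : ℕ) : Measure (closedModel j) :=
  (volume.restrict (openModel j)).comap Subtype.val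

/-- The Green function on the closed sector. -/
noncomputable def modelGreen (j : ℕ) (x y : closedModel j) : ℝ := sectorGreen j x y

theorem measurableEmbedding_closedModel (j : ℕ) :
    MeasurableEmbedding (Subtype.val : closedModel j → ℂ) :=
  MeasurableEmbedding.subtype_coe (measurableSet_closedModel j)

theorem map_modelMeasure (j : ℕ) :
    (modelMeasure j).map Subtype.val = volume.restrict (openModel j) := by
  rw [modelMeasure, (measurableEmbedding_closedModel j).map_comap, Subtype.range_coe,
    Measure.restrict_restrict (measurableSet_closedModel j),
    inter_eq_right.2 (openModel_subset j)]

theorem volume_openModel_lt_top (j : ℕ) : volume (openModel j) < ⊤ :=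
  (measure_mono (openModel_subset_ball j)).trans_lt measure_ball_lt_top

instance (j : ℕ) : IsFiniteMeasure (volume.restrict (openModel j)) :=
  isFiniteMeasure_restrict.2 (volume_openModel_lt_top j).ne

instance (j : ℕ) : IsFiniteMeasure (modelMeasure j) := by
  refine ⟨?_⟩
  have h := congrArg (fun ν : Measure ℂ => ν univ) (map_modelMeasure j)
  simp only [(measurableEmbedding_closedModel j).map_apply, preimage_univ] at h
  rw [h]
  exact measure_lt_top _ _

theorem integral_modelMeasure (F : ℂ → ℝ) :
    ∫ x, F x ∂(modelMeasure j) = ∫ x in openModel j, F x := by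
  rw [← map_modelMeasure, (measurableEmbedding_closedModel j).integral_map]

theorem integrable_modelMeasure_iff {F : ℂ → ℝ} :
    Integrable (fun x : closedModel j => F x) (modelMeasure j) ↔ IntegrableOn F (openModel j) := by
  rw [IntegrableOn, ← map_modelMeasure, (measurableEmbedding_closedModel j).integrable_map_iff]
  rfl

theorem ae_modelMeasure {p : ℂ → Prop} (h : ∀ᵐ y, y ∈ openModel j → p y) :
    ∀ᵐ y : closedModel j ∂(modelMeasure j), p y := by
  have h1 : ∀ᵐ y ∂(volume.restrict (openModel j)), p y :=
    (ae_restrict_iff' (measurableSet_openModel j)).2 h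
  rw [← map_modelMeasure, (measurableEmbedding_closedModel j).ae_map_iff] at h1
  exact h1

theorem ae_mem_openModel : ∀ᵐ y : closedModel j ∂(modelMeasure j), (y : ℂ) ∈ openModel j :=
  ae_modelMeasure (ae_of_all _ fun _ h => h)

theorem ae_pow_ne (n : ℕ) (c : ℂ) (hn : 0 < n) : ∀ᵐ y : ℂ, y ^ n ≠ c := by
  have hfin : {y : ℂ | y ^ n = c}.Finite := by
    refine (Multiset.finite_toSet (Polynomial.nthRoots n c)).subset fun y hy => ?_
    exact (Polynomial.mem_nthRoots hn).2 hy
  rw [ae_iff]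
  simpa using hfin.measure_zero volume

theorem integrableOn_two_div_rpow {s : ℝ} (hs0 : 0 ≤ s) (hs : s < 2) :
    ∃ C, ∀ x : ℂ, IntegrableOn (fun y => (2 / ‖x - y‖) ^ s) (openModel j) ∧
      ∫ y in openModel j, (2 / ‖x - y‖) ^ s ≤ C := by
  obtain ⟨C, hC0, hC⟩ := exists_riesz_bound hs0 hs
  have hsub : openModel j ⊆ closedBall 0 1 := (openModel_subset_ball j).trans ball_subset_closedBall
  have e : ∀ x y : ℂ, (2 / ‖x - y‖) ^ s = 2 ^ s * ‖x - y‖ ^ (-s) := fun x y => by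
    rw [div_rpow two_pos.le (norm_nonneg _), rpow_neg (norm_nonneg _), div_eq_mul_inv]
  refine ⟨2 ^ s * C, fun x => ?_⟩
  simp_rw [e]
  have hi : IntegrableOn (fun y : ℂ => ‖x - y‖ ^ (-s)) (closedBall 0 1) := (hC x).1
  refine ⟨(hi.mono_set hsub).const_mul _, ?_⟩
  rw [integral_const_mul]
  refine mul_le_mul_of_nonneg_left (le_trans ?_ (hC x).2) (by positivity)
  exact setIntegral_mono_set hi (ae_of_all _ fun y => by positivity) hsub.eventuallyLE

theorem measurable_coe_prod_closedModel (j : ℕ) :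
    Measurable fun p : closedModel j × closedModel j => ((p.1 : ℂ), (p.2 : ℂ)) :=
  (measurable_subtype_coe.comp measurable_fst).prodMk (measurable_subtype_coe.comp measurable_snd)

theorem measurable_modelGreen (j : ℕ) : Measurable (Function.uncurry (modelGreen j)) := by
  have h : Function.uncurry (modelGreen j) = Function.uncurry (sectorGreen j) ∘
      fun p : closedModel j × closedModel j => ((p.1 : ℂ), (p.2 : ℂ)) := by
    ext p
    simp only [Function.comp, Function.uncurry, modelGreen]
  rw [h]
  exact (measurable_sectorGreen j).comp (measurable_coe_prod_closedModel j)

theorem measurable_modelGreen_left (x : closedModel j) : Measurable (modelGreen j x) :=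
  (measurable_modelGreen j).of_uncurry_left

theorem modelGreen_exp_bound (j : ℕ) {a : ℝ} (ha : a < 4 * π) : ∃ C, ∀ x : closedModel j,
    Integrable (fun y => Real.exp (a * modelGreen j x y)) (modelMeasure j) ∧
      ∫ y, Real.exp (a * modelGreen j x y) ∂(modelMeasure j) ≤ C := by
  have hm : ∀ x : closedModel j, AEStronglyMeasurable
      (fun y => Real.exp (a * modelGreen j x y)) (modelMeasure j) := fun x =>
    ((measurable_modelGreen_left x).const_mul a).exp.aestronglyMeasurable
  obtain ⟨C, hC⟩ := integrableOn_two_div_rpow (j := j) (s := max a 0 / (2 * π)) (by positivity) (by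
    rw [div_lt_iff₀ (by positivity)]
    exact max_lt (by linarith) (by positivity))
  refine ⟨C, fun x => ?_⟩
  have hle : ∀ᵐ y : closedModel j ∂(modelMeasure j), Real.exp (a * modelGreen j x y) ≤
      (2 / ‖(x : ℂ) - y‖) ^ (max a 0 / (2 * π)) := by
    refine ae_modelMeasure (p := fun y => Real.exp (a * sectorGreen j x y) ≤
      (2 / ‖(x : ℂ) - y‖) ^ (max a 0 / (2 * π))) ?_
    filter_upwards [ae_pow_ne 1 x one_pos] with y hyx hy
    rw [pow_one] at hyx
    have hG0 := sectorGreen_nonneg x.2 (openModel_subset j hy)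
    have hpos : 0 < ‖(x : ℂ) - y‖ := norm_pos_iff.2 (sub_ne_zero.2 hyx.symm)
    rw [rpow_def_of_pos (by positivity)]
    refine Real.exp_le_exp.2 ?_
    calc a * sectorGreen j x y ≤ max a 0 * sectorGreen j x y := by
          gcongr; exact le_max_left _ _
      _ ≤ max a 0 * ((2 * π)⁻¹ * log (2 / ‖(x : ℂ) - y‖)) := by
          refine mul_le_mul_of_nonneg_left ?_ (le_max_right _ _)
          exact sectorGreen_le x.2 (openModel_subset j hy) hyx.symm
      _ = _ := by ring
  have hi : Integrable (fun y : closedModel j => (2 / ‖(x : ℂ) - y‖) ^ (max a 0 / (2 * π)))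
      (modelMeasure j) :=
    (integrable_modelMeasure_iff (F := fun y => (2 / ‖(x : ℂ) - y‖) ^ (max a 0 / (2 * π)))).2
      (hC x).1
  have hi2 : Integrable (fun y => Real.exp (a * modelGreen j x y)) (modelMeasure j) := by
    refine hi.mono' (hm x) ?_
    filter_upwards [hle] with y hy
    rwa [norm_of_nonneg (Real.exp_pos _).le]
  refine ⟨hi2, (integral_mono_ae hi2 hi hle).trans ?_⟩
  rw [integral_modelMeasure (fun y => (2 / ‖(x : ℂ) - y‖) ^ (max a 0 / (2 * π)))]
  exact (hC x).2

theorem modelGreen_ae_continuousAt (x : closedModel j) :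
    ∀ᵐ y ∂(modelMeasure j), ContinuousAt (fun x' => modelGreen j x' y) x := by
  refine ae_modelMeasure (p := fun y : ℂ => ContinuousAt (fun x' : closedModel j =>
    sectorGreen j x' y) x) ?_
  filter_upwards [ae_pow_ne (2 ^ j) ((x : ℂ) ^ 2 ^ j) (by positivity)] with y hne hy
  exact (continuousAt_sectorGreen x.2 hy hne).comp continuous_subtype_val.continuousAt

theorem isLogKernel_modelGreen (j : ℕ) : IsLogKernel (modelMeasure j) (modelGreen j) where
  measurable := measurable_modelGreen j
  symm x y := sectorGreen_symm _ _
  nonneg x y := sectorGreen_nonneg x.2 y.2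
  exp_bound a ha := modelGreen_exp_bound j ha
  ae_continuousAt := modelGreen_ae_continuousAt

/-- Extension by zero to the plane of a function on the closed sector, restricted to the open
sector. -/
noncomputable def extendModel (g : closedModel j → ℝ) : ℂ → ℝ :=
  (openModel j).indicator (Function.extend Subtype.val g 0)

theorem extendModel_coe {g : closedModel j → ℝ} {x : closedModel j} (hx : (x : ℂ) ∈ openModel j) :
    extendModel g x = g x := by
  rw [extendModel, indicator_of_mem hx, Subtype.val_injective.extend_apply]

theorem extendModel_of_mem {g : closedModel j → ℝ} {x : ℂ} (hx : x ∈ openModel j) :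
    extendModel g x = g ⟨x, openModel_subset j hx⟩ :=
  extendModel_coe (x := ⟨x, openModel_subset j hx⟩) hx

theorem extendModel_of_notMem {g : closedModel j → ℝ} {x : ℂ} (hx : x ∉ openModel j) :
    extendModel g x = 0 := indicator_of_notMem hx _

theorem BddMeasurable.extendModel {g : closedModel j → ℝ} (hg : BddMeasurable g) :
    BddMeasurable (extendModel g) := by
  obtain ⟨C, hC0, hC⟩ := hg.exists_nonneg_bound
  refine ⟨((measurableEmbedding_closedModel j).measurable_extend hg.1 measurable_zero).indicator
    (measurableSet_openModel j), C, fun x => ?_⟩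
  by_cases hx : x ∈ openModel j
  · rw [extendModel_of_mem hx]; exact hC _
  · rw [extendModel_of_notMem hx, abs_zero]; exact hC0

theorem integral_mul_modelMeasure (F : ℂ → ℝ) (g : closedModel j → ℝ) :
    ∫ y : closedModel j, F y * g y ∂(modelMeasure j) = ∫ y in openModel j, F y * extendModel g y := by
  rw [← integral_modelMeasure fun y => F y * extendModel g y]
  refine integral_congr_ae ?_
  filter_upwards [ae_mem_openModel] with y hy
  rw [extendModel_coe hy]

theorem kernelOp_modelGreen (g : closedModel j → ℝ) (x : closedModel j) :
    kernelOp (modelMeasure j) (modelGreen j) g x =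
      ∫ y in openModel j, sectorGreen j x y * extendModel g y :=
  integral_mul_modelMeasure (fun y => sectorGreen j x y) g

end SectorLogKernel

section OddExtension

variable {j : ℕ}

open scoped ComplexConjugate

/-- The extension of a function on the sector that is invariant under the rotations of order
`2 ^ j` and odd under complex conjugation. -/
noncomputable def oddExtension (j : ℕ) (h : ℂ → ℝ) (y : ℂ) : ℝ :=
  ∑ ζ ∈ Polynomial.nthRootsFinset (2 ^ j) (1 : ℂ), (h (ζ⁻¹ * y) - h (conj (ζ⁻¹ * y)))

theorem norm_of_mem_nthRootsFinset {ζ : ℂ}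
    (hζ : ζ ∈ Polynomial.nthRootsFinset (2 ^ j) (1 : ℂ)) : ‖ζ‖ = 1 := by
  rw [Polynomial.mem_nthRootsFinset (by positivity)] at hζ
  exact Complex.norm_eq_one_of_pow_eq_one hζ (by positivity)

theorem BddMeasurable.finset_sum {ι X : Type*} [MeasurableSpace X] (s : Finset ι) {g : ι → X → ℝ}
    (hg : ∀ i ∈ s, BddMeasurable (g i)) : BddMeasurable (fun x => ∑ i ∈ s, g i x) := by
  choose! C hC using fun i (hi : i ∈ s) => (hg i hi).2
  refine ⟨Finset.measurable_fun_sum s fun i hi => (hg i hi).1, ∑ i ∈ s, C i, fun _ => ?_⟩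
  exact (Finset.abs_sum_le_sum_abs _ _).trans (Finset.sum_le_sum fun i hi => hC i hi _)

theorem BddMeasurable.comp {X Y : Type*} [MeasurableSpace X] [MeasurableSpace Y] {g : Y → ℝ}
    (hg : BddMeasurable g) {φ : X → Y} (hφ : Measurable φ) : BddMeasurable (fun x => g (φ x)) :=
  ⟨hg.1.comp hφ, hg.2.imp fun _ hC x => hC _⟩

theorem measurable_conj_mul (ζ : ℂ) : Measurable fun y : ℂ => conj (ζ * y) :=
  (Complex.continuous_conj.comp (continuous_const.mul continuous_id)).measurable

theorem BddMeasurable.oddExtension {h : ℂ → ℝ} (hh : BddMeasurable h) :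
    BddMeasurable (oddExtension j h) :=
  BddMeasurable.finset_sum _ fun ζ _ =>
    (hh.comp (measurable_const_mul ζ⁻¹)).sub (hh.comp (measurable_conj_mul ζ⁻¹))

theorem measurePreserving_discMeasure (e : ℂ ≃ₗᵢ[ℝ] ℂ) :
    MeasurePreserving e discMeasure discMeasure := by
  have h := (e.measurePreserving).restrict_preimage
    (measurableSet_closedBall (x := (0 : ℂ)) (ε := 1))
  rwa [e.preimage_closedBall, map_zero] at h

theorem integral_comp_discMeasure (e : ℂ ≃ₗᵢ[ℝ] ℂ) (F : ℂ → ℝ) :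
    ∫ y, F (e y) ∂discMeasure = ∫ y, F y ∂discMeasure :=
  (measurePreserving_discMeasure e).integral_comp e.toHomeomorph.measurableEmbedding F

/-- Multiplication by a complex number of modulus one. -/
noncomputable def rotationLIE {ζ : ℂ} (hζ : ‖ζ‖ = 1) : ℂ ≃ₗᵢ[ℝ] ℂ :=
  rotation ⟨ζ, mem_sphere_zero_iff_norm.2 hζ⟩

theorem rotationLIE_apply {ζ : ℂ} (hζ : ‖ζ‖ = 1) (y : ℂ) : rotationLIE hζ y = ζ * y :=
  rotation_apply _ _

theorem integral_mul_oddExtension {F h : ℂ → ℝ} (hF : Integrable F discMeasure)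
    (hh : BddMeasurable h) :
    ∫ y, F y * oddExtension j h y ∂discMeasure =
      ∫ y, (∑ ζ ∈ Polynomial.nthRootsFinset (2 ^ j) (1 : ℂ), (F (ζ * y) - F (ζ * conj y))) * h y
        ∂discMeasure := by
  have key : ∀ ζ ∈ Polynomial.nthRootsFinset (2 ^ j) (1 : ℂ),
      Integrable (fun y => F y * (h (ζ⁻¹ * y) - h (conj (ζ⁻¹ * y)))) discMeasure ∧
      Integrable (fun y => (F (ζ * y) - F (ζ * conj y)) * h y) discMeasure ∧
      ∫ y, F y * (h (ζ⁻¹ * y) - h (conj (ζ⁻¹ * y))) ∂discMeasure =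
        ∫ y, (F (ζ * y) - F (ζ * conj y)) * h y ∂discMeasure := by
    intro ζ hζ
    have hn := norm_of_mem_nthRootsFinset hζ
    have h0 : ζ ≠ 0 := norm_ne_zero_iff.1 (by rw [hn]; exact one_ne_zero)
    set e₁ := rotationLIE hn with he₁
    set e₂ := (RCLike.conjLIE (K := ℂ)).trans e₁ with he₂
    have e₁a : ∀ y, e₁ y = ζ * y := rotationLIE_apply hn
    have e₂a : ∀ y, e₂ y = ζ * conj y := fun y => e₁a _
    have i1 : Integrable (fun y => F y * h (ζ⁻¹ * y)) discMeasure :=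
      (hh.comp (measurable_const_mul ζ⁻¹)).integrable_mul_left hF
    have i2 : Integrable (fun y => F y * h (conj (ζ⁻¹ * y))) discMeasure :=
      (hh.comp (measurable_conj_mul ζ⁻¹)).integrable_mul_left hF
    have i3 : Integrable (fun y => F (ζ * y)) discMeasure := by
      have := (measurePreserving_discMeasure e₁).integrable_comp_of_integrable hF
      exact this.congr (ae_of_all _ fun y => by simp only [Function.comp, e₁a])
    have i4 : Integrable (fun y => F (ζ * conj y)) discMeasure := by
      have := (measurePreserving_discMeasure e₂).integrable_comp_of_integrable hF
      exact this.congr (ae_of_all _ fun y => by simp only [Function.comp, e₂a])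
    have i5 := hh.integrable_mul_left i3
    have i6 := hh.integrable_mul_left i4
    refine ⟨(i1.sub i2).congr (ae_of_all _ fun y => by simp only [Pi.sub_apply]; ring),
      (i5.sub i6).congr (ae_of_all _ fun y => by simp only [Pi.sub_apply]; ring), ?_⟩
    simp_rw [mul_sub, sub_mul]
    rw [integral_sub i1 i2, integral_sub i5 i6,
      ← integral_comp_discMeasure e₁ (fun y => F y * h (ζ⁻¹ * y)),
      ← integral_comp_discMeasure e₂ (fun y => F y * h (conj (ζ⁻¹ * y)))]
    simp_rw [e₁a, e₂a, inv_mul_cancel_left₀ h0, Complex.conj_conj]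
  simp_rw [oddExtension, Finset.mul_sum, Finset.sum_mul]
  rw [integral_finsetSum _ fun ζ hζ => (key ζ hζ).1,
    integral_finsetSum _ fun ζ hζ => (key ζ hζ).2.1]
  exact Finset.sum_congr rfl fun ζ hζ => (key ζ hζ).2.2

theorem log_norm_pow_sub_pow {n : ℕ} (hn : 0 < n) {x y : ℂ} (h : x ^ n ≠ y ^ n) :
    log ‖x ^ n - y ^ n‖ = ∑ ζ ∈ Polynomial.nthRootsFinset n (1 : ℂ), log ‖x - ζ * y‖ := by
  have e := (Complex.isPrimitiveRoot_exp n hn.ne').pow_sub_pow_eq_prod_sub_mul x y hn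
  have h0 := sub_ne_zero.2 h
  rw [e, Finset.prod_ne_zero_iff] at h0
  rw [e, norm_prod, Real.log_prod fun ζ hζ => norm_ne_zero_iff.2 (h0 ζ hζ)]

theorem log_norm_one_sub_pow_mul_pow {n : ℕ} (hn : 0 < n) {x y : ℂ} (h : 1 - x ^ n * y ^ n ≠ 0) :
    log ‖1 - x ^ n * y ^ n‖ =
      ∑ ζ ∈ Polynomial.nthRootsFinset n (1 : ℂ), log ‖1 - x * (ζ * y)‖ := by
  have := log_norm_pow_sub_pow (x := 1) (y := x * y) hn (by
    rw [one_pow, mul_pow]; exact (sub_ne_zero.1 h))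
  rw [one_pow, mul_pow] at this
  rw [this]
  refine Finset.sum_congr rfl fun ζ _ => ?_
  rw [mul_left_comm]

theorem conj_pow_im_neg {y : ℂ} {n : ℕ} (h : 0 < (y ^ n).im) : ((conj y) ^ n).im < 0 := by
  rw [← map_pow, Complex.conj_im]; linarith

theorem sum_log_eq {x y : ℂ} (hx : x ∈ openModel j) (hy : y ∈ openModel j) (hxy : x ≠ y) :
    ∑ ζ ∈ Polynomial.nthRootsFinset (2 ^ j) (1 : ℂ),
      ((log ‖x - ζ * y‖ + log ‖1 - x * (ζ * y)‖) -
        (log ‖x - ζ * conj y‖ + log ‖1 - x * (ζ * conj y)‖)) =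
      -(2 * π) * sectorGreen j x y := by
  have hn : 0 < 2 ^ j := by positivity
  have hxi := hx.2 j le_rfl
  have hyi := hy.2 j le_rfl
  have hne : x ^ 2 ^ j ≠ y ^ 2 ^ j := fun h => hxy (pow_injOn_openModel hx hy h)
  have hne' : x ^ 2 ^ j ≠ (conj y) ^ 2 ^ j := fun h => by
    have := conj_pow_im_neg hyi
    rw [← h] at this
    linarith
  have hx1 : ‖x ^ 2 ^ j‖ < 1 := by rw [norm_pow]; exact pow_lt_one₀ (norm_nonneg _) hx.1 hn.ne'
  have hy1 : ‖y ^ 2 ^ j‖ < 1 := by rw [norm_pow]; exact pow_lt_one₀ (norm_nonneg _) hy.1 hn.ne'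
  have hone : ∀ w : ℂ, ‖w‖ < 1 → 1 - x ^ 2 ^ j * w ≠ 0 := fun w hw h => by
    have : ‖x ^ 2 ^ j * w‖ < 1 := by
      rw [norm_mul]; exact mul_lt_one_of_nonneg_of_lt_one_left (norm_nonneg _) hx1 hw.le
    rw [← sub_eq_zero.1 h, norm_one] at this
    exact lt_irrefl _ this
  have hcy1 : ‖(conj y) ^ 2 ^ j‖ < 1 := by rwa [← map_pow, Complex.norm_conj]
  rw [Finset.sum_sub_distrib, Finset.sum_add_distrib, Finset.sum_add_distrib,
    ← log_norm_pow_sub_pow hn hne, ← log_norm_pow_sub_pow hn hne',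
    ← log_norm_one_sub_pow_mul_pow hn (hone _ hy1), ← log_norm_one_sub_pow_mul_pow hn (hone _ hcy1),
    sectorGreen, log_one_add_halfDiscRatio hx1 hy1 hxi hyi hne, map_pow]
  have := pi_ne_zero
  field_simp
  ring

theorem oddExtension_of_mem {h : ℂ → ℝ} (hh : ∀ y ∉ openModel j, h y = 0) {y : ℂ}
    (hy : y ∈ openModel j) : oddExtension j h y = h y := by
  have hn : 0 < 2 ^ j := by positivity
  rw [oddExtension, Finset.sum_eq_single (1 : ℂ)]
  · rw [inv_one, one_mul, hh (conj y), sub_zero]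
    exact fun hc => lt_asymm (conj_pow_im_neg (hy.2 j le_rfl)) (hc.2 j le_rfl)
  · intro ζ hζ h1
    rw [Polynomial.mem_nthRootsFinset hn] at hζ
    have hp : (ζ⁻¹ * y) ^ 2 ^ j = y ^ 2 ^ j := by rw [mul_pow, inv_pow, hζ, inv_one, one_mul]
    rw [hh (conj (ζ⁻¹ * y)), hh (ζ⁻¹ * y), sub_zero]
    · intro hc
      have h2 := pow_injOn_openModel hc hy hp
      have hy0 : y ≠ 0 := fun h0 => by
        have := hy.2 j le_rfl
        rw [h0, zero_pow hn.ne'] at this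
        exact lt_irrefl _ this
      have h3 : ζ⁻¹ = 1 := mul_right_cancel₀ hy0 (by rw [h2, one_mul])
      exact h1 (inv_eq_one.1 h3)
    · intro hc
      have h2 := conj_pow_im_neg (y := ζ⁻¹ * y) (n := 2 ^ j) (by rw [hp]; exact hy.2 j le_rfl)
      exact lt_asymm h2 (hc.2 j le_rfl)
  · intro h1
    exact absurd ((Polynomial.mem_nthRootsFinset hn _).2 (one_pow _)) h1

theorem integral_sectorGreen_mul {h : ℂ → ℝ} (hh : BddMeasurable h)
    (h0 : ∀ y ∉ openModel j, h y = 0) {x : ℂ} (hx : x ∈ openModel j) :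
    ∫ y in openModel j, sectorGreen j x y * h y =
      -(2 * π)⁻¹ * (logPotential (oddExtension j h) x + reflPotential (oddExtension j h) x) := by
  have hF : Integrable (fun y => log ‖x - y‖ + log ‖1 - x * y‖) discMeasure :=
    (integrable_log_norm_sub x).add (integrable_log_norm_one_sub hx.1)
  have e := integral_mul_oddExtension (j := j) hF hh
  have hg := hh.oddExtension (j := j)
  have e2 : ∫ y, (log ‖x - y‖ + log ‖1 - x * y‖) * oddExtension j h y ∂discMeasure =
      logPotential (oddExtension j h) x + reflPotential (oddExtension j h) x := by
    simp_rw [add_mul]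
    exact integral_add (hg.integrable_mul_left (integrable_log_norm_sub x))
      (hg.integrable_mul_left (integrable_log_norm_one_sub hx.1))
  have hsub : openModel j ⊆ closedBall 0 1 := (openModel_subset_ball j).trans ball_subset_closedBall
  have e3 : ∫ y, (∑ ζ ∈ Polynomial.nthRootsFinset (2 ^ j) (1 : ℂ),
      ((log ‖x - ζ * y‖ + log ‖1 - x * (ζ * y)‖) -
        (log ‖x - ζ * conj y‖ + log ‖1 - x * (ζ * conj y)‖))) * h y ∂discMeasure =
      ∫ y in openModel j, -(2 * π) * (sectorGreen j x y * h y) := by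
    rw [discMeasure, setIntegral_eq_of_subset_of_forall_sdiff_eq_zero
      measurableSet_closedBall hsub fun y hy => by rw [h0 y hy.2, mul_zero]]
    refine setIntegral_congr_ae (measurableSet_openModel j) ?_
    filter_upwards [ae_pow_ne 1 x one_pos] with y hyx hy
    rw [pow_one] at hyx
    rw [sum_log_eq hx hy hyx.symm, mul_assoc]
  rw [← e2, e, e3, integral_const_mul]
  have := pi_ne_zero
  field_simp

/-- The gradient of the Green potential of `h`. -/
noncomputable def greenGradient (j : ℕ) (h : ℂ → ℝ) (x : ℂ) : ℂ :=
  (-(2 * π)⁻¹ : ℝ) • (newtonPotential (oddExtension j h) x + reflGradient (oddExtension j h) x)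

theorem hasFDerivAt_greenPotential {h : ℂ → ℝ} (hh : BddMeasurable h)
    (h0 : ∀ y ∉ openModel j, h y = 0) {x : ℂ} (hx : x ∈ openModel j) :
    HasFDerivAt (fun x => ∫ y in openModel j, sectorGreen j x y * h y)
      (innerSL ℝ (greenGradient j h x)) x := by
  have hg := hh.oddExtension (j := j)
  have h1 := ((hasFDerivAt_logPotential hg x).add (hasFDerivAt_reflPotential hg hx.1)).const_mul
    (-(2 * π)⁻¹)
  have h2 : innerSL ℝ (greenGradient j h x) = (-(2 * π)⁻¹ : ℝ) •
      (innerSL ℝ (newtonPotential (oddExtension j h) x) +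
        innerSL ℝ (reflGradient (oddExtension j h) x)) := by
    rw [greenGradient, map_smul, map_add]
  rw [h2]
  refine h1.congr_of_eventuallyEq ?_
  filter_upwards [(isOpen_openModel j).mem_nhds hx] with z hz
  exact integral_sectorGreen_mul hh h0 hz

theorem continuousOn_greenGradient {h : ℂ → ℝ} (hh : BddMeasurable h) :
    ContinuousOn (greenGradient j h) (ball 0 1) := by
  have hg := hh.oddExtension (j := j)
  exact ContinuousOn.const_smul ((continuous_newtonPotential hg).continuousOn.add
    (continuousOn_reflGradient hg)) (-(2 * π)⁻¹ : ℝ)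

theorem integral_fderiv_greenGradient {h : ℂ → ℝ} (hh : BddMeasurable h)
    (h0 : ∀ y ∉ openModel j, h y = 0) {ψ : ℂ → ℝ} (hψ : ContDiff ℝ 1 ψ)
    (hc : HasCompactSupport ψ) (hs : tsupport ψ ⊆ openModel j) :
    ∫ x in openModel j, fderiv ℝ ψ x (greenGradient j h x) = ∫ x in openModel j, h x * ψ x := by
  have hg := hh.oddExtension (j := j)
  have hs' : tsupport ψ ⊆ ball 0 1 := hs.trans (openModel_subset_ball j)
  have hsub : openModel j ⊆ closedBall 0 1 := (openModel_subset_ball j).trans ball_subset_closedBall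
  have hcont : Continuous (fderiv ℝ ψ) := hψ.continuous_fderiv one_ne_zero
  have hz : ∀ x ∉ tsupport ψ, fderiv ℝ ψ x = 0 := fun x hx => fderiv_eq_zero_of_notMem_tsupport hx
  have i1 : Integrable fun x => fderiv ℝ ψ x (newtonPotential (oddExtension j h) x) := by
    refine Continuous.integrable_of_hasCompactSupport
      (hcont.clm_apply (continuous_newtonPotential hg)) ?_
    refine HasCompactSupport.intro hc fun x hx => ?_
    rw [hz x hx, zero_apply]
  have i2 : Integrable fun x => fderiv ℝ ψ x (reflGradient (oddExtension j h) x) := by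
    have : IntegrableOn (fun x => fderiv ℝ ψ x (reflGradient (oddExtension j h) x))
        (tsupport ψ) := by
      refine ContinuousOn.integrableOn_compact hc ?_
      exact hcont.continuousOn.clm_apply ((continuousOn_reflGradient hg).mono hs')
    refine (integrableOn_iff_integrable_of_support_subset fun x hx => ?_).1 this
    by_contra hx'
    exact hx (by simp only [hz x hx', zero_apply])
  rw [setIntegral_eq_integral_of_forall_compl_eq_zero fun x hx => by
    rw [hz x fun hx' => hx (hs hx'), zero_apply]]
  have e1 : ∀ x, fderiv ℝ ψ x (greenGradient j h x) = -(2 * π)⁻¹ *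
      (fderiv ℝ ψ x (newtonPotential (oddExtension j h) x) +
        fderiv ℝ ψ x (reflGradient (oddExtension j h) x)) := fun x => by
    rw [greenGradient, map_smul, map_add, smul_eq_mul]
  simp_rw [e1]
  rw [integral_const_mul, integral_add i1 i2, integral_fderiv_newtonPotential hψ hc hg,
    integral_fderiv_reflGradient hψ hc hg hs', add_zero, discMeasure,
    setIntegral_eq_of_subset_of_forall_sdiff_eq_zero measurableSet_closedBall hsub fun x hx => by
      simp only [image_eq_zero_of_notMem_tsupport fun h => hx.2 (hs h), mul_zero],
    ← integral_const_mul]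
  refine setIntegral_congr_fun (measurableSet_openModel j) fun x hx => ?_
  simp only [oddExtension_of_mem h0 hx]
  have := pi_ne_zero
  field_simp

end OddExtension

section Cutoff

/-- A smooth increasing odd function close to the identity, vanishing on `[-ε, ε]`. -/
noncomputable def softThreshold (ε s : ℝ) : ℝ := s * Real.smoothTransition (s ^ 2 / ε ^ 2 - 1)

variable {ε s : ℝ}

theorem contDiff_softThreshold (ε : ℝ) : ContDiff ℝ 1 (softThreshold ε) := by
  have h : ContDiff ℝ 1 Real.smoothTransition := Real.smoothTransition.contDiff (n := 1)
  exact contDiff_id.mul (h.comp (((contDiff_id.pow 2).div_const _).sub contDiff_const))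

theorem softThreshold_eq_zero (hε : 0 < ε) (hs : |s| ≤ ε) : softThreshold ε s = 0 := by
  rw [softThreshold, Real.smoothTransition.zero_of_nonpos, mul_zero]
  rw [sub_nonpos, div_le_one (by positivity)]
  exact sq_le_sq.2 (by rwa [abs_of_pos hε])

theorem abs_softThreshold_sub_le (hε : 0 < ε) (s : ℝ) : |softThreshold ε s - s| ≤ 2 * ε := by
  have e : softThreshold ε s - s = -(s * (1 - Real.smoothTransition (s ^ 2 / ε ^ 2 - 1))) := by
    rw [softThreshold]; ring
  rw [e, abs_neg]
  rcases le_or_gt |s| (2 * ε) with h | h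
  · rw [abs_mul]
    have h1 := Real.smoothTransition.le_one (s ^ 2 / ε ^ 2 - 1)
    have h0 := Real.smoothTransition.nonneg (s ^ 2 / ε ^ 2 - 1)
    rw [abs_of_nonneg (sub_nonneg.2 h1)]
    exact (mul_le_of_le_one_right (abs_nonneg _) (by linarith)).trans h
  · rw [Real.smoothTransition.one_of_one_le, sub_self, mul_zero, abs_zero]
    · positivity
    · rw [le_sub_iff_add_le, le_div_iff₀ (by positivity)]
      have : (2 * ε) ^ 2 ≤ s ^ 2 := sq_le_sq.2 (by rw [abs_of_pos (by positivity)]; exact h.le)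
      nlinarith

theorem monotone_softThreshold (ε : ℝ) : Monotone (softThreshold ε) := by
  refine monotone_of_odd_of_monotoneOn_nonneg (fun x => by simp [softThreshold]) ?_
  intro a ha b hb hab
  have ha' : 0 ≤ a := ha
  refine mul_le_mul hab (Real.smoothTransition.monotone ?_) (Real.smoothTransition.nonneg _) hb
  gcongr

end Cutoff

section GreenForm

variable {j : ℕ}

/-- The Green potential of a function on the sector, extended by zero. -/
noncomputable def greenPotential (g : closedModel j → ℝ) : ℂ → ℝ :=
  extendModel (kernelOp (modelMeasure j) (modelGreen j) g)

theorem kernelOp_modelGreen_eq_zero (g : closedModel j → ℝ) {x : closedModel j}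
    (hx : (x : ℂ) ∉ openModel j) : kernelOp (modelMeasure j) (modelGreen j) g x = 0 := by
  rw [kernelOp_modelGreen]
  simp_rw [sectorGreen_eq_zero x.2 hx, zero_mul]
  exact integral_zero _ _

theorem greenPotential_of_mem (g : closedModel j → ℝ) {x : ℂ} (hx : x ∈ openModel j) :
    greenPotential g x = ∫ y in openModel j, sectorGreen j x y * extendModel g y := by
  rw [greenPotential, extendModel_of_mem hx, kernelOp_modelGreen]

theorem hasFDerivAt_greenPotential_of_mem {g : closedModel j → ℝ} (hg : BddMeasurable g) {x : ℂ}
    (hx : x ∈ openModel j) : HasFDerivAt (greenPotential g)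
      (innerSL ℝ (greenGradient j (extendModel g) x)) x := by
  refine (hasFDerivAt_greenPotential hg.extendModel
    (fun y hy => extendModel_of_notMem hy) hx).congr_of_eventuallyEq ?_
  filter_upwards [(isOpen_openModel j).mem_nhds hx] with z hz
  exact greenPotential_of_mem g hz

theorem contDiffOn_greenPotential {g : closedModel j → ℝ} (hg : BddMeasurable g) :
    ContDiffOn ℝ 1 (greenPotential g) (openModel j) := by
  rw [show (1 : WithTop ℕ∞) = 0 + 1 from (zero_add 1).symm,
    contDiffOn_succ_iff_fderiv_of_isOpen (isOpen_openModel j), contDiffOn_zero]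
  refine ⟨fun x hx => DifferentiableAt.differentiableWithinAt
    (hasFDerivAt_greenPotential_of_mem hg hx).differentiableAt, by simp, ?_⟩
  have h : ContinuousOn (fun x => innerSL ℝ (greenGradient j (extendModel g) x)) (openModel j) :=
    (innerSL ℝ).continuous.comp_continuousOn
      ((continuousOn_greenGradient hg.extendModel).mono (openModel_subset_ball j))
  exact h.congr fun x hx => (hasFDerivAt_greenPotential_of_mem hg hx).fderiv

theorem isCompact_le_abs_greenPotential {g : closedModel j → ℝ} (hg : BddMeasurable g) {ε : ℝ}
    (hε : 0 < ε) : IsCompact {x : ℂ | ε ≤ |greenPotential g x|} := by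
  have hc := (isLogKernel_modelGreen j).continuous_kernelOp hg
  have h : {x : ℂ | ε ≤ |greenPotential g x|} = Subtype.val ''
      {x : closedModel j | ε ≤ |kernelOp (modelMeasure j) (modelGreen j) g x|} := by
    ext x
    constructor
    · intro hx
      by_cases hxo : x ∈ openModel j
      · refine ⟨⟨x, openModel_subset j hxo⟩, ?_, rfl⟩
        have hx' : ε ≤ |greenPotential g x| := hx
        rwa [greenPotential, extendModel_of_mem hxo] at hx'
      · have hx' : ε ≤ |greenPotential g x| := hx
        rw [greenPotential, extendModel_of_notMem hxo, abs_zero] at hx'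
        exact absurd hx' hε.not_ge
    · rintro ⟨y, hy, rfl⟩
      have hy' : ε ≤ |kernelOp (modelMeasure j) (modelGreen j) g y| := hy
      have hyo : (y : ℂ) ∈ openModel j := by
        by_contra hyo
        rw [kernelOp_modelGreen_eq_zero g hyo, abs_zero] at hy'
        exact hε.not_ge hy'
      change ε ≤ |greenPotential g y|
      rwa [greenPotential, extendModel_coe hyo]
  rw [h]
  exact ((isClosed_le continuous_const hc.abs).isCompact).image continuous_subtype_val

theorem le_abs_greenPotential_subset (g : closedModel j → ℝ) {ε : ℝ} (hε : 0 < ε) :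
    {x : ℂ | ε ≤ |greenPotential g x|} ⊆ openModel j := fun x hx => by
  by_contra hxo
  have hx' : ε ≤ |greenPotential g x| := hx
  rw [greenPotential, extendModel_of_notMem hxo, abs_zero] at hx'
  exact hε.not_ge hx'

theorem integral_mul_softThreshold_nonneg {g : closedModel j → ℝ} (hg : BddMeasurable g) {ε : ℝ}
    (hε : 0 < ε) :
    0 ≤ ∫ x in openModel j, extendModel g x * softThreshold ε (greenPotential g x) := by
  have hcpt := isCompact_le_abs_greenPotential hg hε
  have hsub := le_abs_greenPotential_subset g hε
  have hz : ∀ x ∉ {x : ℂ | ε ≤ |greenPotential g x|},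
      softThreshold ε (greenPotential g x) = 0 := fun x hx => by
    have hx' : ¬ ε ≤ |greenPotential g x| := hx
    exact softThreshold_eq_zero hε (not_le.1 hx').le
  have hts : tsupport (fun x => softThreshold ε (greenPotential g x)) ⊆
      {x : ℂ | ε ≤ |greenPotential g x|} := by
    refine closure_minimal (fun x hx => ?_) hcpt.isClosed
    by_contra hx'
    exact hx (hz x hx')
  have hd : ∀ x ∈ openModel j, HasFDerivAt (fun x => softThreshold ε (greenPotential g x))
      (deriv (softThreshold ε) (greenPotential g x) •
        innerSL ℝ (greenGradient j (extendModel g) x)) x := fun x hx =>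
    (((contDiff_softThreshold ε).differentiable one_ne_zero) _).hasDerivAt.comp_hasFDerivAt x
      (hasFDerivAt_greenPotential_of_mem hg hx)
  have hψ : ContDiff ℝ 1 (fun x => softThreshold ε (greenPotential g x)) := by
    rw [contDiff_iff_contDiffAt]
    intro x
    by_cases hx : x ∈ openModel j
    · exact (contDiff_softThreshold ε).contDiffAt.comp x
        ((contDiffOn_greenPotential hg).contDiffAt ((isOpen_openModel j).mem_nhds hx))
    · refine (contDiffAt_const (c := (0 : ℝ))).congr_of_eventuallyEq ?_
      filter_upwards [hcpt.isClosed.isOpen_compl.mem_nhds fun h => hx (hsub h)] with z h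
        using hz z h
  rw [← integral_fderiv_greenGradient hg.extendModel (fun y hy => extendModel_of_notMem hy) hψ
    (hcpt.of_isClosed_subset (isClosed_tsupport _) hts) (hts.trans hsub)]
  refine setIntegral_nonneg (measurableSet_openModel j) fun x hx => ?_
  rw [(hd x hx).fderiv, smul_apply, innerSL_apply_apply, smul_eq_mul]
  exact mul_nonneg ((monotone_softThreshold ε).deriv_nonneg) real_inner_self_nonneg

theorem kernelForm_modelGreen (g : closedModel j → ℝ) :
    kernelForm (modelMeasure j) (modelGreen j) g g =
      ∫ x in openModel j, extendModel g x * greenPotential g x := by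
  rw [kernelForm, greenPotential, ← integral_mul_modelMeasure]
  refine integral_congr_ae ?_
  filter_upwards [ae_mem_openModel] with x hx
  rw [extendModel_coe hx]

theorem posSemidef_modelGreen {g : closedModel j → ℝ} (hg : BddMeasurable g) :
    0 ≤ kernelForm (modelMeasure j) (modelGreen j) g g := by
  have hh := hg.extendModel
  have hu : BddMeasurable (greenPotential g) :=
    ((isLogKernel_modelGreen j).continuous_kernelOp hg).bddMeasurable.extendModel
  rw [kernelForm_modelGreen]
  obtain ⟨C, hC0, hC⟩ := hh.exists_nonneg_bound
  set V := volume.real (openModel j)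
  have key : ∀ ε > 0, -(C * (2 * ε) * V) ≤
      ∫ x in openModel j, extendModel g x * greenPotential g x := by
    intro ε hε
    have hT := hu.comp_continuous (contDiff_softThreshold ε).continuous
    have i1 : IntegrableOn (fun x => extendModel g x * greenPotential g x) (openModel j) :=
      (hh.mul hu).integrable _
    have i2 : IntegrableOn (fun x => extendModel g x * softThreshold ε (greenPotential g x))
      (openModel j) := (hh.mul hT).integrable _
    have h1 : ‖∫ x in openModel j, (extendModel g x * softThreshold ε (greenPotential g x) -
        extendModel g x * greenPotential g x)‖ ≤ C * (2 * ε) * V := by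
      refine norm_setIntegral_le_of_norm_le_const (volume_openModel_lt_top j) fun x _ => ?_
      rw [← mul_sub, norm_mul]
      exact mul_le_mul (hC x) (abs_softThreshold_sub_le hε _) (norm_nonneg _) hC0
    rw [integral_sub i2 i1, Real.norm_eq_abs] at h1
    have h2 := integral_mul_softThreshold_nonneg hg hε
    linarith [(abs_le.1 h1).2]
  have hlim : Tendsto (fun ε : ℝ => -(C * (2 * ε) * V)) (𝓝[>] 0) (𝓝 0) := by
    have : Continuous fun ε : ℝ => -(C * (2 * ε) * V) := by fun_prop
    simpa using (this.tendsto 0).mono_left nhdsWithin_le_nhds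
  exact le_of_tendsto hlim (eventually_mem_nhdsWithin.mono key)

theorem isGreenKernel_modelGreen (j : ℕ) : IsGreenKernel (modelMeasure j) (modelGreen j) where
  toIsLogKernel := isLogKernel_modelGreen j
  posSemidef _ hg := posSemidef_modelGreen hg

end GreenForm

section MoserFunctions

variable {j : ℕ}

theorem openModel_nonempty (j : ℕ) : (openModel j).Nonempty := by
  set θ : ℝ := π / 2 ^ (j + 1) with hθ
  have hθ0 : 0 < θ := by positivity
  refine ⟨((1 / 2 : ℝ) : ℂ) * Complex.exp (θ * Complex.I), ?_, fun k hk => ?_⟩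
  · rw [norm_mul, Complex.norm_exp_ofReal_mul_I, Complex.norm_real]
    norm_num
  · have e : (((1 / 2 : ℝ) : ℂ) * Complex.exp (θ * Complex.I)) ^ 2 ^ k =
        (((1 / 2 : ℝ) ^ 2 ^ k : ℝ) : ℂ) * Complex.exp ((2 ^ k * θ : ℝ) * Complex.I) := by
      rw [mul_pow, ← Complex.exp_nat_mul]
      push_cast
      ring_nf
    rw [e, Complex.im_ofReal_mul, Complex.exp_ofReal_mul_I_im]
    refine mul_pos (by positivity) (Real.sin_pos_of_pos_of_lt_pi (by positivity) ?_)
    have h2 : (2 : ℝ) ^ k < 2 ^ (j + 1) := pow_lt_pow_right₀ one_lt_two (by omega)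
    rw [hθ, mul_div_assoc', div_lt_iff₀ (by positivity), mul_comm]
    exact mul_lt_mul_of_pos_left h2 pi_pos

theorem integral_indicator_inv_norm {R : ℝ} (hR : 0 < R) :
    ∫ z : ℂ, (Iio R).indicator (fun r : ℝ => r ^ (-1 : ℝ)) ‖z‖ = 2 * π * R := by
  rw [integral_fun_norm_addHaar]
  have h2 : ∫ y in Ioi (0 : ℝ), y ^ (Module.finrank ℝ ℂ - 1) •
      (Iio R).indicator (fun r : ℝ => r ^ (-1 : ℝ)) y =
      ∫ y in Ioi (0 : ℝ), (Iio R).indicator (fun _ => (1 : ℝ)) y := by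
    refine setIntegral_congr_fun measurableSet_Ioi fun r hr => ?_
    have hr' : 0 < r := hr
    by_cases h : r ∈ Iio R
    · simp only [indicator_of_mem h, Complex.finrank_real_complex, rpow_neg_one, smul_eq_mul]
      rw [show 2 - 1 = 1 from rfl, pow_one, mul_inv_cancel₀ hr'.ne']
    · simp only [indicator_of_notMem h, smul_zero]
  rw [h2, setIntegral_indicator measurableSet_Iio, Ioi_inter_Iio]
  simp [measureReal_def, Complex.volume_ball, hR.le, mul_assoc]

/-- A cone of height one over the ball of radius `ε`. -/
noncomputable def coneBump (x₀ : ℂ) (ε : ℝ) (y : ℂ) : ℝ := max 0 (1 - ‖y - x₀‖ / ε)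

variable {x₀ x y : ℂ} {ε : ℝ}

theorem continuous_coneBump (x₀ : ℂ) (ε : ℝ) : Continuous (coneBump x₀ ε) := by
  unfold coneBump; fun_prop

theorem coneBump_nonneg : 0 ≤ coneBump x₀ ε y := le_max_left _ _

theorem coneBump_le_one (hε : 0 < ε) : coneBump x₀ ε y ≤ 1 :=
  max_le zero_le_one (by have : 0 ≤ ‖y - x₀‖ / ε := by positivity
                         linarith)

theorem bddMeasurable_coneBump (x₀ : ℂ) (hε : 0 < ε) : BddMeasurable (coneBump x₀ ε) :=
  ⟨(continuous_coneBump x₀ ε).measurable, 1, fun y => by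
    rw [abs_of_nonneg coneBump_nonneg]; exact coneBump_le_one hε⟩

theorem coneBump_eq_zero (hε : 0 < ε) (h : y ∉ ball x₀ ε) : coneBump x₀ ε y = 0 := by
  rw [mem_ball, dist_eq_norm, not_lt] at h
  refine max_eq_left ?_
  rw [sub_nonpos, one_le_div hε]
  exact h

theorem le_integral_coneBump (hε : 0 < ε) (h : ball x₀ ε ⊆ openModel j) :
    π * ε ^ 2 / 8 ≤ ∫ y in openModel j, coneBump x₀ ε y := by
  have hi : IntegrableOn (coneBump x₀ ε) (openModel j) :=
    (bddMeasurable_coneBump x₀ hε).integrable _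
  have hsub : ball x₀ (ε / 2) ⊆ openModel j := (ball_subset_ball (by linarith)).trans h
  calc π * ε ^ 2 / 8 = ∫ _ in ball x₀ (ε / 2), (1 / 2 : ℝ) := by
        rw [setIntegral_const, measureReal_def, Complex.volume_ball]
        simp [ENNReal.toReal_ofReal (half_pos hε).le]
        ring
    _ ≤ ∫ y in ball x₀ (ε / 2), coneBump x₀ ε y := by
        refine setIntegral_mono_on (integrableOn_const measure_ball_lt_top.ne)
          (hi.mono_set hsub) measurableSet_ball fun y hy => ?_
        rw [mem_ball, dist_eq_norm] at hy
        refine le_trans ?_ (le_max_right _ _)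
        have : ‖y - x₀‖ / ε ≤ 1 / 2 := by
          rw [div_le_iff₀ hε]; linarith
        linarith
    _ ≤ _ := setIntegral_mono_set hi (ae_of_all _ fun _ => coneBump_nonneg) hsub.eventuallyLE

theorem integrableOn_sectorGreen_mul (hx : x ∈ closedModel j) {χ : ℂ → ℝ} (hχ : BddMeasurable χ) :
    IntegrableOn (fun y => sectorGreen j x y * χ y) (openModel j) :=
  hχ.integrable_mul_left (integrable_modelMeasure_iff.1
    ((isLogKernel_modelGreen j).integrable_left ⟨x, hx⟩))

theorem integral_sectorGreen_mul_coneBump_le (hε : 0 < ε) (h : ball x₀ ε ⊆ openModel j)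
    (hx : x ∈ closedBall x₀ ε) (hxo : x ∈ openModel j) :
    ∫ y in openModel j, sectorGreen j x y * coneBump x₀ ε y ≤
      (∫ y in openModel j, coneBump x₀ ε y) * ((2 * π)⁻¹ * log (1 / ε) + 64) := by
  set k : ℂ → ℝ := fun y => (Iio (2 * ε)).indicator (fun r : ℝ => r ^ (-1 : ℝ)) ‖x - y‖ with hk
  have hki : Integrable k :=
    (integrable_indicator_norm_rpow (by norm_num : (1 : ℝ) < 2) (by positivity)).comp_sub_left x
  have hk0 : ∀ y, 0 ≤ k y := fun y => by
    simp only [hk, indicator]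
    split_ifs <;> positivity
  have hkv : ∫ y, k y = 2 * π * (2 * ε) := by
    rw [← integral_indicator_inv_norm (by positivity : 0 < 2 * ε)]
    exact integral_sub_left_eq_self
      (fun z : ℂ => (Iio (2 * ε)).indicator (fun r : ℝ => r ^ (-1 : ℝ)) ‖z‖) volume x
  have hχ := bddMeasurable_coneBump x₀ hε
  have hχi : IntegrableOn (coneBump x₀ ε) (openModel j) := hχ.integrable _
  have hpt : ∀ᵐ y, y ∈ openModel j → sectorGreen j x y * coneBump x₀ ε y ≤
      (2 * π)⁻¹ * log (1 / ε) * coneBump x₀ ε y + (2 * π)⁻¹ * (2 * ε) * k y := by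
    filter_upwards [ae_pow_ne 1 x one_pos] with y hyx hy
    rw [pow_one] at hyx
    have hpos : 0 < ‖x - y‖ := norm_pos_iff.2 (sub_ne_zero.2 hyx.symm)
    by_cases hyb : y ∈ ball x₀ ε
    · have hlt : ‖x - y‖ < 2 * ε := by
        rw [← dist_eq_norm]
        calc dist x y ≤ dist x x₀ + dist y x₀ := dist_triangle_right _ _ _
          _ < 2 * ε := by rw [mem_ball] at hyb; rw [mem_closedBall] at hx; linarith
      have hkval : k y = ‖x - y‖⁻¹ := by
        simp only [hk]
        rw [indicator_of_mem (mem_Iio.2 hlt), rpow_neg_one]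
      have h1 := sectorGreen_le (openModel_subset j hxo) (openModel_subset j hy) hyx.symm
      have h2 : log (2 / ‖x - y‖) ≤ log (1 / ε) + 2 * ε * k y := by
        have e : 2 / ‖x - y‖ = (1 / ε) * (2 * ε * ‖x - y‖⁻¹) := by field_simp
        rw [e, log_mul (by positivity) (by positivity), hkval]
        have := log_le_sub_one_of_pos (x := 2 * ε * ‖x - y‖⁻¹) (by positivity)
        linarith
      calc sectorGreen j x y * coneBump x₀ ε y
          ≤ ((2 * π)⁻¹ * (log (1 / ε) + 2 * ε * k y)) * coneBump x₀ ε y := by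
            refine mul_le_mul_of_nonneg_right (h1.trans ?_) coneBump_nonneg
            gcongr
        _ = (2 * π)⁻¹ * log (1 / ε) * coneBump x₀ ε y +
            ((2 * π)⁻¹ * (2 * ε) * k y) * coneBump x₀ ε y := by ring
        _ ≤ _ := by
            refine add_le_add le_rfl (mul_le_of_le_one_right ?_ (coneBump_le_one hε))
            have := hk0 y
            positivity
    · rw [coneBump_eq_zero hε hyb, mul_zero, mul_zero, zero_add]
      have := hk0 y
      positivity
  have hM := le_integral_coneBump hε h
  calc ∫ y in openModel j, sectorGreen j x y * coneBump x₀ ε y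
      ≤ ∫ y in openModel j, ((2 * π)⁻¹ * log (1 / ε) * coneBump x₀ ε y +
          (2 * π)⁻¹ * (2 * ε) * k y) :=
        setIntegral_mono_on_ae (integrableOn_sectorGreen_mul (openModel_subset j hxo) hχ)
          ((hχi.const_mul _).add (hki.integrableOn.const_mul _)) (measurableSet_openModel j) hpt
    _ = (2 * π)⁻¹ * log (1 / ε) * (∫ y in openModel j, coneBump x₀ ε y) +
          (2 * π)⁻¹ * (2 * ε) * ∫ y in openModel j, k y := by
        rw [integral_add (hχi.const_mul _) (hki.integrableOn.const_mul _), integral_const_mul,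
          integral_const_mul]
    _ ≤ (2 * π)⁻¹ * log (1 / ε) * (∫ y in openModel j, coneBump x₀ ε y) +
          (2 * π)⁻¹ * (2 * ε) * (2 * π * (2 * ε)) := by
        rw [← hkv]
        exact add_le_add le_rfl (mul_le_mul_of_nonneg_left
          (setIntegral_le_integral hki (ae_of_all _ hk0)) (by positivity))
    _ ≤ _ := by
        have e : (2 * π)⁻¹ * (2 * ε) * (2 * π * (2 * ε)) = 4 * ε ^ 2 := by
          have := pi_ne_zero
          field_simp
          ring
        rw [e]
        nlinarith [pi_gt_three, sq_nonneg ε]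

theorem norm_pow_sub_pow_le {n : ℕ} (hx : ‖x‖ ≤ 1) (hy : ‖y‖ ≤ 1) :
    ‖x ^ n - y ^ n‖ ≤ n * ‖x - y‖ := by
  induction n with
  | zero => simp
  | succ n ih =>
    have e : x ^ (n + 1) - y ^ (n + 1) = x ^ n * (x - y) + (x ^ n - y ^ n) * y := by ring
    rw [e]
    refine (norm_add_le _ _).trans ?_
    rw [norm_mul, norm_mul, norm_pow]
    push_cast
    have h1 : ‖x‖ ^ n * ‖x - y‖ ≤ ‖x - y‖ :=
      mul_le_of_le_one_left (norm_nonneg _) (pow_le_one₀ (norm_nonneg _) hx)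
    have h2 : ‖x ^ n - y ^ n‖ * ‖y‖ ≤ ‖x ^ n - y ^ n‖ :=
      mul_le_of_le_one_right (norm_nonneg _) hy
    linarith

theorem exists_le_sectorGreen {K : Set ℂ} (hK : IsCompact K) (hKo : K ⊆ openModel j) :
    ∃ C, ∀ x ∈ K, ∀ y ∈ K, x ≠ y → (2 * π)⁻¹ * log (1 / ‖x - y‖) - C ≤ sectorGreen j x y := by
  have hn : 0 < 2 ^ j := by positivity
  set a : ℂ → ℝ := fun x => (x ^ 2 ^ j).im * (1 - ‖x ^ 2 ^ j‖ ^ 2) with ha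
  have hapos : ∀ x ∈ openModel j, 0 < a x := fun x hx => by
    have h1 : ‖x ^ 2 ^ j‖ < 1 := by rw [norm_pow]; exact pow_lt_one₀ (norm_nonneg _) hx.1 hn.ne'
    have := hx.2 j le_rfl
    exact mul_pos this (by nlinarith [norm_nonneg (x ^ 2 ^ j)])
  have hac : Continuous a := by fun_prop
  obtain ⟨b, hb0, hb⟩ : ∃ b > 0, ∀ x ∈ K, b ≤ a x := by
    rcases K.eq_empty_or_nonempty with rfl | hne
    · exact ⟨1, one_pos, by simp⟩
    · obtain ⟨z, hz, hmin⟩ := hK.exists_isMinOn hne hac.continuousOn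
      exact ⟨a z, hapos z (hKo hz), fun x hx => hmin hx⟩
  set κ : ℝ := b ^ 2 / (2 ^ j : ℕ) ^ 2 with hκ
  have hκ0 : 0 < κ := by positivity
  refine ⟨-((4 * π)⁻¹ * log κ), fun x hx y hy hxy => ?_⟩
  have hxo := hKo hx
  have hyo := hKo hy
  have hd : 0 < ‖x - y‖ := norm_pos_iff.2 (sub_ne_zero.2 hxy)
  have hne : x ^ 2 ^ j ≠ y ^ 2 ^ j := fun h => hxy (pow_injOn_openModel hxo hyo h)
  have hd' : 0 < ‖x ^ 2 ^ j - y ^ 2 ^ j‖ := norm_pos_iff.2 (sub_ne_zero.2 hne)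
  have hle := norm_pow_sub_pow_le (n := 2 ^ j) hxo.1.le hyo.1.le
  have hx1 := norm_pow_le_one_of_mem (openModel_subset j hxo)
  have hy1 := norm_pow_le_one_of_mem (openModel_subset j hyo)
  have h1 : ‖1 - x ^ 2 ^ j * y ^ 2 ^ j‖ ≤ 2 := by
    refine (norm_sub_le _ _).trans ?_
    rw [norm_one, norm_mul]
    have := mul_le_one₀ hx1 (norm_nonneg _) hy1
    linarith
  have h1' : 0 < ‖1 - x ^ 2 ^ j * y ^ 2 ^ j‖ := by
    refine norm_pos_iff.2 fun h => ?_
    have hlt : ‖x ^ 2 ^ j * y ^ 2 ^ j‖ < 1 := by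
      rw [norm_mul, norm_pow x]
      exact mul_lt_one_of_nonneg_of_lt_one_left (by positivity)
        (pow_lt_one₀ (norm_nonneg _) hxo.1 hn.ne') hy1
    rw [← sub_eq_zero.1 h, norm_one] at hlt
    exact lt_irrefl _ hlt
  have hr : κ / ‖x - y‖ ^ 2 ≤ halfDiscRatio (x ^ 2 ^ j) (y ^ 2 ^ j) := by
    have e : halfDiscRatio (x ^ 2 ^ j) (y ^ 2 ^ j) =
        4 * (a x * a y) / (‖x ^ 2 ^ j - y ^ 2 ^ j‖ ^ 2 * ‖1 - x ^ 2 ^ j * y ^ 2 ^ j‖ ^ 2) := by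
      simp only [halfDiscRatio, ha]; ring_nf
    have hab : b ^ 2 ≤ a x * a y := by
      rw [sq]; exact mul_le_mul (hb x hx) (hb y hy) hb0.le (hapos x hxo).le
    rw [e]
    calc κ / ‖x - y‖ ^ 2 = 4 * b ^ 2 / (((2 ^ j : ℕ) * ‖x - y‖) ^ 2 * 2 ^ 2) := by
          rw [hκ]; field_simp; norm_num
      _ ≤ _ := by
          have := hapos x hxo
          have := hapos y hyo
          gcongr
  have hlog : log κ + 2 * log (1 / ‖x - y‖) ≤ log (1 + halfDiscRatio (x ^ 2 ^ j) (y ^ 2 ^ j)) := by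
    have e : log κ + 2 * log (1 / ‖x - y‖) = log (κ / ‖x - y‖ ^ 2) := by
      rw [log_div hκ0.ne' (by positivity), log_pow, one_div, log_inv]
      push_cast
      ring
    rw [e]
    exact log_le_log (by positivity) (by linarith)
  rw [sectorGreen]
  calc (2 * π)⁻¹ * log (1 / ‖x - y‖) - -((4 * π)⁻¹ * log κ)
      = (4 * π)⁻¹ * (log κ + 2 * log (1 / ‖x - y‖)) := by
        have := pi_ne_zero
        field_simp
        ring
    _ ≤ _ := by gcongr

end MoserFunctions

section MoserSequence

variable {j : ℕ} {x₀ x : ℂ} {ε r C : ℝ}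

theorem le_integral_sectorGreen_mul_coneBump (hε : 0 < ε) (hεr : ε ≤ r)
    (hr : closedBall x₀ r ⊆ openModel j)
    (hC : ∀ x ∈ closedBall x₀ r, ∀ y ∈ closedBall x₀ r, x ≠ y →
      (2 * π)⁻¹ * log (1 / ‖x - y‖) - C ≤ sectorGreen j x y)
    (hx : x ∈ closedBall x₀ ε) :
    (∫ y in openModel j, coneBump x₀ ε y) * ((2 * π)⁻¹ * log (1 / ε) - ((2 * π)⁻¹ * log 2 + C)) ≤
      ∫ y in openModel j, sectorGreen j x y * coneBump x₀ ε y := by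
  have hχ := bddMeasurable_coneBump x₀ hε
  have hχi : IntegrableOn (coneBump x₀ ε) (openModel j) := hχ.integrable _
  have hxr : x ∈ closedBall x₀ r := closedBall_subset_closedBall hεr hx
  have hxo := hr hxr
  rw [← integral_mul_const]
  refine setIntegral_mono_on_ae (hχi.mul_const _)
    (integrableOn_sectorGreen_mul (openModel_subset j hxo) hχ) (measurableSet_openModel j) ?_
  filter_upwards [ae_pow_ne 1 x one_pos] with y hyx hy
  rw [pow_one] at hyx
  have hpos : 0 < ‖x - y‖ := norm_pos_iff.2 (sub_ne_zero.2 hyx.symm)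
  by_cases hyb : y ∈ ball x₀ ε
  · have hyr : y ∈ closedBall x₀ r := closedBall_subset_closedBall hεr (ball_subset_closedBall hyb)
    have hlt : ‖x - y‖ ≤ 2 * ε := by
      rw [← dist_eq_norm]
      calc dist x y ≤ dist x x₀ + dist y x₀ := dist_triangle_right _ _ _
        _ ≤ 2 * ε := by rw [mem_ball] at hyb; rw [mem_closedBall] at hx; linarith
    rw [mul_comm]
    refine mul_le_mul_of_nonneg_right (le_trans ?_ (hC x hxr y hyr hyx.symm)) coneBump_nonneg
    have h1 : log (1 / ε) - log 2 ≤ log (1 / ‖x - y‖) := by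
      rw [← log_div (by positivity) two_ne_zero]
      refine log_le_log (by positivity) ?_
      rw [div_div, mul_comm]
      exact one_div_le_one_div_of_le hpos hlt
    have h2 := mul_le_mul_of_nonneg_left h1 (by positivity : 0 ≤ (2 * π)⁻¹)
    linarith
  · rw [coneBump_eq_zero hε hyb, mul_zero, zero_mul]

theorem kernelOp_modelGreen_coe (χ : ℂ → ℝ) (x : closedModel j) :
    kernelOp (modelMeasure j) (modelGreen j) (fun y => χ y) x =
      ∫ y in openModel j, sectorGreen j x y * χ y :=
  integral_modelMeasure fun y => sectorGreen j x y * χ y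

theorem kernelForm_coneBump_le (hε : 0 < ε) (h : closedBall x₀ ε ⊆ openModel j) :
    kernelForm (modelMeasure j) (modelGreen j) (fun y => coneBump x₀ ε y)
      (fun y => coneBump x₀ ε y) ≤
      (∫ y in openModel j, coneBump x₀ ε y) ^ 2 * ((2 * π)⁻¹ * log (1 / ε) + 64) := by
  have hχ := bddMeasurable_coneBump x₀ hε
  have hχ' : BddMeasurable fun y : closedModel j => coneBump x₀ ε y :=
    hχ.comp measurable_subtype_coe
  have hK := ((isLogKernel_modelGreen j).continuous_kernelOp hχ').bddMeasurable
  have hle : ∀ x : closedModel j, coneBump x₀ ε x *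
      kernelOp (modelMeasure j) (modelGreen j) (fun y => coneBump x₀ ε y) x ≤
      coneBump x₀ ε x *
        ((∫ y in openModel j, coneBump x₀ ε y) * ((2 * π)⁻¹ * log (1 / ε) + 64)) := fun x => by
    by_cases hx : (x : ℂ) ∈ ball x₀ ε
    · have hx' := ball_subset_closedBall hx
      rw [kernelOp_modelGreen_coe]
      exact mul_le_mul_of_nonneg_left (integral_sectorGreen_mul_coneBump_le hε
        (ball_subset_closedBall.trans h) hx' (h hx')) coneBump_nonneg
    · rw [coneBump_eq_zero hε hx, zero_mul, zero_mul]
  calc kernelForm (modelMeasure j) (modelGreen j) (fun y => coneBump x₀ ε y)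
        (fun y => coneBump x₀ ε y)
      ≤ ∫ x : closedModel j, coneBump x₀ ε x *
        ((∫ y in openModel j, coneBump x₀ ε y) * ((2 * π)⁻¹ * log (1 / ε) + 64))
          ∂(modelMeasure j) :=
        integral_mono ((hχ'.mul hK).integrable _) ((hχ'.integrable _).mul_const _) hle
    _ = _ := by
        rw [integral_mul_const, integral_modelMeasure (coneBump x₀ ε)]
        ring

theorem volume_real_closedBall_complex (x₀ : ℂ) (hε : 0 ≤ ε) :
    volume.real (closedBall x₀ ε) = π * ε ^ 2 := by
  rw [measureReal_def, Complex.volume_closedBall]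
  simp [ENNReal.toReal_ofReal hε, mul_comm]

theorem modelMeasure_real_preimage {E : Set ℂ} (hE : MeasurableSet E) (h : E ⊆ openModel j) :
    (modelMeasure j).real (Subtype.val ⁻¹' E) = volume.real E := by
  rw [measureReal_def, ← (measurableEmbedding_closedModel j).map_apply, map_modelMeasure,
    Measure.restrict_apply hE, inter_eq_left.2 h, measureReal_def]

theorem hasMoserFunctions_modelGreen (j : ℕ) :
    HasMoserFunctions (modelMeasure j) (modelGreen j) := by
  obtain ⟨x₀, hx₀⟩ := openModel_nonempty j
  obtain ⟨r, hr0, hr⟩ := Metric.nhds_basis_closedBall.mem_iff.1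
    ((isOpen_openModel j).mem_nhds hx₀)
  obtain ⟨C, hC⟩ := exists_le_sectorGreen (isCompact_closedBall x₀ r) hr
  set D : ℝ := max 0 ((2 * π)⁻¹ * log 2 + C) with hD
  have hD0 : 0 ≤ D := le_max_left _ _
  refine ⟨π * Real.exp (-(4 * π * (64 + 2 * D))), by positivity, fun l₀ => ?_⟩
  set L : ℝ := max (max (l₀ + (64 + 2 * D)) D) ((2 * π)⁻¹ * log (1 / r)) with hL
  have hL1 : l₀ + (64 + 2 * D) ≤ L := (le_max_left _ _).trans (le_max_left _ _)
  have hL2 : D ≤ L := (le_max_right _ _).trans (le_max_left _ _)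
  have hL3 : (2 * π)⁻¹ * log (1 / r) ≤ L := le_max_right _ _
  clear_value L
  set ε : ℝ := Real.exp (-(2 * π * L)) with hεdef
  have hε : 0 < ε := Real.exp_pos _
  have hεL : (2 * π)⁻¹ * log (1 / ε) = L := by
    have := pi_ne_zero
    rw [one_div, log_inv, hεdef, Real.log_exp]
    field_simp
  have hεr : ε ≤ r := by
    rw [← hεL] at hL3
    have h1 := le_of_mul_le_mul_left hL3 (by positivity)
    rw [log_le_log_iff (by positivity) (by positivity)] at h1
    exact (one_div_le_one_div hr0 hε).1 h1
  have hsub : closedBall x₀ ε ⊆ openModel j := (closedBall_subset_closedBall hεr).trans hr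
  set M : ℝ := ∫ y in openModel j, coneBump x₀ ε y with hMdef
  have hM : 0 < M := lt_of_lt_of_le (by positivity)
    (le_integral_coneBump hε (ball_subset_closedBall.trans hsub))
  have hL64 : 0 < L + 64 := by linarith
  set t : ℝ := (M * √(L + 64))⁻¹ with ht
  have hs : 0 < √(L + 64) := Real.sqrt_pos.2 hL64
  have hlL : L - (64 + 2 * D) ≤ (L - D) ^ 2 / (L + 64) := by
    rw [le_div_iff₀ hL64]
    nlinarith [sq_nonneg (64 + D)]
  refine ⟨(L - D) ^ 2 / (L + 64), by linarith,
    ⟨fun y => t * coneBump x₀ ε y,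
      ((continuous_coneBump x₀ ε).comp continuous_subtype_val).const_mul t⟩, ?_,
    Subtype.val ⁻¹' closedBall x₀ ε, measurableSet_closedBall.preimage measurable_subtype_coe,
    ?_, fun x hx => ?_⟩
  · have h1 := kernelForm_coneBump_le hε hsub
    rw [hεL] at h1
    calc kernelForm (modelMeasure j) (modelGreen j) (fun y => t * coneBump x₀ ε y)
          (fun y => t * coneBump x₀ ε y)
        = t ^ 2 * kernelForm (modelMeasure j) (modelGreen j) (fun y => coneBump x₀ ε y)
          (fun y => coneBump x₀ ε y) := kernelForm_smul_smul _ _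
      _ ≤ t ^ 2 * (M ^ 2 * (L + 64)) := mul_le_mul_of_nonneg_left h1 (sq_nonneg _)
      _ = 1 := by
          rw [ht, inv_pow, mul_pow, Real.sq_sqrt hL64.le]
          field_simp
  · rw [modelMeasure_real_preimage measurableSet_closedBall hsub,
      volume_real_closedBall_complex x₀ hε.le, mul_assoc, ← Real.exp_add, hεdef, ← Real.exp_nat_mul]
    refine mul_le_mul_of_nonneg_left (Real.exp_le_exp.2 ?_) pi_pos.le
    push_cast
    nlinarith [pi_pos]
  · have h1 := le_integral_sectorGreen_mul_coneBump hε hεr hr hC hx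
    rw [hεL, ← kernelOp_modelGreen_coe] at h1
    have h2 : M * (L - D) ≤ kernelOp (modelMeasure j) (modelGreen j)
        (fun y => coneBump x₀ ε y) x := by
      refine le_trans (mul_le_mul_of_nonneg_left ?_ hM.le) h1
      linarith [le_max_right 0 ((2 * π)⁻¹ * log 2 + C)]
    calc √((L - D) ^ 2 / (L + 64)) = t * (M * (L - D)) := by
          rw [Real.sqrt_div' _ hL64.le, Real.sqrt_sq (by linarith), ht]
          field_simp
      _ ≤ t * kernelOp (modelMeasure j) (modelGreen j) (fun y => coneBump x₀ ε y) x :=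
          mul_le_mul_of_nonneg_left h2 (by positivity)
      _ = _ := (IsLogKernel.kernelOp_const_mul _ _ _).symm

end MoserSequence

theorem isCriticalNonlinearity_comp_max {f : ℝ → ℝ} (hcont : Continuous f)
    (hodd : ∀ s : ℝ, f (-s) = - f s)
    (hf1 : ∃ C > 0, ∀ s : ℝ, |f s| ≤ C * Real.exp (4 * π * s ^ 2))
    (hf2 : Tendsto (fun s : ℝ => f s / s) (𝓝[≠] 0) (𝓝 0))
    (hH1 : ∃ s₀ > 0, ∃ M > 0, ∀ s : ℝ, s₀ ≤ |s| → 0 < primF f s ∧ primF f s ≤ M * |f s|)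
    (hpos : ∀ s, 0 < s → 0 < f s)
    (hH3 : Tendsto (fun s : ℝ => s * f s * Real.exp (-(4 * π * s ^ 2))) atTop atTop) :
    IsCriticalNonlinearity fun s => f (max s 0) := by
  have h0 : f 0 = 0 := by
    have := hodd 0
    rw [neg_zero] at this
    linarith
  have hnn : ∀ s, 0 ≤ s → 0 ≤ f s := fun s hs => by
    rcases hs.eq_or_lt with rfl | h
    · exact h0.ge
    · exact (hpos s h).le
  refine ⟨by fun_prop, fun s => hnn _ (le_max_right _ _), fun s hs => ?_, ?_, ?_, ?_, ?_⟩
  · simp only [max_eq_right hs, h0]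
  · obtain ⟨C, hC0, hC⟩ := hf1
    refine ⟨C, hC0, fun s => ((le_abs_self _).trans (hC _)).trans ?_⟩
    have : (max s 0) ^ 2 ≤ s ^ 2 := by
      rcases le_total s 0 with h | h
      · rw [max_eq_right h]; nlinarith
      · rw [max_eq_left h]
    gcongr
  · intro ε hε
    have h1 : ∀ᶠ s in 𝓝[≠] (0 : ℝ), f s / s < ε := hf2.eventually_lt_const hε
    rw [eventually_nhdsWithin_iff, Metric.eventually_nhds_iff] at h1
    obtain ⟨δ, hδ, h⟩ := h1
    refine ⟨δ / 2, half_pos hδ, fun s hs hsδ => ?_⟩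
    simp only [max_eq_left hs]
    rcases hs.eq_or_lt with rfl | hs'
    · rw [h0, mul_zero]
    · have h2 := h (y := s) (by rw [dist_zero_right, Real.norm_of_nonneg hs]; linarith) hs'.ne'
      rw [div_lt_iff₀ hs'] at h2
      exact h2.le
  · obtain ⟨s₀, hs₀, M, hM, h⟩ := hH1
    refine ⟨s₀, hs₀, M, hM, fun s hs => ?_⟩
    have hs0 : 0 ≤ s := hs₀.le.trans hs
    have h1 := (h s (hs.trans (le_abs_self s))).2
    rw [abs_of_nonneg (hnn s hs0)] at h1
    have e : primF (fun s => f (max s 0)) s = primF f s := by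
      refine intervalIntegral.integral_congr fun t ht => ?_
      rw [uIcc_of_le hs0] at ht
      simp only [max_eq_left ht.1]
    simp only [max_eq_left hs0, e, h1]
  · refine hH3.congr' ?_
    filter_upwards [eventually_ge_atTop 0] with s hs
    rw [max_eq_left hs]

theorem exists_solution_openModel (j : ℕ) {f : ℝ → ℝ}
    (hf : IsCriticalNonlinearity fun s => f (max s 0)) :
    ∃ u : ℂ → ℝ, ContinuousOn u (closedModel j) ∧ ContDiffOn ℝ 1 u (openModel j) ∧
      (∀ x ∉ openModel j, u x = 0) ∧ (∀ x ∈ openModel j, 0 < u x) ∧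
      ∀ ψ : ℂ → ℝ, ContDiff ℝ 1 ψ → HasCompactSupport ψ → tsupport ψ ⊆ openModel j →
        ∫ x in openModel j, ⟪gradient u x, gradient ψ x⟫ =
          ∫ x in openModel j, f (u x) * ψ x := by
  obtain ⟨v, hvc, hv0, hvne, hvK⟩ :=
    (isGreenKernel_modelGreen j).exists_solution hf (hasMoserFunctions_modelGreen j)
  set g : closedModel j → ℝ := fun y => f (max (v y) 0) with hgdef
  have hgc : Continuous g := hf.continuous.comp hvc
  have hg : BddMeasurable g := hgc.bddMeasurable
  have hg0 : ∀ y, 0 ≤ g y := fun y => hf.nonneg (v y)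
  have hvK' : v = kernelOp (modelMeasure j) (modelGreen j) g := funext hvK
  have hu : greenPotential g = extendModel v := by rw [greenPotential, ← hvK']
  have huv : ∀ x : closedModel j, greenPotential g x = v x := fun x => by
    by_cases hx : (x : ℂ) ∈ openModel j
    · rw [hu, extendModel_coe hx]
    · rw [hu, extendModel_of_notMem hx, hvK x]
      exact (kernelOp_modelGreen_eq_zero g hx).symm
  refine ⟨greenPotential g, ?_, contDiffOn_greenPotential hg,
    fun x hx => by rw [hu, extendModel_of_notMem hx], fun x hx => ?_, fun ψ hψ hc hs => ?_⟩
  · rw [continuousOn_iff_continuous_domRestrict]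
    exact hvc.congr fun x => (huv x).symm
  · rw [hu, extendModel_of_mem hx]
    refine (hv0 _).lt_of_ne fun h => hvne ?_
    set x' : closedModel j := ⟨x, openModel_subset j hx⟩
    have h1 : ∫ y, modelGreen j x' y * g y ∂(modelMeasure j) = 0 := by
      rw [h]; exact (hvK x').symm
    rw [integral_eq_zero_iff_of_nonneg
      (fun y => mul_nonneg ((isLogKernel_modelGreen j).nonneg x' y) (hg0 y))
      ((isLogKernel_modelGreen j).integrable_mul hg x')] at h1
    have h2 : g =ᵐ[modelMeasure j] fun _ => 0 := by
      have hne : ∀ᵐ y : closedModel j ∂(modelMeasure j), (y : ℂ) ^ 1 ≠ x :=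
        ae_modelMeasure (p := fun y : ℂ => y ^ 1 ≠ x) ((ae_pow_ne 1 x one_pos).mono fun y h _ => h)
      filter_upwards [h1, ae_mem_openModel, hne] with y hy hyΩ hyx
      rw [pow_one] at hyx
      exact (mul_eq_zero.1 hy).resolve_left (sectorGreen_pos hx hyΩ hyx.symm).ne'
    refine Eventually.of_forall fun z => ?_
    rw [hvK z]
    refine (integral_congr_ae (g := fun _ => (0 : ℝ)) ?_).trans (integral_zero _ _)
    filter_upwards [h2] with y hy
    rw [hy, mul_zero]
  · rw [← setIntegral_congr_fun (measurableSet_openModel j) (g := fun x => f (greenPotential g x) * ψ x)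
      (f := fun x => extendModel g x * ψ x) fun x hx => ?_,
      ← integral_fderiv_greenGradient hg.extendModel (fun y hy => extendModel_of_notMem hy) hψ hc hs]
    · refine setIntegral_congr_fun (measurableSet_openModel j) fun x hx => ?_
      have hgr : HasGradientAt (greenPotential g) (greenGradient j (extendModel g) x) x :=
        hasFDerivAt_greenPotential_of_mem hg hx
      simp only [hgr.gradient, inner_gradient_right]
      rfl
    · have e : greenPotential g x = v ⟨x, openModel_subset j hx⟩ := by
        rw [hu, extendModel_of_mem hx]
      simp only [e, extendModel_of_mem hx]
      simp only [hgdef, max_eq_left (hv0 _)]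

theorem forall_sin_two_pow_pos {θ : ℝ} (h0 : 0 < θ) {j : ℕ} (h : θ < π / 2 ^ j) :
    ∀ k ≤ j, 0 < Real.sin (2 ^ k * θ) := fun k hk => by
  refine Real.sin_pos_of_pos_of_lt_pi (by positivity) ?_
  rw [lt_div_iff₀ (by positivity)] at h
  calc 2 ^ k * θ ≤ 2 ^ j * θ := by gcongr; norm_num
    _ < π := by linarith

theorem lt_pi_div_two_pow_of_sin_pos {θ : ℝ} (h0 : -π < θ) (h1 : θ < 2 * π) {j : ℕ}
    (h : ∀ k ≤ j, 0 < Real.sin (2 ^ k * θ)) : 0 < θ ∧ θ < π / 2 ^ j := by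
  induction j with
  | zero =>
    have hs := h 0 le_rfl
    rw [pow_zero, one_mul] at hs
    rw [pow_zero, div_one]
    constructor
    · by_contra! hc
      exact hs.not_ge (Real.sin_nonpos_of_nonpos_of_neg_pi_le hc h0.le)
    · by_contra! hc
      have := Real.sin_nonneg_of_nonneg_of_le_pi (sub_nonneg.2 hc) (by linarith)
      rw [Real.sin_sub_pi] at this
      linarith
  | succ n ih =>
    obtain ⟨ih0, ih1⟩ := ih fun k hk => h k (hk.trans n.le_succ)
    refine ⟨ih0, ?_⟩
    have hs := h (n + 1) le_rfl
    rw [lt_div_iff₀ (by positivity)] at ih1 ⊢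
    by_contra! hc
    have := Real.sin_nonneg_of_nonneg_of_le_pi (x := 2 ^ (n + 1) * θ - π) (by linarith)
      (by rw [pow_succ]; linarith)
    rw [Real.sin_sub_pi] at this
    linarith

/-- The isometry of the plane carrying the sector with axis `x 1` to the sector with one edge
on the positive real axis. -/
noncomputable def sectorIsometry (θ : ℝ) : EuclideanSpace ℝ (Fin 2) ≃ₗᵢ[ℝ] ℂ :=
  Complex.orthonormalBasisOneI.repr.symm.trans
    (rotationLIE (ζ := Complex.exp ((θ - π / 2 : ℝ) * Complex.I)) (Complex.norm_exp_ofReal_mul_I _))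

theorem sectorIsometry_apply (θ : ℝ) (x : EuclideanSpace ℝ (Fin 2)) :
    sectorIsometry θ x = Complex.exp ((θ : ℝ) * Complex.I) * (⟨x 1, -x 0⟩ : ℂ) := by
  have e : Complex.exp ((θ - π / 2 : ℝ) * Complex.I) =
      Complex.exp ((θ : ℝ) * Complex.I) * (-Complex.I) := by
    rw [Complex.ofReal_sub, sub_mul, Complex.exp_sub, Complex.ofReal_div, Complex.ofReal_ofNat,
      Complex.exp_pi_div_two_mul_I, div_eq_mul_inv, Complex.inv_I]
  rw [sectorIsometry, LinearIsometryEquiv.trans_apply, rotationLIE_apply, e, mul_assoc]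
  congr 1
  apply Complex.ext <;> simp [Complex.orthonormalBasisOneI, Fin.sum_univ_two]

theorem preimage_openModel (j : ℕ) :
    sectorIsometry (π / 2 ^ (j + 1)) ⁻¹' openModel j = sector (j + 1) := by
  set θ : ℝ := π / 2 ^ (j + 1) with hθdef
  have hθ0 : 0 < θ := by positivity
  have hθ1 : θ ≤ π / 2 := by
    rw [hθdef]
    gcongr
    exact le_self_pow₀ one_le_two j.succ_ne_zero
  have h2θ : π / 2 ^ j = 2 * θ := by rw [hθdef, pow_succ]; field_simp
  have hsin : 0 < Real.sin θ := Real.sin_pos_of_pos_of_lt_pi hθ0 (by linarith [Real.pi_pos])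
  have hcos : 0 ≤ Real.cos θ := Real.cos_nonneg_of_neg_pi_div_two_le_of_le (by linarith) hθ1
  ext x
  have hnorm : ‖sectorIsometry θ x‖ = ‖x‖ := (sectorIsometry θ).norm_map x
  set y : ℂ := ⟨x 1, -x 0⟩ with hy
  set r : ℝ := ‖y‖
  set β : ℝ := y.arg
  have hπ := Real.pi_pos
  have hβ1 : β ≤ π := Complex.arg_le_pi y
  have hβ0 : -π < β := Complex.neg_pi_lt_arg y
  have hr : 0 ≤ r := norm_nonneg y
  have hx1 : x 1 = r * Real.cos β := (Complex.norm_mul_cos_arg y).symm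
  have hx0 : -x 0 = r * Real.sin β := (Complex.norm_mul_sin_arg y).symm
  have him : ∀ k : ℕ, ((sectorIsometry θ x) ^ 2 ^ k).im =
      r ^ 2 ^ k * Real.sin (2 ^ k * (θ + β)) := fun k => by
    have e : sectorIsometry θ x = r * Complex.exp ((θ + β : ℝ) * Complex.I) := by
      rw [sectorIsometry_apply, ← hy, ← Complex.norm_mul_exp_arg_mul_I y, Complex.ofReal_add,
        add_mul, Complex.exp_add]
      ring
    rw [e, mul_pow, ← Complex.exp_nat_mul, ← Complex.ofReal_pow, Complex.im_ofReal_mul, ← mul_assoc,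
      ← Complex.ofReal_natCast, ← Complex.ofReal_mul, Complex.exp_ofReal_mul_I_im, Nat.cast_pow,
      Nat.cast_ofNat]
  have hiff : Real.cos θ * |x 0| < Real.sin θ * x 1 ↔
      0 < r * Real.sin (θ + β) ∧ 0 < r * Real.sin (θ - β) := by
    have e1 : r * Real.sin (θ + β) = Real.sin θ * x 1 + Real.cos θ * (-x 0) := by
      rw [hx1, hx0, Real.sin_add]; ring
    have e2 : r * Real.sin (θ - β) = Real.sin θ * x 1 - Real.cos θ * (-x 0) := by
      rw [hx1, hx0, Real.sin_sub]; ring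
    rw [e1, e2, ← abs_of_nonneg hcos, ← abs_mul, abs_of_nonneg hcos, abs_lt]
    constructor <;> rintro ⟨h1, h2⟩ <;> constructor <;> linarith
  rw [mem_preimage, openModel, sector, mem_ofPred, mem_ofPred, hiff, hnorm, mem_ball_zero_iff]
  refine and_congr_right fun _ => ?_
  simp_rw [him]
  constructor
  · intro h
    have hr0 : 0 < r := hr.lt_of_ne fun h0 => by
      have := h 0 (Nat.zero_le j)
      simp [← h0] at this
    obtain ⟨h1, h2⟩ := lt_pi_div_two_pow_of_sin_pos (θ := θ + β) (by linarith)
      (by linarith) fun k hk => pos_of_mul_pos_right (h k hk) (by positivity)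
    rw [h2θ] at h2
    exact ⟨mul_pos hr0 (Real.sin_pos_of_pos_of_lt_pi h1 (by linarith)),
      mul_pos hr0 (Real.sin_pos_of_pos_of_lt_pi (by linarith) (by linarith))⟩
  · rintro ⟨h1, h2⟩
    have hr0 : 0 < r := hr.lt_of_ne fun h0 => by simp [← h0] at h1
    obtain ⟨h3, h4⟩ := lt_pi_div_two_pow_of_sin_pos (j := 0) (θ := θ + β) (by linarith)
      (by linarith) fun k hk => by
        rw [Nat.le_zero.1 hk, pow_zero, one_mul]; exact pos_of_mul_pos_right h1 hr
    obtain ⟨h5, h6⟩ := lt_pi_div_two_pow_of_sin_pos (j := 0) (θ := θ - β) (by linarith)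
      (by linarith) fun k hk => by
        rw [Nat.le_zero.1 hk, pow_zero, one_mul]; exact pos_of_mul_pos_right h2 hr
    exact fun k hk => mul_pos (by positivity)
      (forall_sin_two_pow_pos h3 (by rw [h2θ]; linarith) k hk)

theorem gradient_comp_linearIsometryEquiv {E F : Type*} [NormedAddCommGroup E]
    [InnerProductSpace ℝ E] [CompleteSpace E] [NormedAddCommGroup F] [InnerProductSpace ℝ F]
    [CompleteSpace F] (e : E ≃ₗᵢ[ℝ] F) (u : F → ℝ) (x : E) :
    gradient (u ∘ e) x = e.symm (gradient u (e x)) := by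
  refine ext_inner_right ℝ fun v => ?_
  have h : fderiv ℝ (u ∘ e) x = (fderiv ℝ u (e x)).comp (e.toContinuousLinearEquiv : E →L[ℝ] F) :=
    e.toContinuousLinearEquiv.comp_right_fderiv
  rw [inner_gradient_left, h, ← e.inner_map_map, e.apply_symm_apply, inner_gradient_left]
  rfl

/-- under (f₁), (f₂), (H₁), (H₂), (H₃), for every `m ≥ 1` the Dirichlet
problem `-Δu = f(u)` on the angular sector `A_m` has a positive weak solution. -/
theorem positive_solution_on_sector
    (f : ℝ → ℝ) (hcont : Continuous f) (hodd : ∀ s : ℝ, f (-s) = - f s)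
    (hf1 : ∃ C > 0, ∀ s : ℝ, |f s| ≤ C * Real.exp (4 * π * s ^ 2))
    (hf2 : Tendsto (fun s : ℝ => f s / s) (𝓝[≠] 0) (𝓝 0))
    (hH1 : ∃ s₀ > 0, ∃ M > 0, ∀ s : ℝ, s₀ ≤ |s| → 0 < primF f s ∧ primF f s ≤ M * |f s|)
    (hH2 : ∀ s : ℝ, s ≠ 0 → 0 < primF f s ∧ primF f s ≤ (1/2) * f s * s)
    (hH3 : Tendsto (fun s : ℝ => s * f s * Real.exp (-(4 * π * s ^ 2))) atTop atTop) :
    ∀ m : ℕ, 1 ≤ m →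
      ∃ u : EuclideanSpace ℝ (Fin 2) → ℝ,
        ContinuousOn u (closure (sector m)) ∧
        ContDiffOn ℝ 1 u (sector m) ∧
        (∀ x ∈ frontier (sector m), u x = 0) ∧
        (∀ x ∈ sector m, 0 < u x) ∧
        ∀ φ : EuclideanSpace ℝ (Fin 2) → ℝ, ContDiff ℝ (⊤ : ℕ∞) φ → HasCompactSupport φ →
          tsupport φ ⊆ sector m →
          (∫ x in sector m, ⟪gradient u x, gradient φ x⟫) =
            ∫ x in sector m, f (u x) * φ x := by
  intro m hm
  obtain ⟨j, rfl⟩ : ∃ j, m = j + 1 := ⟨m - 1, by omega⟩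
  have hpos : ∀ s, 0 < s → 0 < f s := fun s hs => by
    obtain ⟨h1, h2⟩ := hH2 s hs.ne'
    have h3 : 0 < f s * s := by linarith
    exact pos_of_mul_pos_left h3 hs.le
  obtain ⟨v, hvc, hv1, hv0, hvpos, hvw⟩ := exists_solution_openModel j
    (isCriticalNonlinearity_comp_max hcont hodd hf1 hf2 hH1 hpos hH3)
  set e := sectorIsometry (π / 2 ^ (j + 1)) with he
  have hS : sector (j + 1) = e ⁻¹' openModel j := (preimage_openModel j).symm
  have hSo : IsOpen (sector (j + 1)) := by
    rw [hS]; exact (isOpen_openModel j).preimage e.continuous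
  have hcl : closure (sector (j + 1)) ⊆ e ⁻¹' closedModel j := by
    refine closure_minimal ?_ ((isClosed_closedModel j).preimage e.continuous)
    rw [hS]; exact preimage_mono (openModel_subset j)
  have hint : ∀ F : ℂ → ℝ, ∫ x in sector (j + 1), F (e x) = ∫ y in openModel j, F y := fun F => by
    rw [hS]
    exact e.measurePreserving.setIntegral_preimage_emb e.toHomeomorph.measurableEmbedding F _
  refine ⟨v ∘ e, hvc.comp e.continuous.continuousOn hcl,
    hv1.comp e.contDiff.contDiffOn hS.subset, fun x hx => hv0 _ fun h => ?_,
    fun x hx => hvpos _ (by rw [hS] at hx; exact hx), fun φ hφ hc hs => ?_⟩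
  · rw [hSo.frontier_eq, hS] at hx
    exact hx.2 h
  · set ψ : ℂ → ℝ := φ ∘ e.symm with hψdef
    have hφψ : φ = ψ ∘ e := by ext x; simp [hψdef]
    have hψ : ContDiff ℝ 1 ψ := (hφ.of_le (by simp)).comp e.symm.contDiff
    have hψc : HasCompactSupport ψ := hc.comp_homeomorph e.symm.toHomeomorph
    have hψs : tsupport ψ ⊆ openModel j := by
      have h : tsupport ψ = e.symm ⁻¹' tsupport φ :=
        tsupport_comp_eq_preimage φ e.symm.toHomeomorph
      rw [h]
      intro y hy
      have := hs hy
      rw [hS, mem_preimage, e.apply_symm_apply] at this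
      exact this
    have h1 := hvw ψ hψ hψc hψs
    rw [← hint, ← hint] at h1
    rw [hφψ]
    simp_rw [gradient_comp_linearIsometryEquiv, e.symm.inner_map_map]
    exact h1
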